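/- Let 𝒞 be a hereditary class of graphs. The following are equivalent: (i) 𝒞 is weakly χ_p-bounded for every positive integer p; (ii) 𝒞 and all the classes ITM_r^e(𝒞) (r ≥ 1) are χ-bounded; (iii) 𝒞 is χ-bounded and for every positive integer r, d̄(ITM_r^e(𝒞)) < ∞; (iv) 𝒞 is χ-bounded and for each positive integer p there is a function f_p such that every G ∈ 𝒞 satisfies χ_p(G) ≤ f_p(bω(G)); (v) 𝒞 is χ-bounded and for each positive integer s the class {G ∈ 𝒞 : G is K_{s,s}-free} is strongly χ_p-bounded for every positive integer p. -/

import Mathlib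

open SimpleGraph

/-! ## Basic containment relations between graphs -/

/-- `H` is isomorphic to a (not necessarily induced) subgraph of `G`. -/
def IsSubgraphOf {V W : Type*} (H : SimpleGraph V) (G : SimpleGraph W) : Prop :=
  ∃ f : H →g G, Function.Injective f

/-- `H` is isomorphic to an induced subgraph of `G`. -/
def IsInducedSubgraphOf {V W : Type*} (H : SimpleGraph V) (G : SimpleGraph W) : Prop :=
  Nonempty (H ↪g G)

/-- The clique number `ω(G)`: the largest `m` such that `K_m` is a subgraph of `G`. -/
noncomputable def omegaNum {V : Type*} (G : SimpleGraph V) : ℕ :=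
  sSup {m | IsSubgraphOf (⊤ : SimpleGraph (Fin m)) G}

/-- The chromatic number `χ(G)` (as a natural number). -/
noncomputable def chi {V : Type*} (G : SimpleGraph V) : ℕ :=
  sInf {N | G.Colorable N}

/-! ## Tree-depth and the invariants `χ_p` -/

/-- A forest order: a partial order in which the down-set of every element is a chain.
Such orders are exactly the ancestor orders of rooted forests. -/
def IsForestOrder {V : Type*} (r : V → V → Prop) : Prop :=
  (∀ v, r v v) ∧ (∀ u v, r u v → r v u → u = v) ∧
  (∀ u v w, r u v → r v w → r u w) ∧
  (∀ u v w, r u w → r v w → r u v ∨ r v u)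

/-- `G` has tree-depth at most `h`: `G` is a subgraph of the closure of a rooted forest
of height at most `h` (height = maximum number of vertices on a root-to-leaf path). -/
def TreeDepthLE {V : Type*} (G : SimpleGraph V) (h : ℕ) : Prop :=
  ∃ r : V → V → Prop, IsForestOrder r ∧
    (∀ u v, G.Adj u v → r u v ∨ r v u) ∧
    (∀ v, {u | r u v}.ncard ≤ h)

/-- The tree-depth `td(G)`. -/
noncomputable def treeDepth {V : Type*} (G : SimpleGraph V) : ℕ :=
  sInf {h | TreeDepthLE G h}

/-- `χ_p(G)`: the least number of colors of a vertex coloring such that every set `I` of at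
most `p` colors induces a subgraph of tree-depth at most `|I|`. -/
noncomputable def chiP {V : Type*} (G : SimpleGraph V) (p : ℕ) : ℕ :=
  sInf {N | ∃ c : V → Fin N, ∀ I : Finset (Fin N), I.card ≤ p →
    TreeDepthLE (G.induce {v | c v ∈ I}) I.card}

/-! ## Star colorings -/

/-- A star coloring: a proper coloring with no path on `4` vertices using only two colors. -/
def IsStarColoring {V α : Type*} (G : SimpleGraph V) (c : V → α) : Prop :=
  (∀ u v, G.Adj u v → c u ≠ c v) ∧
  ∀ x y z w : V, G.Adj x y → G.Adj y z → G.Adj z w →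
    x ≠ z → y ≠ w → x ≠ w → ¬(c x = c z ∧ c y = c w)

/-- The star chromatic number `χ_s(G)`. -/
noncomputable def starChi {V : Type*} (G : SimpleGraph V) : ℕ :=
  sInf {N | ∃ c : V → Fin N, IsStarColoring G c}

/-! ## Subdivisions -/

/-- The edges of a graph on `Fin n`, presented as increasingly ordered pairs. -/
def Edges {n : ℕ} (H : SimpleGraph (Fin n)) : Type :=
  {p : Fin n × Fin n // p.1 < p.2 ∧ H.Adj p.1 p.2}

/-- Base relation of the subdivision of `H`, where the edge `e` receives `t e` internal
vertices. -/
def subdivRel {n : ℕ} (H : SimpleGraph (Fin n)) (t : Edges H → ℕ) :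
    (Fin n ⊕ Σ e : Edges H, Fin (t e)) → (Fin n ⊕ Σ e : Edges H, Fin (t e)) → Prop
  | Sum.inl u, Sum.inl v => ∃ h : u < v ∧ H.Adj u v, t ⟨(u, v), h⟩ = 0
  | Sum.inl u, Sum.inr ⟨e, i⟩ =>
      (u = e.1.1 ∧ (i : ℕ) = 0) ∨ (u = e.1.2 ∧ (i : ℕ) + 1 = t e)
  | Sum.inr ⟨e, i⟩, Sum.inr ⟨e', j⟩ => e = e' ∧ (i : ℕ) + 1 = (j : ℕ)
  | _, _ => False

/-- The subdivision of `H` in which each edge `e` is replaced by a path with exactly `t e`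
internal vertices. In particular `Subdiv H (fun _ => r)` is the `r`-subdivision `H^{(r)}`,
and the `(≤ r)`-subdivisions of `H` are the graphs `Subdiv H t` with `t e ≤ r` for all `e`. -/
def Subdiv {n : ℕ} (H : SimpleGraph (Fin n)) (t : Edges H → ℕ) :
    SimpleGraph (Fin n ⊕ Σ e : Edges H, Fin (t e)) :=
  SimpleGraph.fromRel (subdivRel H t)

/-- `H ∈ TM_r(G)`: some `(≤ r)`-subdivision of `H` is a subgraph of `G`. -/
def MemTM {W : Type*} (r : ℕ) (G : SimpleGraph W) {n : ℕ} (H : SimpleGraph (Fin n)) : Prop :=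
  ∃ t : Edges H → ℕ, (∀ e, t e ≤ r) ∧ IsSubgraphOf (Subdiv H t) G

/-- `H ∈ ITM_r^e(G)`: the exact `r`-subdivision of `H` is an induced subgraph of `G`. -/
def MemITM {W : Type*} (r : ℕ) (G : SimpleGraph W) {n : ℕ} (H : SimpleGraph (Fin n)) : Prop :=
  IsInducedSubgraphOf (Subdiv H (fun _ => r)) G

/-- `ω(TM_r(G))`: the supremum of the clique numbers of the graphs in `TM_r(G)`. -/
noncomputable def omegaTM {W : Type*} (r : ℕ) (G : SimpleGraph W) : ℕ :=
  sSup {m | ∃ (k : ℕ) (H : SimpleGraph (Fin k)), MemTM r G H ∧ omegaNum H = m}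

/-- The biclique number `bω(G)`: the largest `s` with `K_{s,s}` a subgraph of `G`. -/
noncomputable def bomega {V : Type*} (G : SimpleGraph V) : ℕ :=
  sSup {s | IsSubgraphOf (completeBipartiteGraph (Fin s) (Fin s)) G}

/-- The average degree `d̄(G) = 2|E(G)|/|V(G)|`. -/
noncomputable def avgDeg {n : ℕ} (G : SimpleGraph (Fin n)) : ℝ :=
  2 * (G.edgeSet.ncard : ℝ) / n

/-! ## Classes of graphs -/

/-- A class of (finite, simple) graphs: for each `n`, a set of graphs on `Fin n`.
Classes are implicitly closed under isomorphism via the relations used below. -/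
def GraphClass := ∀ n : ℕ, Set (SimpleGraph (Fin n))

/-- A hereditary class: closed under induced subgraphs (hence under isomorphism). -/
def Hereditary (C : GraphClass) : Prop :=
  ∀ ⦃n m : ℕ⦄ (G : SimpleGraph (Fin n)) (H : SimpleGraph (Fin m)),
    G ∈ C n → IsInducedSubgraphOf H G → H ∈ C m

/-- A monotone class: closed under subgraphs (hence under isomorphism). -/
def MonotoneClass (C : GraphClass) : Prop :=
  ∀ ⦃n m : ℕ⦄ (G : SimpleGraph (Fin n)) (H : SimpleGraph (Fin m)),
    G ∈ C n → IsSubgraphOf H G → H ∈ C m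

/-- `H ∈ TM_r(𝒞)`. -/
def MemTMClass (r : ℕ) (C : GraphClass) {m : ℕ} (H : SimpleGraph (Fin m)) : Prop :=
  ∃ (n : ℕ) (G : SimpleGraph (Fin n)), G ∈ C n ∧ MemTM r G H

/-- `H ∈ ITM_r^e(𝒞)`. -/
def MemITMClass (r : ℕ) (C : GraphClass) {m : ℕ} (H : SimpleGraph (Fin m)) : Prop :=
  ∃ (n : ℕ) (G : SimpleGraph (Fin n)), G ∈ C n ∧ MemITM r G H

/-- `𝒞` is `χ`-bounded: `χ(H) ≤ f(ω(H))` for every induced subgraph `H` of a graph of `𝒞`. -/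
def ChiBounded (C : GraphClass) : Prop :=
  ∃ f : ℕ → ℕ, ∀ ⦃n : ℕ⦄ (G : SimpleGraph (Fin n)), G ∈ C n →
    ∀ ⦃m : ℕ⦄ (H : SimpleGraph (Fin m)), IsInducedSubgraphOf H G →
      chi H ≤ f (omegaNum H)

/-- `𝒞` has bounded expansion: for every `r`, `d̄(TM_r(𝒞)) < ∞`. -/
def BoundedExpansion (C : GraphClass) : Prop :=
  ∀ r : ℕ, ∃ d : ℝ, ∀ ⦃m : ℕ⦄ (H : SimpleGraph (Fin m)), MemTMClass r C H → avgDeg H ≤ d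

/-- `𝒞` has `ω`-bounded expansion. -/
def OmegaBoundedExpansion (C : GraphClass) : Prop :=
  ∃ f : ℕ → ℕ → ℝ, ∀ ⦃n : ℕ⦄ (G : SimpleGraph (Fin n)), G ∈ C n →
    ∀ (r : ℕ) ⦃m : ℕ⦄ (H : SimpleGraph (Fin m)), MemTM r G H →
      avgDeg H ≤ f (omegaNum G) r

/-- `𝒞` is nowhere dense: for every `r`, `ω(TM_r(𝒞)) < ∞`. -/
def NowhereDense (C : GraphClass) : Prop :=
  ∀ r : ℕ, ∃ c : ℕ, ∀ ⦃m : ℕ⦄ (H : SimpleGraph (Fin m)), MemTMClass r C H → omegaNum H ≤ c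

/-- `𝒞` is strongly `χ_p`-bounded: `χ_p(G) ≤ f_p(ω(G))` on `𝒞`. -/
def StronglyChiPBounded (C : GraphClass) (p : ℕ) : Prop :=
  ∃ f : ℕ → ℕ, ∀ ⦃n : ℕ⦄ (G : SimpleGraph (Fin n)), G ∈ C n → chiP G p ≤ f (omegaNum G)

/-- `𝒞` is weakly `χ_p`-bounded: `χ_p(G) ≤ g_p(ω(TM_{p-1}(G)))` on `𝒞`. -/
def WeaklyChiPBounded (C : GraphClass) (p : ℕ) : Prop :=
  ∃ g : ℕ → ℕ, ∀ ⦃n : ℕ⦄ (G : SimpleGraph (Fin n)), G ∈ C n → chiP G p ≤ g (omegaTM (p - 1) G)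

/-! ## Directed graphs, orientations and restricted dualities -/

/-- Existence of a homomorphism between directed graphs presented as binary relations. -/
def DigraphHomEx {n m : ℕ} (A : Fin n → Fin n → Prop) (B : Fin m → Fin m → Prop) : Prop :=
  ∃ f : Fin n → Fin m, ∀ u v, A u v → B (f u) (f v)

/-- `A` is an orientation of the graph `G`. -/
def IsOrientationOf {n : ℕ} (A : Fin n → Fin n → Prop) (G : SimpleGraph (Fin n)) : Prop :=
  (∀ u v, ¬(A u v ∧ A v u)) ∧ (∀ u v, G.Adj u v ↔ (A u v ∨ A v u))

/-- A directed graph is acyclic if it has no directed cycle. -/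
def IsAcyclicDigraph {n : ℕ} (A : Fin n → Fin n → Prop) : Prop :=
  ∀ v, ¬ Relation.TransGen A v v

/-- The directed graph `F` has a restricted dual for the class of all orientations of the
graphs of `𝒞`. -/
def HasRestrictedDualForOrientations (C : GraphClass) {nF : ℕ}
    (F : Fin nF → Fin nF → Prop) : Prop :=
  ∃ (m : ℕ) (D : Fin m → Fin m → Prop),
    ¬ DigraphHomEx F D ∧
    ∀ ⦃n : ℕ⦄ (A : Fin n → Fin n → Prop) (G : SimpleGraph (Fin n)),
      G ∈ C n → IsOrientationOf A G →
      (¬ DigraphHomEx F A ↔ DigraphHomEx A D)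

/-! ## Holes -/

/-- The number `h_g(G)` of holes of length `g` in `G`, i.e. of vertex subsets inducing a
cycle on `g` vertices. -/
noncomputable def holeCount {n : ℕ} (g : ℕ) (G : SimpleGraph (Fin n)) : ℕ :=
  {S : Set (Fin n) | Nonempty (G.induce S ≃g SimpleGraph.cycleGraph g)}.ncard

/-- `G` is even hole-free: it has no induced cycle of even length at least `4`. -/
def EvenHoleFree {n : ℕ} (G : SimpleGraph (Fin n)) : Prop :=
  ∀ g : ℕ, 4 ≤ g → Even g → holeCount g G = 0

section Counting

open scoped Classical
open Finset

/-- The number of colorings taking the value `0` on `P` and avoiding it on `N`. -/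
lemma card_colorings_zero_on {V : Type} [Fintype V] (q : ℕ) {P N : Finset V} (h : Disjoint P N) :
    #{f : V → Fin (q + 1) | (∀ x ∈ P, f x = 0) ∧ ∀ x ∈ N, f x ≠ 0} * (q + 1) ^ (#P + #N)
      = q ^ #N * (q + 1) ^ Fintype.card V := by
  have e : ({f : V → Fin (q + 1) | (∀ x ∈ P, f x = 0) ∧ ∀ x ∈ N, f x ≠ 0} : Finset _)
      = Fintype.piFinset (fun x => if x ∈ P then ({0} : Finset (Fin (q + 1)))
          else if x ∈ N then univ.erase 0 else univ) := by
    ext f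
    simp only [mem_filter, mem_univ, true_and, Fintype.mem_piFinset]
    constructor
    · rintro ⟨h1, h2⟩ x
      split_ifs with hP hN
      · simpa using h1 x hP
      · simpa using h2 x hN
      · simp
    · intro h1
      refine ⟨fun x hx => ?_, fun x hx => ?_⟩
      · simpa [hx] using h1 x
      · have hP : x ∉ P := fun hp => (Finset.disjoint_left.1 h hp) hx
        simpa [hx, hP] using h1 x
  rw [e, Fintype.card_piFinset]
  have e2 : ∀ x : V, #(if x ∈ P then ({0} : Finset (Fin (q + 1)))
          else if x ∈ N then univ.erase 0 else univ)
      = if x ∈ P then 1 else if x ∈ N then q else q + 1 := by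
    intro x
    split_ifs <;> simp
  have e3 : (q + 1) ^ (#P + #N) = ∏ x : V, if x ∈ P ∪ N then q + 1 else 1 := by
    rw [prod_ite_mem, univ_inter, prod_const, card_union_of_disjoint h]
  have e4 : q ^ #N = ∏ x : V, if x ∈ N then q else 1 := by
    rw [prod_ite_mem, univ_inter, prod_const]
  have e5 : (q + 1) ^ Fintype.card V = ∏ x : V, (q + 1) := by
    rw [prod_const, Finset.card_univ]
  simp_rw [e2]
  rw [e3, e4, e5, ← prod_mul_distrib, ← prod_mul_distrib]
  refine prod_congr rfl fun x _ => ?_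
  by_cases hP : x ∈ P
  · have hN : x ∉ N := fun hn => (Finset.disjoint_left.1 h hP) hn
    simp [hP, hN]
  · by_cases hN : x ∈ N <;> simp [hP, hN, mul_comm]

/-- Sampling a set `R` of vertices uniformly at random: if each `e ∈ E` requires the vertices in
`P e` and forbids those in `N e`, some `R` satisfies a positive proportion of the requirements. -/
lemma exists_sample {V ι : Type} [Fintype V] (E : Finset ι) (P N : ι → Finset V) (t : ℕ)
    (hd : ∀ e ∈ E, Disjoint (P e) (N e)) (ht : ∀ e ∈ E, #(P e) + #(N e) ≤ t) :
    ∃ R : Finset V, #E ≤ 2 ^ t * #{e ∈ E | P e ⊆ R ∧ Disjoint (N e) R} := by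
  by_contra hcon
  push Not at hcon
  let F : ι → Finset (V → Fin 2) := fun e => {f | (∀ x ∈ P e, f x = 0) ∧ ∀ x ∈ N e, f x ≠ 0}
  have h1 : ∀ e ∈ E, 2 ^ Fintype.card V ≤ #(F e) * 2 ^ t := by
    intro e he
    have := card_colorings_zero_on 1 (hd e he)
    simp only [one_pow, one_mul, Nat.reduceAdd] at this
    rw [← this]
    exact Nat.mul_le_mul le_rfl (Nat.pow_le_pow_right (by norm_num) (ht e he))
  have h2 : ∑ e ∈ E, #(F e) = ∑ f : V → Fin 2, #{e ∈ E | f ∈ F e} := by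
    have := sum_card_bipartiteAbove_eq_sum_card_bipartiteBelow (s := E)
      (t := (univ : Finset (V → Fin 2))) (fun e f => f ∈ F e)
    simpa [bipartiteAbove, bipartiteBelow] using this
  have h3 : ∀ f : V → Fin 2, 2 ^ t * #{e ∈ E | f ∈ F e} < #E := by
    intro f
    refine lt_of_le_of_lt (Nat.mul_le_mul le_rfl (card_le_card ?_)) (hcon {x | f x = 0})
    intro e he
    simp only [F, mem_filter, mem_univ, true_and] at he ⊢
    refine ⟨he.1, fun x hx => by simpa using he.2.1 x hx, ?_⟩
    rw [Finset.disjoint_left]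
    intro x hx
    simpa using he.2.2 x hx
  have h4 : #E * 2 ^ Fintype.card V ≤ (∑ e ∈ E, #(F e)) * 2 ^ t := by
    rw [sum_mul, ← smul_eq_mul, ← sum_const]
    exact sum_le_sum h1
  have h5 : (∑ f : V → Fin 2, #{e ∈ E | f ∈ F e}) * 2 ^ t < #E * 2 ^ Fintype.card V := by
    rw [sum_mul]
    calc _ < ∑ f : V → Fin 2, #E := by
          refine sum_lt_sum_of_nonempty univ_nonempty fun f _ => ?_
          rw [mul_comm]
          exact h3 f
      _ = _ := by simp [mul_comm]
  rw [h2] at h4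
  omega

/-- If every nonempty vertex set `S` has a member `v` with `Q v S`, there is an ordering in which
`Q` holds at every vertex with respect to its initial segment. -/
lemma exists_ordering {V : Type} [Fintype V] (Q : V → Finset V → Prop)
    (hQ : ∀ S : Finset V, S.Nonempty → ∃ v ∈ S, Q v S) :
    ∃ ρ : V → ℕ, Function.Injective ρ ∧ ∀ v, Q v {u | ρ u ≤ ρ v} := by
  have key : ∀ n, ∀ S : Finset V, #S = n → ∃ ρ : V → ℕ, (∀ u ∈ S, ρ u < n) ∧
      (∀ u ∈ S, ∀ v ∈ S, ρ u = ρ v → u = v) ∧ ∀ v ∈ S, Q v {u ∈ S | ρ u ≤ ρ v} := by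
    intro n
    induction n with
    | zero =>
      intro S hS
      rw [card_eq_zero] at hS
      subst hS
      exact ⟨fun _ => 0, by simp, by simp, by simp⟩
    | succ n ih =>
      intro S hS
      obtain ⟨v, hv, hQv⟩ := hQ S (card_pos.1 (by omega))
      obtain ⟨ρ, h1, h2, h3⟩ := ih (S.erase v) (by rw [card_erase_of_mem hv]; omega)
      have hlt : ∀ u ∈ S, u ≠ v → ρ u < n := fun u hu huv => h1 u (mem_erase.2 ⟨huv, hu⟩)
      refine ⟨fun u => if u = v then n else ρ u, ?_, ?_, ?_⟩
      · intro u hu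
        by_cases huv : u = v
        · simp [huv]
        · have := hlt u hu huv
          simp only [huv, if_false]; omega
      · intro u hu w hw
        by_cases huv : u = v <;> by_cases hwv : w = v
        · simp [huv, hwv]
        · have := hlt w hw hwv
          simp only [huv, hwv, if_true, if_false]; omega
        · have := hlt u hu huv
          simp only [huv, hwv, if_true, if_false]; omega
        · simp only [huv, hwv, if_false]
          exact h2 u (mem_erase.2 ⟨huv, hu⟩) w (mem_erase.2 ⟨hwv, hw⟩)
      · intro w hw
        by_cases hwv : w = v
        · subst hwv
          convert hQv using 1
          ext u
          simp only [mem_filter, if_true]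
          refine ⟨fun h => h.1, fun h => ⟨h, ?_⟩⟩
          by_cases huw : u = w
          · simp [huw]
          · simp only [huw, if_false]; exact (hlt u h huw).le
        · have hw' := hlt w hw hwv
          convert h3 w (mem_erase.2 ⟨hwv, hw⟩) using 1
          ext u
          simp only [mem_filter, mem_erase, hwv, if_false]
          by_cases huv : u = v
          · simp only [huv, if_true]
            constructor
            · rintro ⟨_, h⟩; omega
            · rintro ⟨⟨h, _⟩, _⟩; exact absurd rfl h
          · simp [huv]
  obtain ⟨ρ, _, h2, h3⟩ := key _ (univ : Finset V) rfl
  exact ⟨ρ, fun u v h => h2 u (mem_univ _) v (mem_univ _) h, fun v => h3 v (mem_univ _)⟩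

/-- Greedy coloring along an ordering. -/
lemma exists_greedy_coloring {V : Type} (ρ : V → ℕ)
    (conf : V → Finset V) (k : ℕ) (hk : ∀ v, #(conf v) ≤ k) (hlt : ∀ v, ∀ u ∈ conf v, ρ u < ρ v) :
    ∃ c : V → Fin (k + 1), ∀ v, ∀ u ∈ conf v, c u ≠ c v := by
  have free : ∀ (c : V → Fin (k + 1)) (v : V), ∃ x, ∀ u ∈ conf v, c u ≠ x := by
    intro c v
    have : #((conf v).image c) < #(univ : Finset (Fin (k + 1))) := by
      rw [card_univ, Fintype.card_fin]
      exact Nat.lt_succ_of_le (card_image_le.trans (hk v))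
    obtain ⟨x, -, hx⟩ := exists_mem_notMem_of_card_lt_card this
    exact ⟨x, fun u hu h => hx (mem_image.2 ⟨u, hu, h⟩)⟩
  let step : (v : V) → ((u : V) → ρ u < ρ v → Fin (k + 1)) → Fin (k + 1) := fun v rec =>
    (free (fun u => if h : ρ u < ρ v then rec u h else 0) v).choose
  have wf : WellFounded (fun u v : V => ρ u < ρ v) := (measure ρ).wf
  refine ⟨wf.fix step, fun v u hu => ?_⟩
  have hv : wf.fix step v = step v (fun u _ => wf.fix step u) := wf.fix_eq step v
  have := (free (fun u => if h : ρ u < ρ v then wf.fix step u else 0) v).choose_spec u hu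
  rw [hv]
  simpa only [hlt v u hu, dif_pos] using this

/-- A relation in which every subset has a vertex of low degree has a large independent set. -/
lemma exists_independent {V : Type} (r : V → V → Prop) (hs : ∀ u v, r u v → r v u) (D : ℕ)
    (hirr : ∀ v, ¬ r v v) (S : Finset V)
    (h : ∀ T ⊆ S, T.Nonempty → ∃ v ∈ T, #{u ∈ T | r v u} ≤ D) :
    ∃ S' ⊆ S, (∀ u ∈ S', ∀ v ∈ S', ¬ r u v) ∧ #S ≤ (D + 1) * #S' := by
  induction hn : #S using Nat.strong_induction_on generalizing S with
  | _ n ih =>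
    rcases S.eq_empty_or_nonempty with rfl | hne
    · exact ⟨∅, by simp, by simp, by simp at hn; simp [← hn]⟩
    obtain ⟨v, hv, hdeg⟩ := h S le_rfl hne
    let T : Finset V := {u ∈ S | u ≠ v ∧ ¬ r v u}
    have hTS : T ⊆ S := filter_subset _ _
    have hTlt : #T < #S := card_lt_card ⟨hTS, fun hh => by
      have := hh hv
      simp [T] at this⟩
    obtain ⟨S', h1, h2, h3⟩ := ih #T (hn ▸ hTlt) T
      (fun T' hT' => h T' (hT'.trans hTS)) rfl
    have hvS' : v ∉ S' := fun hh => by simpa [T] using h1 hh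
    refine ⟨insert v S', insert_subset hv (h1.trans hTS), ?_, ?_⟩
    · intro x hx y hy
      rw [mem_insert] at hx hy
      rcases hx with rfl | hx <;> rcases hy with rfl | hy
      · exact hirr _
      · have := h1 hy
        simp only [T, mem_filter] at this
        exact this.2.2
      · have := h1 hx
        simp only [T, mem_filter] at this
        exact fun h => this.2.2 (hs _ _ h)
      · exact h2 x hx y hy
    · have hsub : S ⊆ T ∪ ({v} ∪ {u ∈ S | r v u}) := by
        intro u hu
        simp only [T, mem_union, mem_filter, mem_singleton]
        tauto
      have := (card_le_card hsub).trans ((card_union_le _ _).trans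
        (Nat.add_le_add_left (card_union_le _ _) _))
      rw [card_insert_of_notMem hvS', mul_add, ← hn]
      simp only [card_singleton] at this
      omega

end Counting

section BipartiteSampling

open scoped Classical
open Finset

/-- The number of edges between `A` and `B`. -/
noncomputable def edgesBetween {V : Type} (G : SimpleGraph V) (A B : Finset V) : ℕ :=
  ∑ a ∈ A, #{b ∈ B | G.Adj a b}

lemma edgesBetween_comm {V : Type} (G : SimpleGraph V) (A B : Finset V) :
    edgesBetween G A B = edgesBetween G B A := by
  have := sum_card_bipartiteAbove_eq_sum_card_bipartiteBelow (s := A) (t := B) (fun a b => G.Adj a b)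
  simp only [bipartiteAbove, bipartiteBelow] at this
  rw [edgesBetween, edgesBetween, this]
  exact sum_congr rfl fun b _ => by simp_rw [G.adj_comm]

lemma edgesBetween_le {V : Type} (G : SimpleGraph V) (A B : Finset V) :
    edgesBetween G A B ≤ #A * #B := by
  rw [edgesBetween, ← smul_eq_mul, ← sum_const]
  exact sum_le_sum fun a _ => card_filter_le _ _

lemma edgesBetween_erase {V : Type} (G : SimpleGraph V) (A B : Finset V) {a : V} (ha : a ∈ A) :
    edgesBetween G (A.erase a) B + #{b ∈ B | G.Adj a b} = edgesBetween G A B := by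
  rw [edgesBetween, edgesBetween, sum_erase_add _ _ ha]

/-- A dense pair contains a pair in which every vertex of either side has degree at least `q` while
the total number of edges is less than `(q + 1)` times the number of vertices. -/
lemma exists_balanced_pair {V : Type} (G : SimpleGraph V) (D : ℕ) (A B : Finset V)
    (h : D * (#A + #B) < edgesBetween G A B) :
    ∃ q ≥ D, ∃ A₀ ⊆ A, ∃ B₀ ⊆ B, 0 < #A₀ + #B₀ ∧
      edgesBetween G A₀ B₀ < (q + 1) * (#A₀ + #B₀) ∧
      (∀ a ∈ A₀, q ≤ #{b ∈ B₀ | G.Adj a b}) ∧ (∀ b ∈ B₀, q ≤ #{a ∈ A₀ | G.Adj b a}) := by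
  let Pq : ℕ → Prop := fun q => ∃ A₀ ⊆ A, ∃ B₀ ⊆ B, 0 < #A₀ + #B₀ ∧
    q * (#A₀ + #B₀) ≤ edgesBetween G A₀ B₀
  have hPD : Pq D := by
    refine ⟨A, le_rfl, B, le_rfl, ?_, h.le⟩
    by_contra h0
    have := edgesBetween_le G A B
    have hA : #A = 0 := by omega
    rw [hA, zero_mul] at this
    omega
  have hbound : ∀ q, Pq q → q ≤ #A * #B := by
    rintro q ⟨A₀, hA, B₀, hB, hpos, hle⟩
    calc q ≤ q * (#A₀ + #B₀) := Nat.le_mul_of_pos_right _ hpos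
      _ ≤ #A₀ * #B₀ := hle.trans (edgesBetween_le _ _ _)
      _ ≤ _ := Nat.mul_le_mul (card_le_card hA) (card_le_card hB)
  let q := Nat.findGreatest Pq (#A * #B)
  have hPq : Pq q := Nat.findGreatest_spec (hbound D hPD) hPD
  have hDq : D ≤ q := Nat.le_findGreatest (hbound D hPD) hPD
  have hmax : ¬ Pq (q + 1) := fun hh => by
    have := Nat.le_findGreatest (hbound _ hh) hh
    change q + 1 ≤ q at this
    omega
  have hPn : ∃ n, ∃ A₀ ⊆ A, ∃ B₀ ⊆ B, 0 < n ∧ #A₀ + #B₀ = n ∧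
      q * n ≤ edgesBetween G A₀ B₀ := by
    obtain ⟨A₀, hA, B₀, hB, hpos, hle⟩ := hPq
    exact ⟨_, A₀, hA, B₀, hB, hpos, rfl, hle⟩
  obtain ⟨A₀, hA, B₀, hB, hpos, hn, hle⟩ := Nat.find_spec hPn
  have hmin := fun m => @Nat.find_min _ _ hPn m
  set n := Nat.find hPn
  refine ⟨q, hDq, A₀, hA, B₀, hB, by omega, ?_, ?_, ?_⟩
  · by_contra hh
    exact hmax ⟨A₀, hA, B₀, hB, by omega, not_lt.1 hh⟩
  · intro a ha
    by_contra hlt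
    push Not at hlt
    have he := edgesBetween_erase G A₀ B₀ ha
    have hc := card_erase_of_mem ha
    have hca := card_pos.2 ⟨a, ha⟩
    have hqn : q * n = q * (n - 1) + q := by
      obtain ⟨m, hm⟩ : ∃ m, n = m + 1 := ⟨n - 1, by omega⟩
      rw [hm]; simp [mul_add]
    by_cases h1 : n = 1
    · have : #B₀ = 0 := by omega
      have h2 := edgesBetween_le G A₀ B₀
      rw [this, mul_zero] at h2
      have : q * n = q := by rw [h1, mul_one]
      omega
    · exact hmin (n - 1) (by omega) ⟨A₀.erase a, (erase_subset _ _).trans hA, B₀, hB,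
        by omega, by omega, by omega⟩
  · intro a ha
    by_contra hlt
    push Not at hlt
    rw [edgesBetween_comm] at hle
    have he := edgesBetween_erase G B₀ A₀ ha
    have hc := card_erase_of_mem ha
    have hca := card_pos.2 ⟨a, ha⟩
    have hqn : q * n = q * (n - 1) + q := by
      obtain ⟨m, hm⟩ : ∃ m, n = m + 1 := ⟨n - 1, by omega⟩
      rw [hm]; simp [mul_add]
    by_cases h1 : n = 1
    · have : #A₀ = 0 := by omega
      have h2 := edgesBetween_le G B₀ A₀
      rw [this, mul_zero] at h2
      have : q * n = q := by rw [h1, mul_one]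
      omega
    · exact hmin (n - 1) (by omega) ⟨A₀, hA, B₀.erase a, (erase_subset _ _).trans hB,
        by omega, by omega, by rw [edgesBetween_comm]; omega⟩

/-- The number of colorings with exactly `s` elements of `N` colored `0`, when
`2 * s ≤ q ≤ #N ≤ 8 * q`, is a positive proportion of all colorings with `16 * q` colors. -/
lemma card_colorings_exactly {V : Type} [Fintype V] (s q : ℕ) (hq : 1 ≤ q) (hsq : 2 * s ≤ q)
    (N : Finset V) (h1 : q ≤ #N) (h2 : #N ≤ 8 * q) (Q : ℕ) (hQ : Q + 1 = 16 * q) :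
    (Q + 1) ^ Fintype.card V ≤ (2 * 32 ^ s * s.factorial) *
      #{f : V → Fin (Q + 1) | #{x ∈ N | f x = 0} = s} := by
  have hunion : ({f : V → Fin (Q + 1) | #{x ∈ N | f x = 0} = s} : Finset _)
      = (N.powersetCard s).biUnion (fun P => {f : V → Fin (Q + 1) | (∀ x ∈ P, f x = 0) ∧
          ∀ x ∈ N \ P, f x ≠ 0}) := by
    ext f
    simp only [mem_filter, mem_univ, true_and, mem_biUnion, mem_powersetCard, mem_sdiff]
    constructor
    · intro h
      refine ⟨{x ∈ N | f x = 0}, ⟨filter_subset _ _, h⟩, fun x hx => (mem_filter.1 hx).2,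
        fun x hx h0 => hx.2 (mem_filter.2 ⟨hx.1, h0⟩)⟩
    · rintro ⟨P, ⟨hP, hc⟩, h3, h4⟩
      rw [← hc]
      congr 1
      ext x
      simp only [mem_filter]
      refine ⟨fun h => ?_, fun h => ⟨hP h, h3 x h⟩⟩
      by_contra hx
      exact h4 x ⟨h.1, hx⟩ h.2
  have hdisj : ((N.powersetCard s : Finset (Finset V)) : Set (Finset V)).PairwiseDisjoint
      (fun P => ({f : V → Fin (Q + 1) | (∀ x ∈ P, f x = 0) ∧
          ∀ x ∈ N \ P, f x ≠ 0} : Finset (V → Fin (Q + 1)))) := by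
    have aux : ∀ P ∈ N.powersetCard s, ∀ f : V → Fin (Q + 1), ((∀ x ∈ P, f x = 0) ∧
          ∀ x ∈ N \ P, f x ≠ 0) → P = {x ∈ N | f x = 0} := by
      intro P hP f hf
      rw [mem_powersetCard] at hP
      ext x
      simp only [mem_filter]
      refine ⟨fun h => ⟨hP.1 h, hf.1 x h⟩, fun h => ?_⟩
      by_contra hx
      exact hf.2 x (mem_sdiff.2 ⟨h.1, hx⟩) h.2
    intro P hP P' hP' hne
    simp only [Function.onFun]
    rw [Finset.disjoint_left]
    intro f hf hf'
    simp only [mem_filter, mem_univ, true_and] at hf hf'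
    exact hne ((aux P hP f hf).trans (aux P' hP' f hf').symm)
  rw [hunion, card_biUnion hdisj]
  have hterm : ∀ P ∈ N.powersetCard s, (Q + 1 : ℝ) ^ Fintype.card V ≤ 2 * (Q + 1 : ℝ) ^ s *
      (#{f : V → Fin (Q + 1) | (∀ x ∈ P, f x = 0) ∧ ∀ x ∈ N \ P, f x ≠ 0} : ℝ) := by
    intro P hP
    rw [mem_powersetCard] at hP
    have := card_colorings_zero_on Q (P := P) (N := N \ P) disjoint_sdiff
    set c := #{f : V → Fin (Q + 1) | (∀ x ∈ P, f x = 0) ∧ ∀ x ∈ N \ P, f x ≠ 0}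
    have hm : #(N \ P) ≤ 8 * q := (card_le_card sdiff_subset).trans h2
    set m := #(N \ P)
    have this' : (c : ℝ) * (Q + 1 : ℝ) ^ (#P + m) = (Q : ℝ) ^ m * (Q + 1 : ℝ) ^ Fintype.card V := by
      exact_mod_cast this
    have hQ' : (Q : ℝ) + 1 = 16 * q := by exact_mod_cast hQ
    have hqpos : (1 : ℝ) ≤ q := by exact_mod_cast hq
    have hpos : (0 : ℝ) < Q + 1 := by positivity
    have hbern : (1 : ℝ) / 2 ≤ ((Q : ℝ) / (Q + 1)) ^ m := by
      have hb := one_add_mul_le_pow (a := (-1 / (Q + 1) : ℝ)) (by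
        rw [le_div_iff₀ hpos]; nlinarith) m
      have e : (1 : ℝ) + -1 / (Q + 1) = Q / (Q + 1) := by field_simp; ring
      rw [e] at hb
      refine le_trans ?_ hb
      have hm' : (m : ℝ) ≤ 8 * q := by exact_mod_cast hm
      rw [hQ', ← sub_nonneg]
      have e : (1 : ℝ) + (m : ℝ) * (-1 / (16 * q)) - 1 / 2 = (8 * q - m) / (16 * q) := by
        field_simp; ring
      rw [e]
      apply div_nonneg <;> linarith
    rw [div_pow, div_le_div_iff₀ (by norm_num) (by positivity), one_mul] at hbern
    rw [hP.2, pow_add] at this'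
    have hz : (0 : ℝ) < (Q + 1 : ℝ) ^ m := by positivity
    have : (Q + 1 : ℝ) ^ Fintype.card V * (Q + 1 : ℝ) ^ m ≤
        (2 * (Q + 1 : ℝ) ^ s * c) * (Q + 1 : ℝ) ^ m := by
      have hy : (0 : ℝ) < (Q + 1 : ℝ) ^ Fintype.card V := by positivity
      nlinarith
    exact le_of_mul_le_mul_right this hz
  have hsum := sum_le_sum hterm
  rw [sum_const, card_powersetCard, nsmul_eq_mul, ← mul_sum] at hsum
  have hchoose : (q : ℝ) ^ s ≤ 2 ^ s * s.factorial * ((#N).choose s : ℝ) := by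
    have h3 : ((q + 1 - s : ℕ) : ℝ) ^ s / s.factorial ≤ (q.choose s : ℝ) := Nat.pow_le_choose s q
    rw [div_le_iff₀ (by positivity)] at h3
    have h4 : (q.choose s : ℝ) ≤ ((#N).choose s : ℝ) := by
      exact_mod_cast Nat.choose_le_choose s h1
    have h5 : (q : ℝ) ≤ 2 * ((q + 1 - s : ℕ) : ℝ) := by
      have : q ≤ 2 * (q + 1 - s) := by omega
      exact_mod_cast this
    calc (q : ℝ) ^ s ≤ (2 * ((q + 1 - s : ℕ) : ℝ)) ^ s := by gcongr
      _ = 2 ^ s * ((q + 1 - s : ℕ) : ℝ) ^ s := by rw [mul_pow]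
      _ ≤ 2 ^ s * ((q.choose s : ℝ) * s.factorial) := by gcongr
      _ ≤ 2 ^ s * (((#N).choose s : ℝ) * s.factorial) := by gcongr
      _ = _ := by ring
  have hfin : ((Q + 1 : ℝ) ^ Fintype.card V) * (Q + 1 : ℝ) ^ s ≤ (2 * 32 ^ s * s.factorial *
      ∑ P ∈ N.powersetCard s, (#{f : V → Fin (Q + 1) | (∀ x ∈ P, f x = 0) ∧
        ∀ x ∈ N \ P, f x ≠ 0} : ℝ)) * (Q + 1 : ℝ) ^ s := by
    have hQ' : (Q : ℝ) + 1 = 16 * q := by exact_mod_cast hQ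
    have e : (Q + 1 : ℝ) ^ s = 16 ^ s * (q : ℝ) ^ s := by rw [hQ', mul_pow]
    have e2 : (32 : ℝ) ^ s = 16 ^ s * 2 ^ s := by rw [← mul_pow]; norm_num
    calc ((Q + 1 : ℝ) ^ Fintype.card V) * (Q + 1 : ℝ) ^ s
        = 16 ^ s * ((q : ℝ) ^ s * (Q + 1 : ℝ) ^ Fintype.card V) := by rw [e]; ring
      _ ≤ 16 ^ s * ((2 ^ s * s.factorial * ((#N).choose s : ℝ)) * (Q + 1 : ℝ) ^ Fintype.card V) := by
          gcongr
      _ = 16 ^ s * 2 ^ s * s.factorial * (((#N).choose s : ℝ) * (Q + 1 : ℝ) ^ Fintype.card V) := by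
          ring
      _ ≤ 16 ^ s * 2 ^ s * s.factorial * (2 * (Q + 1 : ℝ) ^ s * _) := by
          gcongr
      _ = _ := by rw [e2]; ring
  have := le_of_mul_le_mul_right hfin (by positivity)
  exact_mod_cast this

lemma exists_sample_of_balanced {V : Type} [Fintype V] (s M : ℕ) (G : SimpleGraph V)
    (q : ℕ) (hq : 1 ≤ q) (hsq : 2 * s ≤ q) (hM : M * (2 * 32 ^ s * s.factorial) < q)
    (A B : Finset V)
    (hpos : 0 < #A + #B) (hAB : #B ≤ #A)
    (he : edgesBetween G A B < (q + 1) * (#A + #B))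
    (hdeg : ∀ a ∈ A, q ≤ #{b ∈ B | G.Adj a b}) :
    ∃ A' ⊆ A, ∃ R ⊆ B, (∀ a ∈ A', #{b ∈ R | G.Adj a b} = s) ∧ M * #R < #A' := by
  set K := 2 * 32 ^ s * s.factorial
  let A₁ : Finset V := {a ∈ A | #{b ∈ B | G.Adj a b} ≤ 8 * q}
  have hA₁ : #A ≤ 2 * #A₁ := by
    have h1 : #A₁ + #{a ∈ A | ¬ #{b ∈ B | G.Adj a b} ≤ 8 * q} = #A :=
      card_filter_add_card_filter_not _
    have h2 : #{a ∈ A | ¬ #{b ∈ B | G.Adj a b} ≤ 8 * q} * (8 * q) ≤ edgesBetween G A B := by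
      rw [edgesBetween, ← smul_eq_mul, ← sum_const]
      refine (sum_le_sum fun a ha => ?_).trans (sum_le_sum_of_subset (filter_subset _ _))
      have := (mem_filter.1 ha).2
      omega
    set x := #{a ∈ A | ¬ #{b ∈ B | G.Adj a b} ≤ 8 * q}
    have h3 : (q + 1) * (#A + #B) ≤ (2 * q) * (2 * #A) := Nat.mul_le_mul (by omega) (by omega)
    have h4 : x * 2 < #A := by
      by_contra hcon
      push Not at hcon
      have : q * (4 * #A) ≤ q * (8 * x) := Nat.mul_le_mul le_rfl (by omega)
      nlinarith
    omega
  obtain ⟨Q, hQ⟩ : ∃ Q, Q + 1 = 16 * q := ⟨16 * q - 1, by omega⟩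
  by_contra hcon
  push Not at hcon
  let R : (V → Fin (Q + 1)) → Finset V := fun f => {b ∈ B | f b = 0}
  have hf : ∀ f : V → Fin (Q + 1), #{a ∈ A₁ | #{b ∈ R f | G.Adj a b} = s} ≤ M * #(R f) := by
    intro f
    exact hcon _ ((filter_subset _ _).trans (filter_subset _ _)) (R f) (filter_subset _ _)
      fun a ha => (mem_filter.1 ha).2
  have hsum : ∑ f : V → Fin (Q + 1), #{a ∈ A₁ | #{b ∈ R f | G.Adj a b} = s}
      ≤ M * ∑ f : V → Fin (Q + 1), #(R f) := by
    rw [mul_sum]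
    exact sum_le_sum fun f _ => hf f
  have hR : (∑ f : V → Fin (Q + 1), #(R f)) * (16 * q) = #B * (Q + 1) ^ Fintype.card V := by
    have := sum_card_bipartiteAbove_eq_sum_card_bipartiteBelow
      (s := (univ : Finset (V → Fin (Q + 1)))) (t := B) (fun f b => f b = 0)
    simp only [bipartiteAbove, bipartiteBelow] at this
    rw [this, sum_mul, ← smul_eq_mul (#B), ← sum_const]
    refine sum_congr rfl fun b _ => ?_
    have h := card_colorings_zero_on Q (P := {b}) (N := ∅) (by simp)
    simpa [hQ] using h
  have hA : #A₁ * (Q + 1) ^ Fintype.card V ≤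
      K * ∑ f : V → Fin (Q + 1), #{a ∈ A₁ | #{b ∈ R f | G.Adj a b} = s} := by
    have := sum_card_bipartiteAbove_eq_sum_card_bipartiteBelow
      (s := (univ : Finset (V → Fin (Q + 1)))) (t := A₁) (fun f a => #{b ∈ R f | G.Adj a b} = s)
    simp only [bipartiteAbove, bipartiteBelow] at this
    rw [this, mul_sum, ← smul_eq_mul, ← sum_const]
    refine sum_le_sum fun a ha => ?_
    have ha' := mem_filter.1 ha
    have h := card_colorings_exactly s q hq hsq {b ∈ B | G.Adj a b} (hdeg a ha'.1) ha'.2 Q hQ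
    refine h.trans (Nat.mul_le_mul le_rfl (card_le_card ?_))
    intro f hf
    simp only [mem_filter, mem_univ, true_and] at hf ⊢
    rw [← hf]
    congr 1
    ext x
    simp only [R, mem_filter]
    tauto
  set X := (Q + 1) ^ Fintype.card V
  have hX : 0 < X := by positivity
  set Y := ∑ f : V → Fin (Q + 1), #(R f)
  have h1 : #A₁ * X ≤ K * (M * Y) := hA.trans (Nat.mul_le_mul le_rfl hsum)
  have h2 : #A₁ * X * (16 * q) ≤ K * M * (#B * X) := by
    rw [← hR]
    calc _ ≤ K * (M * Y) * (16 * q) := Nat.mul_le_mul h1 le_rfl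
      _ = _ := by ring
  have h3 : #A₁ * (16 * q) ≤ K * M * #B := by
    refine Nat.le_of_mul_le_mul_right ?_ hX
    calc _ = #A₁ * X * (16 * q) := by ring
      _ ≤ _ := h2
      _ = _ := by ring
  have hA0 : 0 < #A₁ := by omega
  have h4 : K * M * #B ≤ q * (2 * #A₁) := Nat.mul_le_mul (by rw [mul_comm]; exact hM.le) (by omega)
  nlinarith

/-- A sufficiently dense bipartite graph contains, after deleting vertices, a very unbalanced
bipartite graph all of whose vertices on the large side have degree exactly `s`. -/
lemma exists_unbalanced_pair (s M : ℕ) : ∃ D : ℕ, ∀ (V : Type) [Fintype V] (G : SimpleGraph V)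
    (A B : Finset V), D * (#A + #B) < edgesBetween G A B →
    ∃ A' R : Finset V, (A' ⊆ A ∧ R ⊆ B ∨ A' ⊆ B ∧ R ⊆ A) ∧
      (∀ a ∈ A', #{b ∈ R | G.Adj a b} = s) ∧ M * #R < #A' := by
  refine ⟨1 + 2 * s + M * (2 * 32 ^ s * s.factorial), fun V _ G A B h => ?_⟩
  obtain ⟨q, hq, A₀, hA, B₀, hB, hpos, he, h1, h2⟩ :=
    exists_balanced_pair G _ A B h
  rcases le_total (#B₀) (#A₀) with hle | hle
  · obtain ⟨A', hA', R, hR, h3, h4⟩ := exists_sample_of_balanced s M G q (by omega) (by omega)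
      (by omega) A₀ B₀ hpos hle he h1
    exact ⟨A', R, Or.inl ⟨hA'.trans hA, hR.trans hB⟩, h3, h4⟩
  · rw [edgesBetween_comm, add_comm (#A₀)] at he
    obtain ⟨A', hA', R, hR, h3, h4⟩ := exists_sample_of_balanced s M G q (by omega) (by omega)
      (by omega) B₀ A₀ (by omega) hle he h2
    exact ⟨A', R, Or.inr ⟨hA'.trans hB, hR.trans hA⟩, h3, h4⟩

end BipartiteSampling

section Linkages

open scoped Classical
open Finset

/-- A family of paths with exactly `k` internal vertices each, indexed by `E`, with distinct pairs
of endpoints in `S` and with pairwise disjoint interiors avoiding `S`. -/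
structure IsLinkage {V ι : Type} (G : SimpleGraph V) (k : ℕ) (S : Finset V) (E : Finset ι)
    (p : ι → ℕ → V) : Prop where
  left_mem : ∀ e ∈ E, p e 0 ∈ S
  right_mem : ∀ e ∈ E, p e (k + 1) ∈ S
  ne : ∀ e ∈ E, p e 0 ≠ p e (k + 1)
  ends_inj : ∀ e ∈ E, ∀ e' ∈ E, s(p e 0, p e (k + 1)) = s(p e' 0, p e' (k + 1)) → e = e'
  adj : ∀ e ∈ E, ∀ i ≤ k, G.Adj (p e i) (p e (i + 1))
  interior : ∀ e ∈ E, ∀ i, 1 ≤ i → i ≤ k → p e i ∉ S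
  inj : ∀ e ∈ E, ∀ e' ∈ E, ∀ i j, 1 ≤ i → i ≤ k → 1 ≤ j → j ≤ k → p e i = p e' j → e = e' ∧ i = j

/-- A linkage without further edges of `G` among its vertices: an induced `k`-subdivision. -/
structure IsInducedLinkage {V ι : Type} (G : SimpleGraph V) (k : ℕ) (S : Finset V) (E : Finset ι)
    (p : ι → ℕ → V) : Prop extends IsLinkage G k S E p where
  indep : ∀ u ∈ S, ∀ v ∈ S, ¬ G.Adj u v
  adj_end : ∀ e ∈ E, ∀ i, 1 ≤ i → i ≤ k → ∀ w ∈ S, G.Adj (p e i) w →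
    (w = p e 0 ∧ i = 1) ∨ (w = p e (k + 1) ∧ i = k)
  adj_int : ∀ e ∈ E, ∀ e' ∈ E, ∀ i j, 1 ≤ i → i ≤ k → 1 ≤ j → j ≤ k → G.Adj (p e i) (p e' j) →
    e = e' ∧ (i + 1 = j ∨ j + 1 = i)

/-- Every induced `k`-subdivision in `G` has at most `d` edges per branch vertex. -/
def InducedDensityLE {V : Type} (G : SimpleGraph V) (k d : ℕ) : Prop :=
  ∀ (S : Finset V) (ι : Type) (E : Finset ι) (p : ι → ℕ → V),
    IsInducedLinkage G k S E p → #E ≤ d * #S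

lemma IsLinkage.subset {V ι : Type} {G : SimpleGraph V} {k : ℕ} {S S' : Finset V} {E E' : Finset ι}
    {p : ι → ℕ → V} (h : IsLinkage G k S E p) (hS : S' ⊆ S) (hE : E' ⊆ E)
    (hl : ∀ e ∈ E', p e 0 ∈ S') (hr : ∀ e ∈ E', p e (k + 1) ∈ S') : IsLinkage G k S' E' p where
  left_mem := hl
  right_mem := hr
  ne e he := h.ne e (hE he)
  ends_inj e he e' he' := h.ends_inj e (hE he) e' (hE he')
  adj e he := h.adj e (hE he)
  interior e he i h1 h2 h3 := h.interior e (hE he) i h1 h2 (hS h3)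
  inj e he e' he' := h.inj e (hE he) e' (hE he')

lemma IsInducedLinkage.subset {V ι : Type} {G : SimpleGraph V} {k : ℕ} {S S' : Finset V}
    {E E' : Finset ι} {p : ι → ℕ → V} (h : IsInducedLinkage G k S E p) (hS : S' ⊆ S) (hE : E' ⊆ E)
    (hl : ∀ e ∈ E', p e 0 ∈ S') (hr : ∀ e ∈ E', p e (k + 1) ∈ S') :
    IsInducedLinkage G k S' E' p where
  toIsLinkage := h.toIsLinkage.subset hS hE hl hr
  indep u hu v hv := h.indep u (hS hu) v (hS hv)
  adj_end e he i h1 h2 w hw := h.adj_end e (hE he) i h1 h2 w (hS hw)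
  adj_int e he e' he' := h.adj_int e (hE he) e' (hE he')

lemma IsInducedLinkage.map {V W ι : Type} {G : SimpleGraph V} {G' : SimpleGraph W} {k : ℕ}
    {S : Finset V} {E : Finset ι} {p : ι → ℕ → V} (h : IsInducedLinkage G k S E p) (f : G ↪g G') :
    IsInducedLinkage G' k (S.map f.toEmbedding) E (fun e i => f (p e i)) := by
  have hm : ∀ v, f v ∈ S.map f.toEmbedding ↔ v ∈ S := fun v => mem_map' f.toEmbedding
  constructor
  · constructor
    · exact fun e he => (hm _).2 (h.left_mem e he)
    · exact fun e he => (hm _).2 (h.right_mem e he)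
    · exact fun e he he' => h.ne e he (f.injective he')
    · intro e he e' he' hh
      refine h.ends_inj e he e' he' (Sym2.map.injective f.injective ?_)
      simpa using hh
    · exact fun e he i hi => f.map_adj_iff.2 (h.adj e he i hi)
    · exact fun e he i h1 h2 hh => h.interior e he i h1 h2 ((hm _).1 hh)
    · exact fun e he e' he' i j h1 h2 h3 h4 hh =>
        h.inj e he e' he' i j h1 h2 h3 h4 (f.injective hh)
  · intro u hu v hv
    obtain ⟨u, hu', rfl⟩ := mem_map.1 hu
    obtain ⟨v, hv', rfl⟩ := mem_map.1 hv
    exact fun hh => h.indep u hu' v hv' (f.map_adj_iff.1 hh)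
  · intro e he i h1 h2 w hw hh
    obtain ⟨w, hw', rfl⟩ := mem_map.1 hw
    rcases h.adj_end e he i h1 h2 w hw' (f.map_adj_iff.1 hh) with ⟨rfl, h3⟩ | ⟨rfl, h3⟩
    · exact Or.inl ⟨rfl, h3⟩
    · exact Or.inr ⟨rfl, h3⟩
  · exact fun e he e' he' i j h1 h2 h3 h4 hh =>
      h.adj_int e he e' he' i j h1 h2 h3 h4 (f.map_adj_iff.1 hh)

/-- An induced linkage realizes an induced subdivision of the graph formed by its endpoint
pairs. -/
lemma IsInducedLinkage.exists_memITM {V ι : Type} {G : SimpleGraph V} {k : ℕ} (hk : 1 ≤ k)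
    {S : Finset V} {E : Finset ι} {p : ι → ℕ → V} (h : IsInducedLinkage G k S E p) :
    ∃ (H : SimpleGraph (Fin #S)) (σ : Fin #S → V), Function.Injective σ ∧ (∀ v, v ∈ S ↔ ∃ i, σ i = v)
      ∧ (∀ i j, H.Adj i j ↔ ∃ e ∈ E, s(p e 0, p e (k + 1)) = s(σ i, σ j)) ∧ MemITM k G H := by
  let σ : Fin #S → V := fun i => (S.equivFin.symm i : V)
  have hσ : Function.Injective σ := fun i j hij => S.equivFin.symm.injective (Subtype.ext hij)
  have hσS : ∀ i, σ i ∈ S := fun i => (S.equivFin.symm i).2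
  let H : SimpleGraph (Fin #S) :=
    { Adj := fun i j => ∃ e ∈ E, s(p e 0, p e (k + 1)) = s(σ i, σ j)
      symm := ⟨fun i j ⟨e, he, hh⟩ => ⟨e, he, hh.trans Sym2.eq_swap⟩⟩
      loopless := ⟨fun i ⟨e, he, hh⟩ => h.ne e he (by
        rcases Sym2.eq_iff.1 hh with ⟨h1, h2⟩ | ⟨h1, h2⟩ <;> rw [h1, h2])⟩ }
  refine ⟨H, σ, hσ, ?_, fun i j => Iff.rfl, ?_⟩
  · intro v
    exact ⟨fun hv => ⟨S.equivFin ⟨v, hv⟩, by simp [σ]⟩, fun ⟨i, hi⟩ => hi ▸ hσS i⟩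
  choose ed hedE hed using fun ε : Edges H => ε.2.2
  have hed_inj : ∀ ε ε' : Edges H, ed ε = ed ε' → ε = ε' := by
    intro ε ε' hh
    have h1 := (hed ε).symm.trans ((congrArg (fun e => s(p e 0, p e (k + 1))) hh).trans (hed ε'))
    have hlt := ε.2.1
    have hlt' := ε'.2.1
    rcases Sym2.eq_iff.1 h1 with ⟨h2, h3⟩ | ⟨h2, h3⟩
    · exact Subtype.ext (Prod.ext (hσ h2) (hσ h3))
    · rw [hσ h2, hσ h3] at hlt
      exact absurd hlt hlt'.asymm
  let idx : Edges H → ℕ → ℕ := fun ε i => if p (ed ε) 0 = σ ε.1.1 then i else k + 1 - i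
  let P : Edges H → ℕ → V := fun ε i => p (ed ε) (idx ε i)
  have hP0 : ∀ ε, P ε 0 = σ ε.1.1 := by
    intro ε
    simp only [P, idx]
    split_ifs with h0
    · exact h0
    · rcases Sym2.eq_iff.1 (hed ε) with ⟨h2, h3⟩ | ⟨h2, h3⟩
      · exact absurd h2 h0
      · exact h3
  have hP1 : ∀ ε, P ε (k + 1) = σ ε.1.2 := by
    intro ε
    simp only [P, idx]
    split_ifs with h0
    · rcases Sym2.eq_iff.1 (hed ε) with ⟨h2, h3⟩ | ⟨h2, h3⟩
      · exact h3
      · exact absurd (h3.trans (h0.symm)).symm (h.ne _ (hedE ε))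
    · rcases Sym2.eq_iff.1 (hed ε) with ⟨h2, h3⟩ | ⟨h2, h3⟩
      · exact absurd h2 h0
      · simpa using h2
  have hidx : ∀ ε i, 1 ≤ i → i ≤ k → 1 ≤ idx ε i ∧ idx ε i ≤ k := by
    intro ε i h1 h2
    simp only [idx]
    split_ifs <;> omega
  have hPS : ∀ ε i, 1 ≤ i → i ≤ k → P ε i ∉ S := fun ε i h1 h2 =>
    h.interior _ (hedE ε) _ (hidx ε i h1 h2).1 (hidx ε i h1 h2).2
  have hPinj : ∀ ε ε' i j, 1 ≤ i → i ≤ k → 1 ≤ j → j ≤ k → P ε i = P ε' j → ε = ε' ∧ i = j := by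
    intro ε ε' i j h1 h2 h3 h4 hh
    obtain ⟨h5, h6⟩ := h.inj _ (hedE ε) _ (hedE ε') _ _ (hidx ε i h1 h2).1 (hidx ε i h1 h2).2
      (hidx ε' j h3 h4).1 (hidx ε' j h3 h4).2 hh
    have := hed_inj _ _ h5
    subst this
    refine ⟨rfl, ?_⟩
    simp only [idx] at h6
    split_ifs at h6 <;> omega
  have hPadj : ∀ ε, ∀ i ≤ k, G.Adj (P ε i) (P ε (i + 1)) := by
    intro ε i hi
    simp only [P, idx]
    split_ifs
    · exact h.adj _ (hedE ε) i hi
    · have := h.adj _ (hedE ε) (k - i) (by omega)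
      have e1 : k + 1 - (i + 1) = k - i := by omega
      have e2 : k + 1 - i = k - i + 1 := by omega
      rw [e1, e2]
      exact this.symm
  have hPend : ∀ ε i, 1 ≤ i → i ≤ k → ∀ u, G.Adj (P ε i) (σ u) →
      (u = ε.1.1 ∧ i = 1) ∨ (u = ε.1.2 ∧ i = k) := by
    intro ε i h1 h2 u hu
    have h3 := h.adj_end _ (hedE ε) _ (hidx ε i h1 h2).1 (hidx ε i h1 h2).2 _ (hσS u) hu
    have h4 := hP0 ε
    have h5 := hP1 ε
    simp only [P, idx] at h3 h4 h5
    split_ifs at h3 h4 h5 with h0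
    · rw [h4, h5] at h3
      rcases h3 with ⟨h3, h6⟩ | ⟨h3, h6⟩
      · exact Or.inl ⟨hσ h3, h6⟩
      · exact Or.inr ⟨hσ h3, h6⟩
    · rw [Nat.sub_self] at h5
      rw [Nat.sub_zero] at h4
      rw [h4, h5] at h3
      rcases h3 with ⟨h3, h6⟩ | ⟨h3, h6⟩
      · exact Or.inr ⟨hσ h3, by omega⟩
      · exact Or.inl ⟨hσ h3, by omega⟩
  have hPint : ∀ ε ε' i j, 1 ≤ i → i ≤ k → 1 ≤ j → j ≤ k → G.Adj (P ε i) (P ε' j) →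
      ε = ε' ∧ (i + 1 = j ∨ j + 1 = i) := by
    intro ε ε' i j h1 h2 h3 h4 hh
    obtain ⟨h5, h6⟩ := h.adj_int _ (hedE ε) _ (hedE ε') _ _ (hidx ε i h1 h2).1 (hidx ε i h1 h2).2
      (hidx ε' j h3 h4).1 (hidx ε' j h3 h4).2 hh
    have := hed_inj _ _ h5
    subst this
    refine ⟨rfl, ?_⟩
    simp only [idx] at h6
    split_ifs at h6 <;> omega
  clear_value P
  let f : (Fin #S ⊕ Σ _ : Edges H, Fin k) → V := Sum.elim σ (fun x => P x.1 (x.2 + 1))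
  have hf : Function.Injective f := by
    rintro (u | ⟨ε, i⟩) (v | ⟨ε', j⟩) hh
    · exact congrArg _ (hσ hh)
    · exact absurd (hσS u) (by
        change σ u = P ε' (j + 1) at hh
        rw [hh]; exact hPS _ _ (by omega) (by omega))
    · exact absurd (hσS v) (by
        change P ε (i + 1) = σ v at hh
        rw [← hh]; exact hPS _ _ (by omega) (by omega))
    · obtain ⟨rfl, h2⟩ := hPinj ε ε' (i + 1) (j + 1) (by omega) (by omega) (by omega) (by omega) hh
      have : i = j := Fin.ext (by omega)
      rw [this]
  have hend : ∀ (u : Fin #S) (ε : Edges H) (i : Fin k),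
      G.Adj (σ u) (P ε (i + 1)) ↔ (u = ε.1.1 ∧ (i : ℕ) = 0) ∨ (u = ε.1.2 ∧ (i : ℕ) + 1 = k) := by
    intro u ε i
    constructor
    · intro hh
      rcases hPend ε (i + 1) (by omega) (by omega) u hh.symm with ⟨h1, h2⟩ | ⟨h1, h2⟩
      · exact Or.inl ⟨h1, by omega⟩
      · exact Or.inr ⟨h1, h2⟩
    · rintro (⟨rfl, h2⟩ | ⟨rfl, h2⟩)
      · rw [h2, ← hP0]; exact hPadj ε 0 (by omega)
      · rw [h2, ← hP1]; exact (hPadj ε k le_rfl).symm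
  refine ⟨⟨⟨f, hf⟩, ?_⟩⟩
  rintro (u | ⟨ε, i⟩) (v | ⟨ε', j⟩)
  · simp only [Subdiv, SimpleGraph.fromRel_adj, subdivRel, Function.Embedding.coeFn_mk]
    constructor
    · exact fun hh => absurd hh (h.indep _ (hσS u) _ (hσS v))
    · rintro ⟨_, ⟨_, h2⟩ | ⟨_, h2⟩⟩ <;> omega
  · simp only [Subdiv, SimpleGraph.fromRel_adj, subdivRel, Function.Embedding.coeFn_mk]
    change G.Adj (σ u) (P ε' (j + 1)) ↔ _
    rw [hend]
    simp
  · simp only [Subdiv, SimpleGraph.fromRel_adj, subdivRel, Function.Embedding.coeFn_mk]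
    change G.Adj (P ε (i + 1)) (σ v) ↔ _
    rw [G.adj_comm, hend]
    simp
  · simp only [Subdiv, SimpleGraph.fromRel_adj, subdivRel, Function.Embedding.coeFn_mk]
    change G.Adj (P ε (i + 1)) (P ε' (j + 1)) ↔ _
    constructor
    · intro hh
      have hne := hh.ne
      obtain ⟨rfl, h2⟩ := hPint _ _ _ _ (by omega) (by omega) (by omega) (by omega) hh
      refine ⟨fun he => hne ?_, ?_⟩
      · simp only [Sum.inr.injEq, Sigma.mk.injEq, heq_eq_eq, true_and] at he
        rw [he]
      · simp only [true_and]
        omega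
    · rintro ⟨_, ⟨rfl, h2⟩ | ⟨rfl, h2⟩⟩
      · rw [← h2]; exact hPadj _ _ (by omega)
      · rw [← h2]; exact (hPadj _ _ (by omega)).symm

/-- The path of the `r`-subdivision of `H` that replaces the edge `e`. -/
def subdivPath {n : ℕ} (H : SimpleGraph (Fin n)) (r : ℕ) (e : Edges H) (i : ℕ) :
    Fin n ⊕ Σ _ : Edges H, Fin r :=
  if h : 1 ≤ i ∧ i ≤ r then Sum.inr ⟨e, ⟨i - 1, by omega⟩⟩
  else if i = 0 then Sum.inl e.1.1 else Sum.inl e.1.2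

noncomputable instance {n : ℕ} (H : SimpleGraph (Fin n)) : Fintype (Edges H) :=
  inferInstanceAs (Fintype {p : Fin n × Fin n // p.1 < p.2 ∧ H.Adj p.1 p.2})

lemma subdivPath_zero {n : ℕ} (H : SimpleGraph (Fin n)) (r : ℕ) (e : Edges H) :
    subdivPath H r e 0 = Sum.inl e.1.1 := by simp [subdivPath]

lemma subdivPath_last {n : ℕ} (H : SimpleGraph (Fin n)) (r : ℕ) (e : Edges H) :
    subdivPath H r e (r + 1) = Sum.inl e.1.2 := by simp [subdivPath]

lemma subdivPath_int {n : ℕ} (H : SimpleGraph (Fin n)) (r : ℕ) (e : Edges H) (i : Fin r) :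
    subdivPath H r e (i + 1) = Sum.inr ⟨e, i⟩ := by
  have : (i : ℕ) + 1 ≤ r := i.2
  simp [subdivPath, this]

lemma isInducedLinkage_subdiv {n : ℕ} (H : SimpleGraph (Fin n)) {r : ℕ} (hr : 1 ≤ r) :
    IsInducedLinkage (Subdiv H fun _ => r) r (univ.map Function.Embedding.inl)
      (univ : Finset (Edges H)) (subdivPath H r) := by
  have hinner : ∀ i, 1 ≤ i → i ≤ r → ∃ j : Fin r, i = j + 1 := fun i h1 h2 =>
    ⟨⟨i - 1, by omega⟩, by simp; omega⟩
  constructor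
  · constructor
    · intro e _; rw [subdivPath_zero]; simp
    · intro e _; rw [subdivPath_last]; simp
    · intro e _; rw [subdivPath_zero, subdivPath_last]
      exact fun hh => e.2.1.ne (Sum.inl_injective hh)
    · intro e _ e' _ hh
      rw [subdivPath_zero, subdivPath_last, subdivPath_zero, subdivPath_last] at hh
      have h1 := e.2.1
      have h2 := e'.2.1
      rcases Sym2.eq_iff.1 hh with ⟨h3, h4⟩ | ⟨h3, h4⟩
      · exact Subtype.ext (Prod.ext (Sum.inl_injective h3) (Sum.inl_injective h4))
      · rw [Sum.inl_injective h3, Sum.inl_injective h4] at h1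
        exact absurd h1 h2.asymm
    · intro e _ i hi
      rcases Nat.eq_zero_or_pos i with rfl | hpos
      · rw [subdivPath_zero, show (0 : ℕ) + 1 = ((⟨0, hr⟩ : Fin r) : ℕ) + 1 from rfl,
          subdivPath_int]
        simp [Subdiv, subdivRel]
      · obtain ⟨j, rfl⟩ := hinner i hpos hi
        rw [subdivPath_int]
        rcases Nat.lt_or_ge (j + 1) r with hlt | hge
        · rw [show (j : ℕ) + 1 + 1 = ((⟨j + 1, hlt⟩ : Fin r) : ℕ) + 1 from rfl, subdivPath_int]
          simp [Subdiv, subdivRel, Fin.ext_iff]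
        · have : (j : ℕ) + 1 = r := by omega
          rw [this, subdivPath_last]
          simp [Subdiv, subdivRel, this]
    · intro e _ i h1 h2
      obtain ⟨j, rfl⟩ := hinner i h1 h2
      rw [subdivPath_int]; simp
    · intro e _ e' _ i j h1 h2 h3 h4
      obtain ⟨i, rfl⟩ := hinner i h1 h2
      obtain ⟨j, rfl⟩ := hinner j h3 h4
      rw [subdivPath_int, subdivPath_int]
      intro hh
      simp only [Sum.inr.injEq, Sigma.mk.injEq] at hh
      obtain ⟨rfl, hh⟩ := hh
      simp only [heq_eq_eq] at hh
      simp [hh]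
  · intro u hu v hv
    obtain ⟨u, -, rfl⟩ := mem_map.1 hu
    obtain ⟨v, -, rfl⟩ := mem_map.1 hv
    simp only [Subdiv, SimpleGraph.fromRel_adj, subdivRel, Function.Embedding.inl_apply]
    rintro ⟨_, ⟨_, h⟩ | ⟨_, h⟩⟩ <;> omega
  · intro e _ i h1 h2 w hw
    obtain ⟨i, rfl⟩ := hinner i h1 h2
    obtain ⟨w, -, rfl⟩ := mem_map.1 hw
    rw [subdivPath_int, subdivPath_zero, subdivPath_last]
    simp only [Subdiv, SimpleGraph.fromRel_adj, subdivRel, Function.Embedding.inl_apply]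
    rintro ⟨_, h | ⟨rfl, h⟩ | ⟨rfl, h⟩⟩
    · exact h.elim
    · left; exact ⟨rfl, by omega⟩
    · right; exact ⟨rfl, by omega⟩
  · intro e _ e' _ i j h1 h2 h3 h4
    obtain ⟨i, rfl⟩ := hinner i h1 h2
    obtain ⟨j, rfl⟩ := hinner j h3 h4
    rw [subdivPath_int, subdivPath_int]
    simp only [Subdiv, SimpleGraph.fromRel_adj, subdivRel]
    rintro ⟨_, ⟨rfl, h⟩ | ⟨rfl, h⟩⟩
    · exact ⟨rfl, by omega⟩
    · exact ⟨rfl, by omega⟩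

/-- A linkage has at most as many paths as the graph of its endpoint pairs has edges. -/
lemma IsLinkage.card_le_ncard_edgeSet {V ι : Type} {G : SimpleGraph V} {k : ℕ}
    {S : Finset V} {E : Finset ι} {p : ι → ℕ → V} (h : IsLinkage G k S E p) {n : ℕ}
    (H : SimpleGraph (Fin n)) (σ : Fin n → V) (hσ : ∀ v, v ∈ S ↔ ∃ i, σ i = v)
    (hH : ∀ i j, H.Adj i j ↔ ∃ e ∈ E, s(p e 0, p e (k + 1)) = s(σ i, σ j)) :
    #E ≤ H.edgeSet.ncard := by
  have hex : ∀ e ∈ E, ∃ z : Sym2 (Fin n), z ∈ H.edgeSet ∧ z.map σ = s(p e 0, p e (k + 1)) := by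
    intro e he
    obtain ⟨i, hi⟩ := (hσ _).1 (h.left_mem e he)
    obtain ⟨j, hj⟩ := (hσ _).1 (h.right_mem e he)
    refine ⟨s(i, j), ?_, ?_⟩
    · rw [SimpleGraph.mem_edgeSet, hH]
      exact ⟨e, he, by rw [hi, hj]⟩
    · rw [Sym2.map_mk, hi, hj]
  rcases E.eq_empty_or_nonempty with rfl | ⟨e₀, he₀⟩
  · simp
  have : Nonempty (Sym2 (Fin n)) := ⟨(hex e₀ he₀).choose⟩
  choose! z hz1 hz2 using hex
  rw [← Set.ncard_coe_finset E]
  refine Set.ncard_le_ncard_of_injOn z (fun e he => hz1 e he) ?_ (Set.toFinite _)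
  intro e he e' he' hh
  refine h.ends_inj e he e' he' ?_
  rw [← hz2 e he, ← hz2 e' he', hh]

lemma inducedDensityLE_of_avgDeg {V : Type} {G : SimpleGraph V} {k : ℕ} (hk : 1 ≤ k) {d : ℝ}
    (hd : ∀ ⦃m : ℕ⦄ (H : SimpleGraph (Fin m)), MemITM k G H → avgDeg H ≤ d) :
    InducedDensityLE G k ⌈d⌉₊ := by
  intro S ι E p h
  obtain ⟨H, σ, -, hσ, hH, hmem⟩ := h.exists_memITM hk
  have h1 := h.card_le_ncard_edgeSet H σ hσ hH
  have h2 := hd H hmem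
  rcases Nat.eq_zero_or_pos #S with h0 | hpos
  · have : E = ∅ := by
      rw [eq_empty_iff_forall_notMem]
      intro e he
      rw [card_eq_zero] at h0
      simpa [h0] using h.left_mem e he
    simp [this]
  · have hpos' : (0 : ℝ) < #S := by exact_mod_cast hpos
    rw [avgDeg, div_le_iff₀ hpos'] at h2
    have h3 : (#E : ℝ) ≤ H.edgeSet.ncard := by exact_mod_cast h1
    have h4 : d ≤ ⌈d⌉₊ := Nat.le_ceil d
    have h5 : (#E : ℝ) ≤ ⌈d⌉₊ * #S := by
      have : d * #S ≤ ⌈d⌉₊ * #S := by gcongr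
      have : (0 : ℝ) ≤ H.edgeSet.ncard := by positivity
      linarith
    exact_mod_cast h5

end Linkages

section Shallow

open scoped Classical
open Finset

/-- The graph `G` has no (not necessarily induced) subgraph `K_{s,s}`. -/
def NoBiclique {V : Type} (G : SimpleGraph V) (s : ℕ) : Prop :=
  ∀ X Y : Finset V, #X = s → #Y = s → ¬ ∀ x ∈ X, ∀ y ∈ Y, G.Adj x y

lemma NoBiclique.pos {V : Type} {G : SimpleGraph V} {s : ℕ} (h : NoBiclique G s) : 1 ≤ s := by
  by_contra h0
  obtain rfl : s = 0 := by omega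
  exact h ∅ ∅ rfl rfl (by simp)

/-- A family of `s`-sets with bounded multiplicities whose shadow is degenerate is small. -/
lemma card_le_of_degenerate_shadow {V : Type} (A R : Finset V) (N : V → Finset V) (s t : ℕ)
    (hs : 1 ≤ s) (hN : ∀ a ∈ A, N a ⊆ R ∧ #(N a) = s)
    (hm : ∀ X : Finset V, #X = s → #{a ∈ A | N a = X} ≤ s)
    (hdeg : ∀ S ⊆ R, S.Nonempty → ∃ v ∈ S, #{u ∈ S | ∃ a ∈ A, v ∈ N a ∧ u ∈ N a ∧ v ≠ u} ≤ t) :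
    #A ≤ s * 2 ^ t * #R := by
  have key : ∀ n, ∀ S ⊆ R, #S = n → #{a ∈ A | N a ⊆ S} ≤ s * 2 ^ t * n := by
    intro n
    induction n with
    | zero =>
      intro S _ hS
      rw [card_eq_zero] at hS
      subst hS
      rw [mul_zero, Nat.le_zero, card_eq_zero, filter_eq_empty_iff]
      intro a ha hh
      have := (hN a ha).2
      rw [subset_empty.1 hh, card_empty] at this
      omega
    | succ n ih =>
      intro S hSR hS
      obtain ⟨v, hv, hvt⟩ := hdeg S hSR (card_pos.1 (by omega))
      have h1 := ih (S.erase v) ((erase_subset _ _).trans hSR) (by rw [card_erase_of_mem hv]; omega)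
      have h2 : #{a ∈ A | N a ⊆ S ∧ v ∈ N a} ≤ s * 2 ^ t := by
        set T := ({u ∈ S | ∃ a ∈ A, v ∈ N a ∧ u ∈ N a ∧ v ≠ u} : Finset V)
        have h3 : #(({a ∈ A | N a ⊆ S ∧ v ∈ N a} : Finset V).image N) ≤ 2 ^ t := by
          calc _ ≤ #(T.powerset.image (insert v)) := by
                refine card_le_card ?_
                intro X hX
                obtain ⟨a, ha, rfl⟩ := mem_image.1 hX
                rw [mem_filter] at ha
                refine mem_image.2 ⟨(N a).erase v, ?_, insert_erase ha.2.2⟩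
                rw [mem_powerset]
                intro u hu
                rw [mem_erase] at hu
                exact mem_filter.2 ⟨ha.2.1 hu.2, a, ha.1, ha.2.2, hu.2, hu.1.symm⟩
            _ ≤ #T.powerset := card_image_le
            _ ≤ 2 ^ t := by rw [card_powerset]; exact Nat.pow_le_pow_right (by omega) hvt
        refine (card_le_mul_card_image _ s ?_).trans (Nat.mul_le_mul le_rfl h3)
        intro X hX
        obtain ⟨a, ha, rfl⟩ := mem_image.1 hX
        rw [mem_filter] at ha
        refine (card_le_card ?_).trans (hm (N a) (hN a ha.1).2)
        intro b hb
        rw [mem_filter, mem_filter] at hb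
        exact mem_filter.2 ⟨hb.1.1, hb.2⟩
      calc #{a ∈ A | N a ⊆ S} ≤ #({a ∈ A | N a ⊆ S.erase v} ∪ {a ∈ A | N a ⊆ S ∧ v ∈ N a}) := by
            refine card_le_card ?_
            intro a ha
            rw [mem_filter] at ha
            rw [mem_union, mem_filter, mem_filter]
            by_cases hva : v ∈ N a
            · exact Or.inr ⟨ha.1, ha.2, hva⟩
            · exact Or.inl ⟨ha.1, subset_erase.2 ⟨ha.2, hva⟩⟩
        _ ≤ _ := card_union_le _ _
        _ ≤ s * 2 ^ t * n + s * 2 ^ t := Nat.add_le_add h1 h2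
        _ = _ := by ring
  have := key _ R le_rfl rfl
  rwa [filter_true_of_mem (fun a ha => (hN a ha).1)] at this

lemma NoBiclique.card_le_of_inducedDensityLE {V : Type} [Fintype V] {G : SimpleGraph V} {s d : ℕ}
    (hG : NoBiclique G s) (hd : InducedDensityLE G 1 d) (A R : Finset V) (hAR : Disjoint A R)
    (hA : ∀ a ∈ A, ∀ b ∈ A, ¬ G.Adj a b) (hR : ∀ a ∈ R, ∀ b ∈ R, ¬ G.Adj a b)
    (hs : ∀ a ∈ A, #{b ∈ R | G.Adj a b} = s) :
    #A ≤ s * 2 ^ (s ^ 2 * (2 ^ s * d)) * #R := by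
  set N : V → Finset V := fun a => {b ∈ R | G.Adj a b} with hNdef
  refine card_le_of_degenerate_shadow A R N s _ hG.pos
    (fun a ha => ⟨filter_subset _ _, hs a ha⟩) ?_ ?_
  · intro X hX
    by_contra hcon
    push Not at hcon
    obtain ⟨Y, hY, hYs⟩ := exists_subset_card_eq hcon.le
    refine hG Y X hYs hX ?_
    intro y hy x hx
    have := (mem_filter.1 (hY hy)).2
    rw [← this, hNdef, mem_filter] at hx
    exact hx.2
  intro S hSR hne
  by_contra hcon
  push Not at hcon
  set Q : Finset (V × V) := {π ∈ S ×ˢ S | ∃ a ∈ A, π.1 ∈ N a ∧ π.2 ∈ N a ∧ π.1 ≠ π.2} with hQ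
  have hQcard : (s ^ 2 * (2 ^ s * d) + 1) * #S ≤ #Q := by
    rw [hQ, card_filter, sum_product, mul_comm, ← smul_eq_mul]
    refine card_nsmul_le_sum _ _ _ fun v hv => ?_
    rw [← card_filter]
    exact hcon v hv
  have hex : ∀ z : Sym2 V, (∃ π ∈ Q, s(π.1, π.2) = z) → ∃ a ∈ A, ∀ x ∈ z, x ∈ N a := by
    rintro z ⟨π, hπ, rfl⟩
    obtain ⟨-, a, ha, h1, h2, -⟩ := mem_filter.1 hπ
    refine ⟨a, ha, fun x hx => ?_⟩
    rcases Sym2.mem_iff.1 hx with rfl | rfl <;> assumption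
  obtain ⟨v₀, hv₀⟩ := hne
  have : Nonempty V := ⟨v₀⟩
  choose! g hgA hg using hex
  set A₁ : Finset V := Q.image fun π => g s(π.1, π.2) with hA₁
  have hA₁A : ∀ a ∈ A₁, a ∈ A := by
    intro a ha
    obtain ⟨π, hπ, rfl⟩ := mem_image.1 ha
    exact hgA _ ⟨π, hπ, rfl⟩
  have h1 : #Q ≤ s ^ 2 * #A₁ := by
    refine card_le_mul_card_image _ _ ?_
    intro a ha
    have haA := hA₁A a ha
    calc _ ≤ #(N a ×ˢ N a) := by
          refine card_le_card ?_
          intro π hπ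
          obtain ⟨hπ, hπa⟩ := mem_filter.1 hπ
          have := hg s(π.1, π.2) ⟨π, hπ, rfl⟩
          rw [hπa] at this
          exact mem_product.2 ⟨this _ (Sym2.mem_mk_left _ _), this _ (Sym2.mem_mk_right _ _)⟩
      _ = s ^ 2 := by rw [card_product, hs a haA, sq]
  have hex2 : ∀ a ∈ A₁, ∃ π ∈ Q, g s(π.1, π.2) = a := fun a ha => mem_image.1 ha
  choose! q hqQ hq using hex2
  have hqN : ∀ a ∈ A₁, (q a).1 ∈ N a ∧ (q a).2 ∈ N a := by
    intro a ha
    have := hg s((q a).1, (q a).2) ⟨q a, hqQ a ha, rfl⟩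
    rw [hq a ha] at this
    exact ⟨this _ (Sym2.mem_mk_left _ _), this _ (Sym2.mem_mk_right _ _)⟩
  obtain ⟨T, hT⟩ := exists_sample A₁ (fun a => {(q a).1, (q a).2})
    (fun a => N a \ {(q a).1, (q a).2}) s (fun a _ => disjoint_sdiff) (by
      intro a ha
      have : ({(q a).1, (q a).2} : Finset V) ⊆ N a := by
        intro x hx
        rw [mem_insert, mem_singleton] at hx
        rcases hx with rfl | rfl
        · exact (hqN a ha).1
        · exact (hqN a ha).2
      have h2 := card_sdiff_add_card_eq_card this
      have h3 := hs a (hA₁A a ha)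
      change #(N a) = s at h3
      omega)
  set E' := ({a ∈ A₁ | ({(q a).1, (q a).2} : Finset V) ⊆ T ∧
    Disjoint (N a \ {(q a).1, (q a).2}) T} : Finset V)
  have hE' : ∀ a ∈ E', a ∈ A₁ ∧ (q a).1 ∈ T ∧ (q a).2 ∈ T ∧
      ∀ w ∈ T, w ∈ N a → w = (q a).1 ∨ w = (q a).2 := by
    intro a ha
    obtain ⟨h2, h3, h4⟩ := mem_filter.1 ha
    refine ⟨h2, h3 (by simp), h3 (by simp), fun w hw hwa => ?_⟩
    by_contra hne
    refine (Finset.disjoint_left.1 h4) (mem_sdiff.2 ⟨hwa, ?_⟩) hw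
    simpa using hne
  have hQS : ∀ a ∈ E', (q a).1 ∈ S ∧ (q a).2 ∈ S ∧ (q a).1 ≠ (q a).2 := by
    intro a ha
    obtain ⟨h2, a', -, -, -, h3⟩ := mem_filter.1 (hqQ a (hE' a ha).1)
    exact ⟨(mem_product.1 h2).1, (mem_product.1 h2).2, h3⟩
  let p : V → ℕ → V := fun a i => if i = 0 then (q a).1 else if i = 1 then a else (q a).2
  have hadj : ∀ a ∈ E', G.Adj a (q a).1 ∧ G.Adj a (q a).2 := by
    intro a ha
    have := hqN a (hE' a ha).1
    exact ⟨(mem_filter.1 this.1).2, (mem_filter.1 this.2).2⟩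
  have hlink : IsInducedLinkage G 1 (S ∩ T) E' p := by
    refine ⟨⟨?_, ?_, ?_, ?_, ?_, ?_, ?_⟩, ?_, ?_, ?_⟩
    · intro a ha
      exact mem_inter.2 ⟨(hQS a ha).1, (hE' a ha).2.1⟩
    · intro a ha
      exact mem_inter.2 ⟨(hQS a ha).2.1, (hE' a ha).2.2.1⟩
    · intro a ha
      exact (hQS a ha).2.2
    · intro a ha b hb hh
      rw [← hq a (hE' a ha).1, ← hq b (hE' b hb).1]
      exact congrArg g hh
    · intro a ha i hi
      rcases Nat.le_one_iff_eq_zero_or_eq_one.1 hi with rfl | rfl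
      · exact (hadj a ha).1.symm
      · exact (hadj a ha).2
    · intro a ha i h2 h3 h4
      obtain rfl : i = 1 := by omega
      exact Finset.disjoint_left.1 hAR (hA₁A a (hE' a ha).1) (hSR (mem_inter.1 h4).1)
    · intro a ha b hb i j h2 h3 h4 h5 hh
      obtain rfl : i = 1 := by omega
      obtain rfl : j = 1 := by omega
      exact ⟨hh, rfl⟩
    · intro u hu v hv
      exact hR u (hSR (mem_inter.1 hu).1) v (hSR (mem_inter.1 hv).1)
    · intro a ha i h2 h3 w hw hh
      obtain rfl : i = 1 := by omega
      have hw' := mem_inter.1 hw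
      rcases (hE' a ha).2.2.2 w hw'.2 (mem_filter.2 ⟨hSR hw'.1, hh⟩) with h | h
      · exact Or.inl ⟨h, rfl⟩
      · exact Or.inr ⟨h, rfl⟩
    · intro a ha b hb i j h2 h3 h4 h5 hh
      obtain rfl : i = 1 := by omega
      obtain rfl : j = 1 := by omega
      exact absurd hh (hA a (hA₁A a (hE' a ha).1) b (hA₁A b (hE' b hb).1))
  have h2 := hd _ _ _ _ hlink
  have h3 : #(S ∩ T) ≤ #S := card_le_card inter_subset_left
  have h4 : 0 < #S := card_pos.2 ⟨v₀, hv₀⟩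
  have h5 : #Q ≤ s ^ 2 * (2 ^ s * d) * #S := by
    calc #Q ≤ s ^ 2 * #A₁ := h1
      _ ≤ s ^ 2 * (2 ^ s * (d * #S)) := by
          refine Nat.mul_le_mul le_rfl (hT.trans (Nat.mul_le_mul le_rfl (h2.trans ?_)))
          exact Nat.mul_le_mul le_rfl h3
      _ = _ := by ring
  have : (s ^ 2 * (2 ^ s * d) + 1) * #S = s ^ 2 * (2 ^ s * d) * #S + #S := by ring
  omega

lemma edgesBetween_self_le {V : Type} {G : SimpleGraph V} {c : ℕ} (C : G.Coloring (Fin c))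
    (S : Finset V) (D : ℕ)
    (h : ∀ i j, i ≠ j → edgesBetween G {v ∈ S | C v = i} {v ∈ S | C v = j} ≤ D) :
    edgesBetween G S S ≤ c * (c * D) := by
  have h1 : edgesBetween G S S
      = ∑ i : Fin c, ∑ j : Fin c, edgesBetween G {v ∈ S | C v = i} {v ∈ S | C v = j} := by
    unfold edgesBetween
    rw [← sum_fiberwise S C]
    refine sum_congr rfl fun i _ => ?_
    rw [sum_comm]
    refine sum_congr rfl fun a _ => ?_
    rw [card_eq_sum_card_fiberwise (f := C) (t := univ) (fun _ _ => by simp)]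
    refine sum_congr rfl fun j _ => ?_
    congr 1
    ext b
    simp only [mem_filter]
    tauto
  rw [h1]
  have h2 : ∀ i j, edgesBetween G {v ∈ S | C v = i} {v ∈ S | C v = j} ≤ D := by
    intro i j
    by_cases hij : i = j
    · subst hij
      unfold edgesBetween
      rw [sum_eq_zero]
      · exact Nat.zero_le _
      intro a ha
      rw [card_eq_zero, filter_eq_empty_iff]
      intro b hb hab
      exact C.valid hab ((mem_filter.1 ha).2.trans (mem_filter.1 hb).2.symm)
    · exact h i j hij
  calc _ ≤ ∑ i : Fin c, ∑ j : Fin c, D := sum_le_sum fun i _ => sum_le_sum fun j _ => h2 i j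
    _ = _ := by simp

/-- Bounded chromatic number, no large biclique and sparse induced `1`-subdivisions together bound
the density of all induced subgraphs. -/
lemma exists_edgesBetween_bound (c s d : ℕ) : ∃ d₀ : ℕ, ∀ (V : Type) [Fintype V]
    (G : SimpleGraph V), G.Colorable c → NoBiclique G s → InducedDensityLE G 1 d →
    ∀ S : Finset V, edgesBetween G S S ≤ d₀ * #S := by
  obtain ⟨D, hD⟩ := exists_unbalanced_pair s (s * 2 ^ (s ^ 2 * (2 ^ s * d)))
  refine ⟨c * (c * (D * 2)), fun V _ G ⟨C⟩ hG hd S => ?_⟩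
  have := edgesBetween_self_le C S (D * 2 * #S) ?_
  · calc _ ≤ _ := this
      _ = _ := by ring
  intro i j hij
  by_contra hcon
  push Not at hcon
  obtain ⟨A, R, hAR, hdeg, hlt⟩ := hD V G {v ∈ S | C v = i} {v ∈ S | C v = j} (by
    refine lt_of_le_of_lt ?_ hcon
    rw [mul_assoc]
    have h1 : #{v ∈ S | C v = i} ≤ #S := card_filter_le _ _
    have h2 : #{v ∈ S | C v = j} ≤ #S := card_filter_le _ _
    exact Nat.mul_le_mul le_rfl (by omega))
  have hind : ∀ (k : Fin c) (T : Finset V), T ⊆ {v ∈ S | C v = k} →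
      ∀ a ∈ T, ∀ b ∈ T, ¬ G.Adj a b := fun k T hT a ha b hb hab =>
    C.valid hab ((mem_filter.1 (hT ha)).2.trans (mem_filter.1 (hT hb)).2.symm)
  have key : ∀ i j : Fin c, i ≠ j → A ⊆ {v ∈ S | C v = i} → R ⊆ {v ∈ S | C v = j} → False := by
    intro i j hij hA hR
    have := hG.card_le_of_inducedDensityLE hd A R
      (Finset.disjoint_left.2 fun v h1 h2 => hij
        ((mem_filter.1 (hA h1)).2.symm.trans (mem_filter.1 (hR h2)).2))
      (hind i A hA) (hind j R hR) hdeg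
    omega
  rcases hAR with ⟨h1, h2⟩ | ⟨h1, h2⟩
  · exact key i j hij h1 h2
  · exact key j i hij.symm h1 h2

end Shallow

section LinkageBound

open scoped Classical
open Finset

lemma IsLinkage.shortcut {V ι : Type} {G : SimpleGraph V} {k : ℕ} {S : Finset V} {E : Finset ι}
    {p : ι → ℕ → V} (h : IsLinkage G k S E p) {i j : ℕ} (hij : i + 1 < j) (hj : j ≤ k + 1)
    (hadj : ∀ e ∈ E, G.Adj (p e i) (p e j)) :
    IsLinkage G (k - (j - i - 1)) S E
      (fun e m => p e (if m ≤ i then m else m + (j - i - 1))) := by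
  have hlast : (if k - (j - i - 1) + 1 ≤ i then k - (j - i - 1) + 1
      else k - (j - i - 1) + 1 + (j - i - 1)) = k + 1 := by split_ifs <;> omega
  have hinner : ∀ m, 1 ≤ m → m ≤ k - (j - i - 1) →
      1 ≤ (if m ≤ i then m else m + (j - i - 1)) ∧ (if m ≤ i then m else m + (j - i - 1)) ≤ k := by
    intro m h1 h2; split_ifs <;> omega
  constructor
  · simpa using h.left_mem
  · simpa only [hlast] using h.right_mem
  · simpa only [hlast, zero_le, if_true] using h.ne
  · simpa only [hlast, zero_le, if_true] using h.ends_inj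
  · intro e he m hm
    rcases lt_trichotomy m i with hlt | rfl | hgt
    · simp only [if_pos hlt.le, if_pos (show m + 1 ≤ i by omega)]
      exact h.adj e he m (by omega)
    · have : m + 1 + (j - m - 1) = j := by omega
      simp only [le_refl, if_true, if_neg (show ¬ m + 1 ≤ m by omega), this]
      exact hadj e he
    · simp only [if_neg (show ¬ m ≤ i by omega), if_neg (show ¬ m + 1 ≤ i by omega)]
      have := h.adj e he (m + (j - i - 1)) (by omega)
      rwa [show m + (j - i - 1) + 1 = m + 1 + (j - i - 1) by omega] at this
  · intro e he m h1 h2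
    exact h.interior e he _ (hinner m h1 h2).1 (hinner m h1 h2).2
  · intro e he e' he' m n h1 h2 h3 h4 hh
    obtain ⟨h5, h6⟩ := h.inj e he e' he' _ _ (hinner m h1 h2).1 (hinner m h1 h2).2 (hinner n h3 h4).1
      (hinner n h3 h4).2 hh
    refine ⟨h5, ?_⟩
    split_ifs at h6 <;> omega

lemma IsLinkage.card_le_edgesBetween {V ι : Type} {G : SimpleGraph V} {S : Finset V} {E : Finset ι}
    {p : ι → ℕ → V} (h : IsLinkage G 0 S E p) : #E ≤ edgesBetween G S S := by
  have : edgesBetween G S S = #{π ∈ S ×ˢ S | G.Adj π.1 π.2} := by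
    unfold edgesBetween
    rw [card_filter, sum_product]
    exact sum_congr rfl fun a _ => card_filter _ _
  rw [this]
  refine card_le_card_of_injOn (fun e => (p e 0, p e 1)) ?_ ?_
  · intro e he
    exact mem_coe.2 (mem_filter.2 ⟨mem_product.2 ⟨h.left_mem e he, h.right_mem e he⟩,
      h.adj e he 0 le_rfl⟩)
  · intro e he e' he' hh
    refine h.ends_inj e he e' he' ?_
    simp only [Prod.mk.injEq] at hh
    rw [hh.1, zero_add, hh.2]

lemma IsLinkage.exists_of_mem {V ι : Type} {G : SimpleGraph V} {k : ℕ} {S : Finset V} {E : Finset ι}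
    {p : ι → ℕ → V} (h : IsLinkage G k S E p) {e : ι} (he : e ∈ E) {i : ℕ} (hi : i ≤ k + 1)
    (hS : p e i ∈ S) : i = 0 ∨ i = k + 1 := by
  by_contra hcon
  push Not at hcon
  exact h.interior e he i (by omega) (by omega) hS

/-- In a sparse graph, a positive fraction of a chordless linkage is induced. -/
lemma IsLinkage.exists_induced {V ι : Type} [Fintype V] {G : SimpleGraph V} {k d₀ : ℕ} (hk : 1 ≤ k)
    (h₀ : ∀ S : Finset V, edgesBetween G S S ≤ d₀ * #S) {S : Finset V} {E : Finset ι}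
    {p : ι → ℕ → V} (h : IsLinkage G k S E p)
    (hc : ∀ e ∈ E, ∀ i j, i < j → j ≤ k + 1 → G.Adj (p e i) (p e j) → j = i + 1) :
    ∃ S' ⊆ S, ∃ E' ⊆ E, IsInducedLinkage G k S' E' p ∧ #E ≤ 2 ^ ((k + 2) * (d₀ + 1)) * #E' := by
  obtain ⟨ρ, -, hρ⟩ := exists_ordering (fun v T => #{u ∈ T | G.Adj v u} ≤ d₀) (by
    intro T hT
    obtain ⟨v, hv, h1⟩ := exists_le_of_sum_le (s := T) (f := fun v => #{u ∈ T | G.Adj v u})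
      (g := fun _ => d₀) hT (by
        have := h₀ T
        unfold edgesBetween at this
        rwa [sum_const, smul_eq_mul, mul_comm (#T)])
    exact ⟨v, hv, h1⟩)
  let P : ι → Finset V := fun e => (range (k + 2)).image (p e)
  let out : V → Finset V := fun v => {u ∈ ({u | ρ u ≤ ρ v} : Finset V) | G.Adj v u}
  have hPmem : ∀ e i, i ≤ k + 1 → p e i ∈ P e := fun e i hi =>
    mem_image_of_mem _ (mem_range.2 (by omega))
  have hPmem' : ∀ e w, w ∈ P e → ∃ i ≤ k + 1, p e i = w := by
    intro e w hw
    obtain ⟨i, hi, h1⟩ := mem_image.1 hw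
    exact ⟨i, by have := mem_range.1 hi; omega, h1⟩
  have hPcard : ∀ e, #(P e) ≤ k + 2 := fun e => card_image_le.trans (card_range _).le
  obtain ⟨R, hR⟩ := exists_sample E P (fun e => (P e).biUnion out \ P e) ((k + 2) * (d₀ + 1))
    (fun e _ => disjoint_sdiff) (by
      intro e _
      have h1 : #((P e).biUnion out \ P e) ≤ (k + 2) * d₀ :=
        (card_le_card sdiff_subset).trans
          ((card_biUnion_le_card_mul _ _ d₀ fun v _ => hρ v).trans
            (Nat.mul_le_mul (hPcard e) le_rfl))
      have h2 := hPcard e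
      calc _ ≤ (k + 2) + (k + 2) * d₀ := Nat.add_le_add h2 h1
        _ = _ := by ring)
  set E' := ({e ∈ E | P e ⊆ R ∧ Disjoint ((P e).biUnion out \ P e) R} : Finset ι) with hE'
  have hE'E : E' ⊆ E := filter_subset _ _
  have key : ∀ e ∈ E', ∀ e' ∈ E', ∀ v ∈ P e, ∀ w ∈ P e', G.Adj v w → w ∈ P e ∨ v ∈ P e' := by
    have aux : ∀ e ∈ E', ∀ e' ∈ E', ∀ v ∈ P e, ∀ w ∈ P e', G.Adj v w → ρ w ≤ ρ v → w ∈ P e := by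
      intro e he e' he' v hv w hw hadj hle
      by_contra hcon
      refine Finset.disjoint_left.1 (mem_filter.1 he).2.2 (mem_sdiff.2 ⟨?_, hcon⟩)
        ((mem_filter.1 he').2.1 hw)
      exact mem_biUnion.2 ⟨v, hv, mem_filter.2 ⟨by simpa using hle, hadj⟩⟩
    intro e he e' he' v hv w hw hadj
    rcases le_total (ρ w) (ρ v) with hle | hle
    · exact Or.inl (aux e he e' he' v hv w hw hadj hle)
    · exact Or.inr (aux e' he' e he w hw v hv hadj.symm hle)
  have hsame : ∀ e ∈ E', ∀ e' ∈ E', ∀ i, 1 ≤ i → i ≤ k → p e i ∈ P e' → e = e' := by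
    intro e he e' he' i h1 h2 hm
    obtain ⟨j, hj, hji⟩ := hPmem' e' _ hm
    have hS := h.interior e (hE'E he) i h1 h2
    have hj' : 1 ≤ j ∧ j ≤ k := by
      by_contra hcon
      have : j = 0 ∨ j = k + 1 := by omega
      rcases this with rfl | rfl
      · exact hS (hji ▸ h.left_mem e' (hE'E he'))
      · exact hS (hji ▸ h.right_mem e' (hE'E he'))
    exact (h.inj e (hE'E he) e' (hE'E he') i j h1 h2 hj'.1 hj'.2 hji.symm).1
  have hend : ∀ e ∈ E', ∀ w ∈ S, w ∈ P e → w = p e 0 ∨ w = p e (k + 1) := by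
    intro e he w hwS hw
    obtain ⟨j, hj, rfl⟩ := hPmem' e w hw
    rcases h.exists_of_mem (hE'E he) hj hwS with rfl | rfl
    · exact Or.inl rfl
    · exact Or.inr rfl
  set S' := E'.image (fun e => p e 0) ∪ E'.image (fun e => p e (k + 1)) with hS'
  have hS'mem : ∀ w ∈ S', w ∈ S ∧ ∃ e ∈ E', w ∈ P e := by
    intro w hw
    rcases mem_union.1 hw with hw | hw
    · obtain ⟨e, he, rfl⟩ := mem_image.1 hw
      exact ⟨h.left_mem e (hE'E he), e, he, hPmem e _ (by omega)⟩
    · obtain ⟨e, he, rfl⟩ := mem_image.1 hw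
      exact ⟨h.right_mem e (hE'E he), e, he, hPmem e _ (by omega)⟩
  have hchord : ∀ e ∈ E', ¬ G.Adj (p e 0) (p e (k + 1)) := fun e he hadj => by
    have := hc e (hE'E he) 0 (k + 1) (by omega) le_rfl hadj
    omega
  have hpair : ∀ e ∈ E', ∀ u ∈ S, ∀ v ∈ S, u ∈ P e → v ∈ P e → ¬ G.Adj u v := by
    intro e he u hu v hv hue hve hadj
    rcases hend e he u hu hue with rfl | rfl <;> rcases hend e he v hv hve with rfl | rfl
    · exact hadj.ne rfl
    · exact hchord e he hadj
    · exact hchord e he hadj.symm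
    · exact hadj.ne rfl
  refine ⟨S', fun w hw => (hS'mem w hw).1, E', hE'E, ⟨?_, ?_, ?_, ?_⟩, hR⟩
  · refine h.subset (fun w hw => (hS'mem w hw).1) hE'E ?_ ?_
    · exact fun e he => mem_union_left _ (mem_image_of_mem _ he)
    · exact fun e he => mem_union_right _ (mem_image_of_mem (fun e => p e (k + 1)) he)
  · intro u hu v hv hadj
    obtain ⟨huS, e, he, hue⟩ := hS'mem u hu
    obtain ⟨hvS, e', he', hve⟩ := hS'mem v hv
    rcases key e he e' he' u hue v hve hadj with h1 | h1
    · exact hpair e he u huS v hvS hue h1 hadj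
    · exact hpair e' he' u huS v hvS h1 hve hadj
  · intro e he i h1 h2 w hw hadj
    obtain ⟨hwS, e', he', hwe⟩ := hS'mem w hw
    have hwe' : w ∈ P e := by
      rcases key e he e' he' (p e i) (hPmem e i (by omega)) w hwe hadj with h3 | h3
      · exact h3
      · rwa [hsame e he e' he' i h1 h2 h3]
    rcases hend e he w hwS hwe' with rfl | rfl
    · exact Or.inl ⟨rfl, by
        have := hc e (hE'E he) 0 i (by omega) (by omega) hadj.symm
        omega⟩
    · exact Or.inr ⟨rfl, by
        have := hc e (hE'E he) i (k + 1) (by omega) (by omega) hadj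
        omega⟩
  · intro e he e' he' i j h1 h2 h3 h4 hadj
    have hee : e = e' := by
      rcases key e he e' he' (p e i) (hPmem e i (by omega)) (p e' j) (hPmem e' j (by omega)) hadj
        with h5 | h5
      · exact (hsame e' he' e he j h3 h4 h5).symm
      · exact hsame e he e' he' i h1 h2 h5
    subst hee
    refine ⟨rfl, ?_⟩
    rcases lt_trichotomy i j with hlt | rfl | hgt
    · have := hc e (hE'E he) i j hlt (by omega) hadj
      omega
    · exact absurd rfl hadj.ne
    · have := hc e (hE'E he) j i hgt (by omega) hadj.symm
      omega

/-- Sparse graphs all of whose induced subdivisions are sparse have only sparse linkages. -/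
lemma exists_linkage_bound (d₀ : ℕ) (d : ℕ → ℕ) (k : ℕ) : ∃ c : ℕ, ∀ (V : Type) [Fintype V]
    (G : SimpleGraph V), (∀ S : Finset V, edgesBetween G S S ≤ d₀ * #S) →
    (∀ k, 1 ≤ k → InducedDensityLE G k (d k)) →
    ∀ (ι : Type) (S : Finset V) (E : Finset ι) (p : ι → ℕ → V), IsLinkage G k S E p →
      #E ≤ c * #S := by
  induction k using Nat.strong_induction_on with
  | _ k ih =>
    rcases Nat.eq_zero_or_pos k with rfl | hk
    · exact ⟨d₀, fun V _ G h₀ _ ι S E p h => h.card_le_edgesBetween.trans (h₀ S)⟩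
    choose! c hc using ih
    let C := ∑ k' ∈ range k, c k'
    refine ⟨(k + 2) * ((k + 2) * C) + 2 ^ ((k + 2) * (d₀ + 1)) * d k,
      fun V _ G h₀ hd ι S E p h => ?_⟩
    let Echord : ℕ → ℕ → Finset ι := fun i j =>
      {e ∈ E | i + 1 < j ∧ j ≤ k + 1 ∧ G.Adj (p e i) (p e j)}
    let Efree : Finset ι :=
      {e ∈ E | ∀ i j, i < j → j ≤ k + 1 → G.Adj (p e i) (p e j) → j = i + 1}
    have h1 : ∀ i j, #(Echord i j) ≤ C * #S := by
      intro i j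
      by_cases hij : i + 1 < j ∧ j ≤ k + 1
      · have h2 : IsLinkage G k S (Echord i j) p := h.subset subset_rfl (filter_subset _ _)
          (fun e he => h.left_mem e (mem_filter.1 he).1)
          (fun e he => h.right_mem e (mem_filter.1 he).1)
        have h3 := h2.shortcut hij.1 hij.2 (fun e he => (mem_filter.1 he).2.2.2)
        have h4 := hc (k - (j - i - 1)) (by omega) V G h₀ hd ι S _ _ h3
        refine h4.trans (Nat.mul_le_mul ?_ le_rfl)
        exact single_le_sum (f := c) (fun _ _ => Nat.zero_le _) (mem_range.2 (by omega))
      · have : Echord i j = ∅ := by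
          rw [filter_eq_empty_iff]
          intro e _ hh
          exact hij ⟨hh.1, hh.2.1⟩
        simp [this]
    have h2 : #Efree ≤ 2 ^ ((k + 2) * (d₀ + 1)) * (d k * #S) := by
      have h3 : IsLinkage G k S Efree p := h.subset subset_rfl (filter_subset _ _)
        (fun e he => h.left_mem e (mem_filter.1 he).1)
        (fun e he => h.right_mem e (mem_filter.1 he).1)
      obtain ⟨S', hS', E', -, h4, h5⟩ := h3.exists_induced hk h₀ (fun e he => (mem_filter.1 he).2)
      exact h5.trans (Nat.mul_le_mul le_rfl ((hd k hk S' ι E' p h4).trans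
        (Nat.mul_le_mul le_rfl (card_le_card hS'))))
    have h3 : E ⊆ ((range (k + 2)).biUnion fun i => (range (k + 2)).biUnion fun j => Echord i j)
        ∪ Efree := by
      intro e he
      rw [mem_union]
      by_cases hf : e ∈ Efree
      · exact Or.inr hf
      · left
        have : ¬ ∀ i j, i < j → j ≤ k + 1 → G.Adj (p e i) (p e j) → j = i + 1 :=
          fun hh => hf (mem_filter.2 ⟨he, hh⟩)
        push Not at this
        obtain ⟨i, j, h4, h5, h6, h7⟩ := this
        exact mem_biUnion.2 ⟨i, mem_range.2 (by omega), mem_biUnion.2 ⟨j, mem_range.2 (by omega),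
          mem_filter.2 ⟨he, by omega, h5, h6⟩⟩⟩
    calc #E ≤ _ := card_le_card h3
      _ ≤ _ := card_union_le _ _
      _ ≤ (k + 2) * ((k + 2) * (C * #S)) + 2 ^ ((k + 2) * (d₀ + 1)) * (d k * #S) := by
          refine Nat.add_le_add ?_ h2
          refine (card_biUnion_le_card_mul _ _ ((k + 2) * (C * #S)) fun i _ => ?_).trans (by simp)
          exact (card_biUnion_le_card_mul _ _ (C * #S) fun j _ => h1 i j).trans (by simp)
      _ = _ := by ring

end LinkageBound

section Separators

open scoped Classical
open Finset

lemma SimpleGraph.Walk.exists_sequence {V : Type} {G : SimpleGraph V} {u v : V} (w : G.Walk u v)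
    (hne : u ≠ v) : ∃ (k : ℕ) (p : ℕ → V), k + 1 ≤ w.length ∧ p 0 = u ∧ p (k + 1) = v ∧
      (∀ i ≤ k, G.Adj (p i) (p (i + 1))) ∧ (∀ i ≤ k + 1, p i ∈ w.support) ∧
      ∀ i ≤ k + 1, ∀ j ≤ k + 1, p i = p j → i = j := by
  have hpos : 0 < w.bypass.length := by
    rcases Nat.eq_zero_or_pos w.bypass.length with h | h
    · exact absurd (Walk.eq_of_length_eq_zero h) hne
    · exact h
  obtain ⟨k, hk⟩ : ∃ k, w.bypass.length = k + 1 := ⟨w.bypass.length - 1, by omega⟩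
  refine ⟨k, w.bypass.getVert, ?_, Walk.getVert_zero _, ?_, ?_, ?_, ?_⟩
  · rw [← hk]; exact w.length_bypass_le_length
  · rw [← hk]; exact Walk.getVert_length _
  · intro i hi
    exact Walk.adj_getVert_succ _ (by omega)
  · intro i _
    exact w.support_bypass_subset_support (Walk.getVert_mem_support _ _)
  · intro i hi j hj hh
    exact (w.bypass_isPath).getVert_injOn (by simpa [hk] using hi) (by simpa [hk] using hj) hh

lemma exists_walk_of_sequence {V : Type} {G : SimpleGraph V} (p : ℕ → V) (n : ℕ)
    (h : ∀ i < n, G.Adj (p i) (p (i + 1))) :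
    ∃ w : G.Walk (p 0) (p n), w.length = n ∧ ∀ z ∈ w.support, ∃ i ≤ n, p i = z := by
  induction n with
  | zero => exact ⟨Walk.nil, rfl, fun z hz => ⟨0, le_rfl, by simpa using Eq.symm (by simpa using hz)⟩⟩
  | succ n ih =>
    obtain ⟨w, hw, hs⟩ := ih fun i hi => h i (by omega)
    refine ⟨w.concat (h n (by omega)), by rw [Walk.length_concat, hw], fun z hz => ?_⟩
    rw [Walk.support_concat, List.mem_append, List.mem_singleton] at hz
    rcases hz with hz | rfl
    · obtain ⟨i, hi, h1⟩ := hs z hz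
      exact ⟨i, by omega, h1⟩
    · exact ⟨n + 1, le_rfl, rfl⟩

/-- A family of walks of length at most `L` with distinct pairs of endpoints in `S`, whose
interiors lie in the pairwise disjoint sets `I e` avoiding `S`. -/
structure IsWalkLinkage {V ι : Type} (G : SimpleGraph V) (L : ℕ) (S : Finset V) (E : Finset ι)
    (x y : ι → V) (I : ι → Finset V) : Prop where
  left_mem : ∀ e ∈ E, x e ∈ S
  right_mem : ∀ e ∈ E, y e ∈ S
  ne : ∀ e ∈ E, x e ≠ y e
  ends_inj : ∀ e ∈ E, ∀ e' ∈ E, s(x e, y e) = s(x e', y e') → e = e'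
  interior : ∀ e ∈ E, Disjoint (I e) S
  disj : ∀ e ∈ E, ∀ e' ∈ E, e ≠ e' → Disjoint (I e) (I e')
  walk : ∀ e ∈ E, ∃ w : G.Walk (x e) (y e), w.length ≤ L ∧
    ∀ z ∈ w.support, z = x e ∨ z = y e ∨ z ∈ I e

/-- Every walk linkage with walks of length at most `L` has at most `C` walks per branch vertex. -/
def WalkLinkageBound {V : Type} (G : SimpleGraph V) (L C : ℕ) : Prop :=
  ∀ (ι : Type) (S : Finset V) (E : Finset ι) (x y : ι → V) (I : ι → Finset V),
    IsWalkLinkage G L S E x y I → #E ≤ C * #S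

lemma walkLinkageBound_of_linkage {V : Type} {G : SimpleGraph V} (c : ℕ → ℕ)
    (hc : ∀ (k : ℕ) (ι : Type) (S : Finset V) (E : Finset ι) (p : ι → ℕ → V),
      IsLinkage G k S E p → #E ≤ c k * #S) (L : ℕ) :
    WalkLinkageBound G L (∑ k ∈ range L, c k) := by
  intro ι S E x y I h
  rcases E.eq_empty_or_nonempty with rfl | ⟨e₀, he₀⟩
  · simp
  have : Nonempty V := ⟨x e₀⟩
  have hex : ∀ e ∈ E, ∃ (k : ℕ) (p : ℕ → V), k < L ∧ p 0 = x e ∧ p (k + 1) = y e ∧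
      (∀ i ≤ k, G.Adj (p i) (p (i + 1))) ∧ (∀ i, 1 ≤ i → i ≤ k → p i ∈ I e) ∧
      ∀ i ≤ k + 1, ∀ j ≤ k + 1, p i = p j → i = j := by
    intro e he
    obtain ⟨w, hw, hs⟩ := h.walk e he
    obtain ⟨k, p, h1, h2, h3, h4, h5, h6⟩ := w.exists_sequence (h.ne e he)
    refine ⟨k, p, by omega, h2, h3, h4, fun i hi hik => ?_, h6⟩
    rcases hs _ (h5 i (by omega)) with h7 | h7 | h7
    · have := h6 i (by omega) 0 (by omega) (h7.trans h2.symm)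
      omega
    · have := h6 i (by omega) (k + 1) (by omega) (h7.trans h3.symm)
      omega
    · exact h7
  choose! k p h1 h2 h3 h4 h5 h6 using hex
  have hlink : ∀ n, IsLinkage G n S {e ∈ E | k e = n} p := by
    intro n
    refine ⟨?_, ?_, ?_, ?_, ?_, ?_, ?_⟩
    · intro e he
      rw [h2 e (mem_filter.1 he).1]; exact h.left_mem e (mem_filter.1 he).1
    · intro e he
      obtain ⟨he₁, rfl⟩ := mem_filter.1 he
      rw [h3 e he₁]; exact h.right_mem e he₁
    · intro e he
      obtain ⟨he₁, rfl⟩ := mem_filter.1 he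
      rw [h2 e he₁, h3 e he₁]; exact h.ne e he₁
    · intro e he e' he'
      obtain ⟨he₁, rfl⟩ := mem_filter.1 he
      obtain ⟨he₁', hk⟩ := mem_filter.1 he'
      rw [h2 e he₁, h3 e he₁, ← hk, h2 e' he₁', h3 e' he₁']
      exact h.ends_inj e he₁ e' he₁'
    · intro e he
      obtain ⟨he₁, rfl⟩ := mem_filter.1 he
      exact h4 e he₁
    · intro e he i h7 h8
      obtain ⟨he₁, rfl⟩ := mem_filter.1 he
      exact Finset.disjoint_left.1 (h.interior e he₁) (h5 e he₁ i h7 h8)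
    · intro e he e' he' i j h7 h8 h9 h10 hh
      obtain ⟨he₁, rfl⟩ := mem_filter.1 he
      obtain ⟨he₁', hk⟩ := mem_filter.1 he'
      have hee : e = e' := by
        by_contra hne
        refine Finset.disjoint_left.1 (h.disj e he₁ e' he₁' hne) (h5 e he₁ i h7 h8) ?_
        rw [hh]
        exact h5 e' he₁' j h9 (by omega)
      subst hee
      exact ⟨rfl, h6 e he₁ i (by omega) j (by omega) hh⟩
  rw [card_eq_sum_card_fiberwise (f := k) (t := range L)
    (fun e he => mem_coe.2 (mem_range.2 (h1 e he))), sum_mul]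
  exact sum_le_sum fun n _ => hc n ι S _ p (hlink n)

lemma sum_card_joined_le {V : Type} (E : Finset (V × V)) (T : Finset V) :
    ∑ v ∈ T, #{u ∈ T | (v, u) ∈ E ∨ (u, v) ∈ E} ≤ 2 * #{π ∈ E | π.1 ∈ T ∧ π.2 ∈ T} := by
  have h1 : ∑ v ∈ T, #{u ∈ T | (v, u) ∈ E} = #{π ∈ E | π.1 ∈ T ∧ π.2 ∈ T} := by
    have : ({π ∈ E | π.1 ∈ T ∧ π.2 ∈ T} : Finset (V × V)) = {π ∈ T ×ˢ T | π ∈ E} := by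
      ext π; simp only [mem_filter, mem_product]; tauto
    rw [this, card_filter, sum_product]
    exact sum_congr rfl fun v _ => card_filter _ _
  have h2 : ∑ v ∈ T, #{u ∈ T | (u, v) ∈ E} = #{π ∈ E | π.1 ∈ T ∧ π.2 ∈ T} := by
    have : ({π ∈ E | π.1 ∈ T ∧ π.2 ∈ T} : Finset (V × V)) = {π ∈ T ×ˢ T | π ∈ E} := by
      ext π; simp only [mem_filter, mem_product]; tauto
    rw [this, card_filter, sum_product_right]
    exact sum_congr rfl fun v _ => card_filter _ _
  calc _ ≤ ∑ v ∈ T, (#{u ∈ T | (v, u) ∈ E} + #{u ∈ T | (u, v) ∈ E}) := by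
        refine sum_le_sum fun v _ => ?_
        rw [filter_or]
        exact card_union_le _ _
    _ = _ := by rw [sum_add_distrib, h1, h2]; ring

/-- A fan of walks of length at most `r` from `v` to the vertices of `Y`, with disjoint interiors
avoiding `T`. -/
structure IsFan {V : Type} (G : SimpleGraph V) (r : ℕ) (T : Finset V) (v : V) (Y : Finset V)
    (J : V → Finset V) : Prop where
  subset : ∀ y ∈ Y, y ∈ T ∧ y ≠ v
  interior : ∀ y ∈ Y, Disjoint (J y) T
  card_le : ∀ y ∈ Y, #(J y) ≤ r
  disj : ∀ y ∈ Y, ∀ y' ∈ Y, y ≠ y' → Disjoint (J y) (J y')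
  walk : ∀ y ∈ Y, ∃ w : G.Walk v y, w.length ≤ r ∧ ∀ z ∈ w.support, z = v ∨ z = y ∨ z ∈ J y
  walk_int : ∀ y ∈ Y, ∀ u ∈ J y, ∃ w : G.Walk v u, w.length ≤ r ∧
    ∀ z ∈ w.support, z = v ∨ z ∈ J y

lemma exists_fan {V : Type} {G : SimpleGraph V} {r K : ℕ} {S T : Finset V} (hST : S ⊆ T) {v : V}
    (hv : v ∈ S) (h : ∀ Z : Finset V, #Z ≤ K → v ∉ Z → ∃ u ∈ S, u ≠ v ∧
      ∃ w : G.Walk v u, w.length ≤ r ∧ ∀ z ∈ Z, z ∉ w.support) (k : ℕ) (hk : k * (r + 1) ≤ K) :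
    ∃ Y J, IsFan G r T v Y J ∧ #Y = k := by
  induction k with
  | zero => exact ⟨∅, fun _ => ∅, by constructor <;> simp, rfl⟩
  | succ k ih =>
    obtain ⟨Y, J, hF, hY⟩ := ih (by nlinarith)
    obtain ⟨u, hu, huv, w, hw, hwZ⟩ := h (Y ∪ Y.biUnion J) (by
        refine (card_union_le _ _).trans ?_
        have := card_biUnion_le_card_mul Y J r hF.card_le
        rw [hY] at this ⊢
        nlinarith) (by
        rw [mem_union, mem_biUnion]
        rintro (h1 | ⟨y, hy, h1⟩)
        · exact (hF.subset v h1).2 rfl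
        · exact Finset.disjoint_left.1 (hF.interior y hy) h1 (hST hv))
    obtain ⟨n, p, h1, h2, h3, h4, h5, h6⟩ := w.exists_sequence huv.symm
    have hex : ∃ m, 1 ≤ m ∧ p m ∈ T := ⟨n + 1, by omega, h3 ▸ hST hu⟩
    set m := Nat.find hex with hm
    obtain ⟨hm1, hmT⟩ := Nat.find_spec hex
    have hmn : m ≤ n + 1 := Nat.find_min' hex ⟨by omega, h3 ▸ hST hu⟩
    have hmin : ∀ i, 1 ≤ i → i < m → p i ∉ T := fun i hi him hT => Nat.find_min hex him ⟨hi, hT⟩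
    set J₀ : Finset V := (Ico 1 m).image p with hJ₀
    have hJ₀mem : ∀ z ∈ J₀, ∃ i, 1 ≤ i ∧ i < m ∧ p i = z := by
      intro z hz
      obtain ⟨i, hi, h7⟩ := mem_image.1 hz
      rw [mem_Ico] at hi
      exact ⟨i, hi.1, hi.2, h7⟩
    have hJ₀mem' : ∀ i, 1 ≤ i → i < m → p i ∈ J₀ := fun i h7 h8 =>
      mem_image_of_mem _ (mem_Ico.2 ⟨h7, h8⟩)
    have havoid : ∀ i ≤ m, p i ∉ Y ∪ Y.biUnion J := fun i hi hh => hwZ _ hh (h5 i (by omega))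
    have hyY : p m ∉ Y := fun hh => havoid m le_rfl (mem_union_left _ hh)
    have hJold : ∀ y ∈ Y, Function.update J (p m) J₀ y = J y := fun y hy =>
      Function.update_of_ne (by rintro rfl; exact hyY hy) _ _
    have hJnew : Function.update J (p m) J₀ (p m) = J₀ := Function.update_self _ _ _
    have hd : ∀ y ∈ Y, Disjoint (J y) J₀ := by
      intro y hy
      rw [Finset.disjoint_right]
      intro z hz hzy
      obtain ⟨i, h7, h8, rfl⟩ := hJ₀mem z hz
      exact havoid i h8.le (mem_union_right _ (mem_biUnion.2 ⟨y, hy, hzy⟩))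
    refine ⟨insert (p m) Y, Function.update J (p m) J₀, ⟨?_, ?_, ?_, ?_, ?_, ?_⟩, ?_⟩
    · intro y hy
      rcases mem_insert.1 hy with rfl | hy
      · refine ⟨hmT, fun hh => ?_⟩
        have := h6 m hmn 0 (by omega) (hh.trans h2.symm)
        omega
      · exact hF.subset y hy
    · intro y hy
      rcases mem_insert.1 hy with rfl | hy
      · rw [hJnew, Finset.disjoint_left]
        intro z hz
        obtain ⟨i, h7, h8, rfl⟩ := hJ₀mem z hz
        exact hmin i h7 h8
      · rw [hJold y hy]; exact hF.interior y hy
    · intro y hy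
      rcases mem_insert.1 hy with rfl | hy
      · rw [hJnew]
        refine card_image_le.trans ?_
        rw [Nat.card_Ico]
        omega
      · rw [hJold y hy]; exact hF.card_le y hy
    · intro y hy y' hy' hne
      rcases mem_insert.1 hy with rfl | hy <;> rcases mem_insert.1 hy' with rfl | hy'
      · exact absurd rfl hne
      · rw [hJnew, hJold y' hy']; exact (hd y' hy').symm
      · rw [hJnew, hJold y hy]; exact hd y hy
      · rw [hJold y hy, hJold y' hy']; exact hF.disj y hy y' hy' hne
    · intro y hy
      rcases mem_insert.1 hy with rfl | hy
      · rw [hJnew]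
        obtain ⟨w', hw', hs⟩ := exists_walk_of_sequence (G := G) p m fun i hi => h4 i (by omega)
        refine ⟨w'.copy h2 rfl, by rw [Walk.length_copy]; omega, fun z hz => ?_⟩
        rw [Walk.support_copy] at hz
        obtain ⟨i, hi, rfl⟩ := hs z hz
        rcases Nat.eq_zero_or_pos i with rfl | hpos
        · exact Or.inl h2
        rcases hi.lt_or_eq with hlt | rfl
        · exact Or.inr (Or.inr (hJ₀mem' i hpos hlt))
        · exact Or.inr (Or.inl rfl)
      · rw [hJold y hy]; exact hF.walk y hy
    · intro y hy
      rcases mem_insert.1 hy with rfl | hy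
      · rw [hJnew]
        intro u hu
        obtain ⟨j, h7, h8, rfl⟩ := hJ₀mem u hu
        obtain ⟨w', hw', hs⟩ := exists_walk_of_sequence (G := G) p j fun i hi => h4 i (by omega)
        refine ⟨w'.copy h2 rfl, by rw [Walk.length_copy]; omega, fun z hz => ?_⟩
        rw [Walk.support_copy] at hz
        obtain ⟨i, hi, rfl⟩ := hs z hz
        rcases Nat.eq_zero_or_pos i with rfl | hpos
        · exact Or.inl h2
        · exact Or.inr (hJ₀mem' i hpos (by omega))
      · rw [hJold y hy]; exact hF.walk_int y hy
    · rw [card_insert_of_notMem hyY, hY]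

/-- A maximal walk linkage on `S`. -/
lemma exists_maximal_walkLinkage {V : Type} [Fintype V] (G : SimpleGraph V) (L : ℕ)
    (S : Finset V) : ∃ (E : Finset (V × V)) (I : V × V → Finset V),
      IsWalkLinkage G L S E Prod.fst Prod.snd I ∧ #(E.biUnion I) ≤ #E * (L + 1) ∧
      ∀ u ∈ S, ∀ v ∈ S, u ≠ v → (u, v) ∉ E → (v, u) ∉ E → ∀ w : G.Walk u v, w.length ≤ L →
        ∃ z ∈ w.support, z ≠ u ∧ z ≠ v ∧ z ∈ S ∪ E.biUnion I := by
  let P : ℕ → Prop := fun n => ∃ (E : Finset (V × V)) (I : V × V → Finset V), #E = n ∧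
    IsWalkLinkage G L S E Prod.fst Prod.snd I ∧ ∀ e ∈ E, #(I e) ≤ L + 1
  have hP0 : P 0 := ⟨∅, fun _ => ∅, rfl, by constructor <;> simp, by simp⟩
  obtain ⟨E, I, hE, hl, hI⟩ : P (Nat.findGreatest P (Fintype.card (V × V))) :=
    Nat.findGreatest_spec (Nat.zero_le _) hP0
  refine ⟨E, I, hl, card_biUnion_le_card_mul _ _ _ hI, ?_⟩
  intro u hu v hv hne h1 h2 w hw
  by_contra hcon
  push Not at hcon
  set I₀ : Finset V := w.support.toFinset \ {u, v} with hI₀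
  have hI₀mem : ∀ z ∈ I₀, z ∉ S ∧ ∀ e ∈ E, z ∉ I e := by
    intro z hz
    rw [hI₀, mem_sdiff, List.mem_toFinset, mem_insert, mem_singleton, not_or] at hz
    have := hcon z hz.1 hz.2.1 hz.2.2
    rw [mem_union, not_or] at this
    exact ⟨this.1, fun e he hz => this.2 (mem_biUnion.2 ⟨e, he, hz⟩)⟩
  have hold : ∀ e ∈ E, Function.update I (u, v) I₀ e = I e := fun e he =>
    Function.update_of_ne (by rintro rfl; exact h1 he) _ _
  have hnew : Function.update I (u, v) I₀ (u, v) = I₀ := Function.update_self _ _ _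
  have hd : ∀ e ∈ E, Disjoint (I e) I₀ := fun e he =>
    Finset.disjoint_right.2 fun z hz => (hI₀mem z hz).2 e he
  have hP : P (#E + 1) := by
    refine ⟨insert (u, v) E, Function.update I (u, v) I₀, card_insert_of_notMem h1,
      ⟨?_, ?_, ?_, ?_, ?_, ?_, ?_⟩, ?_⟩
    · intro e he
      rcases mem_insert.1 he with rfl | he
      · exact hu
      · exact hl.left_mem e he
    · intro e he
      rcases mem_insert.1 he with rfl | he
      · exact hv
      · exact hl.right_mem e he
    · intro e he
      rcases mem_insert.1 he with rfl | he
      · exact hne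
      · exact hl.ne e he
    · have hnew : ∀ e ∈ E, s(u, v) ≠ s(e.1, e.2) := by
        intro e he hh
        rcases Sym2.eq_iff.1 hh with ⟨rfl, rfl⟩ | ⟨rfl, rfl⟩
        · exact h1 he
        · exact h2 he
      intro e he e' he' hh
      rcases mem_insert.1 he with rfl | he <;> rcases mem_insert.1 he' with rfl | he'
      · rfl
      · exact absurd hh (hnew e' he')
      · exact absurd hh.symm (hnew e he)
      · exact hl.ends_inj e he e' he' hh
    · intro e he
      rcases mem_insert.1 he with rfl | he
      · rw [hnew]; exact Finset.disjoint_left.2 fun z hz => (hI₀mem z hz).1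
      · rw [hold e he]; exact hl.interior e he
    · intro e he e' he' hee
      rcases mem_insert.1 he with rfl | he <;> rcases mem_insert.1 he' with rfl | he'
      · exact absurd rfl hee
      · rw [hnew, hold e' he']; exact (hd e' he').symm
      · rw [hnew, hold e he]; exact hd e he
      · rw [hold e he, hold e' he']; exact hl.disj e he e' he' hee
    · intro e he
      rcases mem_insert.1 he with rfl | he
      · rw [hnew]
        refine ⟨w, hw, fun z hz => ?_⟩
        by_cases hzu : z = u
        · exact Or.inl hzu
        by_cases hzv : z = v
        · exact Or.inr (Or.inl hzv)
        refine Or.inr (Or.inr ?_)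
        rw [hI₀, mem_sdiff, List.mem_toFinset]
        exact ⟨hz, by simp [hzu, hzv]⟩
      · rw [hold e he]; exact hl.walk e he
    · intro e he
      rcases mem_insert.1 he with rfl | he
      · rw [hnew]
        refine (card_le_card sdiff_subset).trans ((List.toFinset_card_le _).trans ?_)
        rw [Walk.length_support]
        omega
      · rw [hold e he]; exact hI e he
  have h3 := Nat.le_findGreatest (P := P) (n := Fintype.card (V × V)) (m := #E + 1) (by
    obtain ⟨E', I', h4, -⟩ := hP
    rw [← h4]
    exact card_le_univ _) hP
  omega

/-- In a graph with sparse walk linkages, every vertex set contains a vertex which can be separated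
from the rest of the set by few vertices, as far as short walks are concerned. -/
lemma exists_separator (r C : ℕ) : ∃ K : ℕ, ∀ (V : Type) [Fintype V] (G : SimpleGraph V),
    WalkLinkageBound G (2 * r) C → ∀ S : Finset V, S.Nonempty →
    ∃ v ∈ S, ∃ Z : Finset V, #Z ≤ K ∧ v ∉ Z ∧ ∀ u ∈ S, u ≠ v → ∀ w : G.Walk v u, w.length ≤ r →
      ∃ z ∈ Z, z ∈ w.support := by
  set k := C * ((1 + C * (2 * r + 1)) * (2 * C + 1)) + 1 with hk
  refine ⟨k * (r + 1), fun V _ G hG S hS => ?_⟩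
  by_contra hcon
  push Not at hcon
  obtain ⟨E, I, hl, hM, hfree⟩ := exists_maximal_walkLinkage G (2 * r) S
  set M := E.biUnion I
  have hE := hG _ _ _ _ _ _ hl
  obtain ⟨S', hS'S, hind, hS'⟩ := exists_independent (fun v u => (v, u) ∈ E ∨ (u, v) ∈ E)
    (fun u v h => h.symm) (2 * C) (fun v h => by
      rcases h with h | h <;> exact hl.ne _ h rfl) S (by
    intro T hT hne
    obtain ⟨v, hv, h1⟩ := exists_le_of_sum_le (s := T)
      (f := fun v => #{u ∈ T | (v, u) ∈ E ∨ (u, v) ∈ E}) (g := fun _ => 2 * C) hne (by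
        refine (sum_card_joined_le E T).trans ?_
        have : IsWalkLinkage G (2 * r) T {π ∈ E | π.1 ∈ T ∧ π.2 ∈ T} Prod.fst Prod.snd I := by
          have hsub : ∀ e ∈ ({π ∈ E | π.1 ∈ T ∧ π.2 ∈ T} : Finset (V × V)), e ∈ E :=
            fun e he => (mem_filter.1 he).1
          exact ⟨fun e he => (mem_filter.1 he).2.1, fun e he => (mem_filter.1 he).2.2,
            fun e he => hl.ne e (hsub e he),
            fun e he e' he' => hl.ends_inj e (hsub e he) e' (hsub e' he'),
            fun e he => (hl.interior e (hsub e he)).mono_right hT,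
            fun e he e' he' => hl.disj e (hsub e he) e' (hsub e' he'),
            fun e he => hl.walk e (hsub e he)⟩
        have h2 := hG _ _ _ _ _ _ this
        rw [sum_const, smul_eq_mul]
        nlinarith)
    refine ⟨v, hv, le_of_eq_of_le ?_ h1⟩
    congr!)
  have hfan : ∀ v ∈ S', ∃ Y J, IsFan G r (S ∪ M) v Y J ∧ #Y = k := by
    intro v hv
    refine exists_fan (K := k * (r + 1)) subset_union_left (hS'S hv) ?_ k le_rfl
    intro Z hZ hvZ
    obtain ⟨u, hu, huv, w, hw, h1⟩ := hcon v (hS'S hv) Z hZ hvZ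
    exact ⟨u, hu, huv, w, hw, h1⟩
  choose! Y J hF hY using hfan
  have hYS : ∀ v ∈ S', ∀ y ∈ Y v, y ∉ S' := by
    intro v hv y hy hyS
    obtain ⟨w, hw, hs⟩ := (hF v hv).walk y hy
    have hne := ((hF v hv).subset y hy).2
    have hj := hind v hv y hyS
    rw [not_or] at hj
    obtain ⟨z, hz, h1, h2, h3⟩ := hfree v (hS'S hv) y (hS'S hyS) hne.symm hj.1 hj.2 w (by omega)
    rcases hs z hz with h4 | h4 | h4
    · exact h1 h4
    · exact h2 h4
    · exact Finset.disjoint_left.1 ((hF v hv).interior y hy) h4 h3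
  have hJ : ∀ v ∈ S', ∀ v' ∈ S', v ≠ v' → ∀ y ∈ Y v, ∀ y' ∈ Y v', Disjoint (J v y) (J v' y') := by
    intro v hv v' hv' hne y hy y' hy'
    rw [Finset.disjoint_left]
    intro z hz hz'
    obtain ⟨w, hw, hs⟩ := (hF v hv).walk_int y hy z hz
    obtain ⟨w', hw', hs'⟩ := (hF v' hv').walk_int y' hy' z hz'
    have hj := hind v hv v' hv'
    rw [not_or] at hj
    obtain ⟨x, hx, h1, h2, h3⟩ := hfree v (hS'S hv) v' (hS'S hv') hne hj.1 hj.2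
      (w.append w'.reverse) (by rw [Walk.length_append, Walk.length_reverse]; omega)
    rw [Walk.mem_support_append_iff, Walk.support_reverse, List.mem_reverse] at hx
    rcases hx with hx | hx
    · rcases hs x hx with h4 | h4
      · exact h1 h4
      · exact Finset.disjoint_left.1 ((hF v hv).interior y hy) h4 h3
    · rcases hs' x hx with h4 | h4
      · exact h2 h4
      · exact Finset.disjoint_left.1 ((hF v' hv').interior y' hy') h4 h3
  set E₂ : Finset (Σ _ : V, V) := S'.sigma Y with hE₂
  have hl₂ : IsWalkLinkage G (2 * r) (S ∪ M) E₂ (fun e => e.1) (fun e => e.2)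
      (fun e => J e.1 e.2) := by
    refine ⟨?_, ?_, ?_, ?_, ?_, ?_, ?_⟩
    · intro e he
      exact mem_union_left _ (hS'S (mem_sigma.1 he).1)
    · intro e he
      exact ((hF e.1 (mem_sigma.1 he).1).subset e.2 (mem_sigma.1 he).2).1
    · intro e he
      exact ((hF e.1 (mem_sigma.1 he).1).subset e.2 (mem_sigma.1 he).2).2.symm
    · rintro ⟨v, y⟩ he ⟨v', y'⟩ he' hh
      have h1 := mem_sigma.1 he
      have h2 := mem_sigma.1 he'
      rcases Sym2.eq_iff.1 hh with ⟨h3, h4⟩ | ⟨h3, h4⟩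
      · simp only at h3 h4
        rw [h3, h4]
      · simp only at h3 h4 h1 h2
        exact absurd h1.1 (h3 ▸ hYS v' h2.1 y' h2.2)
    · intro e he
      exact (hF e.1 (mem_sigma.1 he).1).interior e.2 (mem_sigma.1 he).2
    · rintro ⟨v, y⟩ he ⟨v', y'⟩ he' hne
      have h1 := mem_sigma.1 he
      have h2 := mem_sigma.1 he'
      simp only at h1 h2
      by_cases hvv : v = v'
      · subst hvv
        exact (hF v h1.1).disj y h1.2 y' h2.2 fun hh => hne (by rw [hh])
      · exact hJ v h1.1 v' h2.1 hvv y h1.2 y' h2.2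
    · intro e he
      obtain ⟨w, hw, hs⟩ := (hF e.1 (mem_sigma.1 he).1).walk e.2 (mem_sigma.1 he).2
      exact ⟨w, by omega, hs⟩
  have h1 := hG _ _ _ _ _ _ hl₂
  have h2 : #E₂ = #S' * k := by
    rw [hE₂, card_sigma, sum_congr rfl hY, sum_const, smul_eq_mul]
  have h3 : #(S ∪ M) ≤ (1 + C * (2 * r + 1)) * #S := by
    calc #(S ∪ M) ≤ #S + #M := card_union_le _ _
      _ ≤ #S + C * #S * (2 * r + 1) := Nat.add_le_add le_rfl
          (hM.trans (Nat.mul_le_mul hE le_rfl))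
      _ = _ := by ring
  have h4 : 0 < #S' := by
    by_contra h0
    have h5 : #S' = 0 := by omega
    rw [h5, mul_zero] at hS'
    have := card_pos.2 hS
    omega
  have h5 : #S' * k ≤ C * ((1 + C * (2 * r + 1)) * (2 * C + 1)) * #S' := by
    calc #S' * k = #E₂ := h2.symm
      _ ≤ C * #(S ∪ M) := h1
      _ ≤ C * ((1 + C * (2 * r + 1)) * ((2 * C + 1) * #S')) :=
          Nat.mul_le_mul le_rfl (h3.trans (Nat.mul_le_mul le_rfl hS'))
      _ = _ := by ring
  rw [hk, mul_add, mul_one, mul_comm (#S')] at h5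
  omega

end Separators

section
open scoped Classical
open Finset

/-- The vertices which can be reached from a vertex by following `Z` at most `j` times. -/
noncomputable def iterReach {V : Type} (Z : V → Finset V) : ℕ → V → Finset V
  | 0, v => {v}
  | j + 1, v => insert v ((Z v).biUnion (iterReach Z j))

lemma card_iterReach_le {V : Type} {Z : V → Finset V} {K : ℕ} (hZ : ∀ v, #(Z v) ≤ K) (j : ℕ)
    (v : V) : #(iterReach Z j v) ≤ (K + 1) ^ j := by
  induction j generalizing v with
  | zero => simp [iterReach]
  | succ j ih =>
    rw [iterReach]
    refine (card_insert_le _ _).trans ?_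
    have h1 := card_biUnion_le_card_mul (Z v) (iterReach Z j) _ fun x _ => ih x
    have h2 := Nat.mul_le_mul_right ((K + 1) ^ j) (hZ v)
    have h3 : 1 ≤ (K + 1) ^ j := Nat.one_le_pow _ _ (by omega)
    rw [pow_succ]
    nlinarith

lemma mem_iterReach {V : Type} {G : SimpleGraph V} {Z : V → Finset V} {ρ : V → ℕ} {r : ℕ}
    (hZv : ∀ v, v ∉ Z v)
    (hZ : ∀ v u, ρ u ≤ ρ v → u ≠ v → ∀ w : G.Walk v u, w.length ≤ r → ∃ z ∈ Z v, z ∈ w.support)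
    (j : ℕ) (hj : j ≤ r) {v u : V} (w : G.Walk v u) (hw : w.length ≤ j)
    (hmin : ∀ x ∈ w.support, ρ u ≤ ρ x) : u ∈ iterReach Z j v := by
  induction j generalizing v with
  | zero =>
    have := Walk.eq_of_length_eq_zero (Nat.le_zero.1 hw)
    simp [iterReach, this]
  | succ j ih =>
    rw [iterReach, mem_insert]
    by_cases huv : u = v
    · exact Or.inl huv
    refine Or.inr ?_
    obtain ⟨z, hz, hzw⟩ := hZ v u (hmin v w.start_mem_support) huv w (by omega)
    refine mem_biUnion.2 ⟨z, hz, ih (by omega) (w.dropUntil z hzw) ?_ fun x hx =>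
      hmin x (w.support_dropUntil_subset_support hzw hx)⟩
    have h1 := congrArg Walk.length (w.take_spec hzw)
    rw [Walk.length_append] at h1
    have h2 : (w.takeUntil z hzw).length ≠ 0 := fun h0 =>
      hZv v (by have := Walk.eq_of_length_eq_zero h0; rwa [← this] at hz)
    omega

/-- A ranked coloring: a vertex which is minimal on a short walk has a color different from that of
the other end of the walk. -/
def IsRankedColoring {V α : Type} (G : SimpleGraph V) (r : ℕ) (ρ : V → ℕ) (c : V → α) : Prop :=
  ∀ v u, u ≠ v → ∀ w : G.Walk v u, w.length ≤ r → (∀ x ∈ w.support, ρ u ≤ ρ x) → c u ≠ c v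

lemma exists_rankedColoring (r C : ℕ) : ∃ N : ℕ, ∀ (V : Type) [Fintype V] (G : SimpleGraph V),
    WalkLinkageBound G (2 * r) C → ∃ (ρ : V → ℕ) (c : V → Fin N),
      Function.Injective ρ ∧ IsRankedColoring G r ρ c := by
  obtain ⟨K, hK⟩ := exists_separator r C
  refine ⟨(K + 1) ^ r + 1, fun V _ G hG => ?_⟩
  obtain ⟨ρ, hρ, hQ⟩ := exists_ordering (fun v S => ∃ Z : Finset V, #Z ≤ K ∧ v ∉ Z ∧
    ∀ u ∈ S, u ≠ v → ∀ w : G.Walk v u, w.length ≤ r → ∃ z ∈ Z, z ∈ w.support) (hK V G hG)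
  choose Z hZ1 hZ2 hZ3 using hQ
  obtain ⟨c, hc⟩ := exists_greedy_coloring ρ (fun v => {u ∈ iterReach Z r v | ρ u < ρ v})
    ((K + 1) ^ r) (fun v => (card_filter_le _ _).trans (card_iterReach_le hZ1 r v))
    (fun v u hu => (mem_filter.1 hu).2)
  refine ⟨ρ, c, hρ, fun v u huv w hw hmin => hc v u (mem_filter.2 ⟨?_, ?_⟩)⟩
  · refine mem_iterReach (ρ := ρ) hZ2 (fun v u h1 h2 => hZ3 v u ?_ h2) r le_rfl w hw hmin
    simpa using h1
  · exact lt_of_le_of_ne (hmin v w.start_mem_support) fun h => huv (hρ h)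

lemma exists_walk_of_segment {V : Type} {G : SimpleGraph V} (p : ℕ → V) {n : ℕ}
    (hadj : ∀ i < n, G.Adj (p i) (p (i + 1))) {a b : ℕ} (hab : a ≤ b) (hb : b ≤ n) :
    ∃ w : G.Walk (p a) (p b), w.length = b - a ∧
      ∀ x ∈ w.support, ∃ i, a ≤ i ∧ i ≤ b ∧ p i = x := by
  obtain ⟨w, hw, hs⟩ := exists_walk_of_sequence (G := G) (fun i => p (a + i)) (b - a)
    fun i hi => hadj (a + i) (by omega)
  refine ⟨w.copy rfl (congrArg p (by omega)), by rw [Walk.length_copy]; omega, fun x hx => ?_⟩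
  rw [Walk.support_copy] at hx
  obtain ⟨i, hi, rfl⟩ := hs x hx
  exact ⟨a + i, by omega, by omega, rfl⟩

lemma IsRankedColoring.card_image_le {V α : Type} {G : SimpleGraph V} {r : ℕ} {ρ : V → ℕ}
    {c : V → α} (hc : IsRankedColoring G r ρ c) (p : ℕ → V) {n : ℕ} (hn : n ≤ r)
    (hadj : ∀ i < n, G.Adj (p i) (p (i + 1)))
    (hinj : ∀ i ≤ n, ∀ j ≤ n, p i = p j → i = j) (k a b : ℕ) (hab : a + 2 ^ k ≤ b)
    (hb : b ≤ n + 1) : k + 1 ≤ #((Ico a b).image (c ∘ p)) := by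
  induction k generalizing a b with
  | zero =>
    refine card_pos.2 ⟨c (p a), mem_image.2 ⟨a, ?_, rfl⟩⟩
    rw [mem_Ico]
    exact ⟨le_rfl, by simpa using hab⟩
  | succ k ih =>
    have h2 : 0 < 2 ^ k := by positivity
    rw [pow_succ] at hab
    obtain ⟨m, hm, hmin⟩ := exists_min_image (Ico a b) (fun i => ρ (p i))
      ⟨a, mem_Ico.2 ⟨le_rfl, by omega⟩⟩
    have hm' := mem_Ico.1 hm
    have hdiff : ∀ i ∈ Ico a b, i ≠ m → c (p m) ≠ c (p i) := by
      intro i hi him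
      have hi' := mem_Ico.1 hi
      have hne : p m ≠ p i := fun h => him (hinj _ (by omega) _ (by omega) h).symm
      rcases le_total i m with h | h
      · obtain ⟨w, hw, hs⟩ := exists_walk_of_segment p hadj h (by omega)
        refine hc _ _ hne w (by omega) fun x hx => ?_
        obtain ⟨j, h3, h4, rfl⟩ := hs x hx
        exact hmin j (mem_Ico.2 ⟨by omega, by omega⟩)
      · obtain ⟨w, hw, hs⟩ := exists_walk_of_segment p hadj h (by omega)
        refine hc _ _ hne w.reverse (by rw [Walk.length_reverse]; omega) fun x hx => ?_
        rw [Walk.support_reverse, List.mem_reverse] at hx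
        obtain ⟨j, h3, h4, rfl⟩ := hs x hx
        exact hmin j (mem_Ico.2 ⟨by omega, by omega⟩)
    have key : ∀ a' b', a ≤ a' → b' ≤ b → m ∉ Ico a' b' → a' + 2 ^ k ≤ b' →
        k + 1 + 1 ≤ #((Ico a b).image (c ∘ p)) := by
      intro a' b' h3 h4 h5 h6
      have hnot : c (p m) ∉ (Ico a' b').image (c ∘ p) := by
        intro h
        obtain ⟨i, hi, h7⟩ := mem_image.1 h
        exact hdiff i (Ico_subset_Ico h3 h4 hi) (by rintro rfl; exact h5 hi) h7.symm
      refine (Nat.succ_le_succ (ih a' b' h6 (by omega))).trans ?_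
      rw [Nat.succ_eq_add_one, ← card_insert_of_notMem hnot]
      refine card_le_card (insert_subset (mem_image.2 ⟨m, hm, rfl⟩) ?_)
      exact image_subset_image (Ico_subset_Ico h3 h4)
    by_cases hcase : a + 2 ^ k ≤ m
    · exact key a m le_rfl (by omega) (by simp) hcase
    · exact key (m + 1) b (by omega) le_rfl (by simp) (by omega)

lemma IsRankedColoring.treeDepthLE {V α : Type} {G : SimpleGraph V} {p : ℕ} {ρ : V → ℕ}
    {c : V → α} (hρ : Function.Injective ρ) (hc : IsRankedColoring G (2 ^ p) ρ c) {I : Finset α}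
    (hI : #I ≤ p) (hcI : ∀ v, c v ∈ I) : TreeDepthLE G #I := by
  have hpath : ∀ v u, u ≠ v → ∀ w : G.Walk v u, (∀ x ∈ w.support, ρ u ≤ ρ x) → c u ≠ c v := by
    intro v u huv w hw
    refine hc v u huv w.bypass ?_ fun x hx => hw x (w.support_bypass_subset_support hx)
    by_contra hlen
    push Not at hlen
    have hP := w.bypass_isPath
    have := hc.card_image_le w.bypass.getVert le_rfl
      (fun i hi => w.bypass.adj_getVert_succ (by omega))
      (fun i hi j hj h => hP.getVert_injOn (by simp; omega) (by simp; omega) h) p 0 (2 ^ p)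
      (by omega) (by omega)
    have h2 : (Ico 0 (2 ^ p)).image (c ∘ w.bypass.getVert) ⊆ I := by
      intro x hx
      obtain ⟨i, -, rfl⟩ := mem_image.1 hx
      exact hcI _
    have := card_le_card h2
    omega
  have hconn : ∀ u u' v, (∃ w : G.Walk v u, ∀ x ∈ w.support, ρ u ≤ ρ x) →
      (∃ w : G.Walk v u', ∀ x ∈ w.support, ρ u' ≤ ρ x) → ρ u ≤ ρ u' →
      ∃ w : G.Walk u' u, ∀ x ∈ w.support, ρ u ≤ ρ x := by
    rintro u u' v ⟨w, hw⟩ ⟨w', hw'⟩ h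
    refine ⟨w'.reverse.append w, fun x hx => ?_⟩
    rw [Walk.mem_support_append_iff, Walk.support_reverse, List.mem_reverse] at hx
    rcases hx with hx | hx
    · exact h.trans (hw' x hx)
    · exact hw x hx
  refine ⟨fun u v => ∃ w : G.Walk v u, ∀ x ∈ w.support, ρ u ≤ ρ x, ⟨?_, ?_, ?_, ?_⟩, ?_, ?_⟩
  · exact fun v => ⟨Walk.nil, by simp⟩
  · rintro u v ⟨w, hw⟩ ⟨w', hw'⟩
    exact hρ (le_antisymm (hw v w.start_mem_support) (hw' u w'.start_mem_support))
  · rintro u v x ⟨w, hw⟩ ⟨w', hw'⟩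
    refine ⟨w'.append w, fun y hy => ?_⟩
    rw [Walk.mem_support_append_iff] at hy
    rcases hy with hy | hy
    · exact (hw v w.start_mem_support).trans (hw' y hy)
    · exact hw y hy
  · intro u u' v h h'
    rcases le_total (ρ u) (ρ u') with h1 | h1
    · exact Or.inl (hconn u u' v h h' h1)
    · exact Or.inr (hconn u' u v h' h h1)
  · intro u v huv
    rcases le_total (ρ u) (ρ v) with h1 | h1
    · exact Or.inl ⟨huv.symm.toWalk, by simp [h1]⟩
    · exact Or.inr ⟨huv.toWalk, by simp [h1]⟩
  · intro v
    rw [← Set.ncard_coe_finset]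
    refine Set.ncard_le_ncard_of_injOn c (fun u _ => hcI u) ?_ I.finite_toSet
    intro u hu u' hu' heq
    by_contra hne
    rcases le_total (ρ u) (ρ u') with h1 | h1
    · obtain ⟨w, hw⟩ := hconn u u' v hu hu' h1
      exact hpath _ _ hne w hw heq
    · obtain ⟨w, hw⟩ := hconn u' u v hu' hu h1
      exact hpath _ _ (Ne.symm hne) w hw heq.symm

lemma IsRankedColoring.comap {V W α : Type} {G : SimpleGraph V} {G' : SimpleGraph W} {r : ℕ}
    {ρ : V → ℕ} {c : V → α} (hc : IsRankedColoring G r ρ c) (f : G' ↪g G) :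
    IsRankedColoring G' r (ρ ∘ f) (c ∘ f) := by
  intro v u huv w hw hmin
  refine hc (f v) (f u) (fun h => huv (f.injective h)) (w.map f.toHom)
    ((Walk.length_map _ _).trans_le hw) fun x hx => ?_
  have hx' := (Walk.support_map f.toHom w) ▸ hx
  rw [List.mem_map] at hx'
  obtain ⟨y, hy, rfl⟩ := hx'
  exact hmin y hy

/-- In graphs of bounded chromatic number without large bicliques, `χ_p` is bounded by the
densities of the graphs whose exact subdivisions are induced subgraphs. -/
theorem exists_chiP_bound (d : ℕ → ℕ) (c s p : ℕ) : ∃ N : ℕ, ∀ (V : Type) [Fintype V]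
    (G : SimpleGraph V), (∀ k, 1 ≤ k → InducedDensityLE G k (d k)) → G.Colorable c →
      NoBiclique G s → chiP G p ≤ N := by
  obtain ⟨d₀, hd₀⟩ := exists_edgesBetween_bound c s (d 1)
  choose b hb using exists_linkage_bound d₀ d
  obtain ⟨N, hN⟩ := exists_rankedColoring (2 ^ p) (∑ k ∈ range (2 * 2 ^ p), b k)
  refine ⟨N, fun V _ G hG hcol hbi => ?_⟩
  have h0 := hd₀ V G hcol hbi (hG 1 le_rfl)
  obtain ⟨ρ, f, hρ, hf⟩ := hN V G
    (walkLinkageBound_of_linkage b (fun k => hb k V G h0 hG) _)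
  refine Nat.sInf_le ⟨f, fun I hI => ?_⟩
  exact (hf.comap (SimpleGraph.Embedding.induce _)).treeDepthLE
    (fun x y h => Subtype.ext (hρ h)) hI fun v => v.2

end

section
open scoped Classical
open Finset

variable {V W : Type}

lemma IsSubgraphOf.card_le [Fintype V] [Fintype W] {H : SimpleGraph V} {G : SimpleGraph W}
    (h : IsSubgraphOf H G) : Fintype.card V ≤ Fintype.card W :=
  let ⟨f, hf⟩ := h
  Fintype.card_le_of_injective f hf

lemma bddAbove_cliques [Fintype V] (G : SimpleGraph V) :
    BddAbove {m | IsSubgraphOf (⊤ : SimpleGraph (Fin m)) G} :=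
  ⟨Fintype.card V, fun m hm => by simpa using hm.card_le⟩

lemma le_omegaNum [Fintype V] {G : SimpleGraph V} {m : ℕ}
    (h : IsSubgraphOf (⊤ : SimpleGraph (Fin m)) G) : m ≤ omegaNum G :=
  le_csSup (bddAbove_cliques G) h

lemma isSubgraphOf_omegaNum [Fintype V] (G : SimpleGraph V) :
    IsSubgraphOf (⊤ : SimpleGraph (Fin (omegaNum G))) G :=
  Nat.sSup_mem (s := {m | IsSubgraphOf (⊤ : SimpleGraph (Fin m)) G})
    ⟨0, ⟨Fin.elim0, fun {a} => a.elim0⟩, fun a => a.elim0⟩ (bddAbove_cliques G)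

lemma bddAbove_bicliques [Fintype V] (G : SimpleGraph V) :
    BddAbove {s | IsSubgraphOf (completeBipartiteGraph (Fin s) (Fin s)) G} :=
  ⟨Fintype.card V, fun m hm => by
    have := hm.card_le
    simp only [Fintype.card_sum, Fintype.card_fin] at this
    omega⟩

lemma le_bomega [Fintype V] {G : SimpleGraph V} {s : ℕ}
    (h : IsSubgraphOf (completeBipartiteGraph (Fin s) (Fin s)) G) : s ≤ bomega G :=
  le_csSup (bddAbove_bicliques G) h

lemma isSubgraphOf_bomega [Fintype V] (G : SimpleGraph V) :
    IsSubgraphOf (completeBipartiteGraph (Fin (bomega G)) (Fin (bomega G))) G :=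
  Nat.sSup_mem (s := {s | IsSubgraphOf (completeBipartiteGraph (Fin s) (Fin s)) G})
    ⟨0, ⟨fun x => x.elim Fin.elim0 Fin.elim0, fun {a} => a.elim (fun a => a.elim0) fun a => a.elim0⟩,
      fun a => a.elim (fun a => a.elim0) fun a => a.elim0⟩ (bddAbove_bicliques G)

lemma colorable_chi [Fintype V] (G : SimpleGraph V) : G.Colorable (chi G) :=
  Nat.sInf_mem (s := {N | G.Colorable N}) ⟨_, G.colorable_of_fintype⟩

lemma chi_le {G : SimpleGraph V} {c : ℕ} (h : G.Colorable c) : chi G ≤ c :=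
  Nat.sInf_le h

lemma noBiclique_of_bomega_lt [Fintype V] {G : SimpleGraph V} {s : ℕ} (h : bomega G < s) :
    NoBiclique G s := by
  intro X Y hX hY hXY
  refine absurd (le_bomega (G := G) (s := s) ?_) (by omega)
  have hX' : X.card = s := hX
  let x : Fin s → V := fun i => (X.equivFin.symm (Fin.cast hX.symm i) : V)
  let y : Fin s → V := fun i => (Y.equivFin.symm (Fin.cast hY.symm i) : V)
  have hx : ∀ i, x i ∈ X := fun i => (X.equivFin.symm _).2
  have hy : ∀ i, y i ∈ Y := fun i => (Y.equivFin.symm _).2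
  refine ⟨⟨Sum.elim x y, ?_⟩, ?_⟩
  · rintro (i | i) (j | j) hij
    · simp at hij
    · exact hXY _ (hx i) _ (hy j)
    · exact (hXY _ (hx j) _ (hy i)).symm
    · simp at hij
  · rintro (i | i) (j | j) hij
    · have := (X.equivFin.symm).injective (Subtype.ext hij)
      simpa using this
    · exact absurd hij (hXY _ (hx i) _ (hy j)).ne
    · exact absurd hij (hXY _ (hx j) _ (hy i)).ne'
    · have := (Y.equivFin.symm).injective (Subtype.ext hij)
      simpa using this

lemma omegaNum_le_bomega [Fintype V] (G : SimpleGraph V) : omegaNum G ≤ 2 * bomega G + 1 := by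
  by_contra hcon
  obtain ⟨f, hf⟩ := isSubgraphOf_omegaNum G
  refine absurd (le_bomega (G := G) (s := bomega G + 1) ?_) (by omega)
  let g : Fin (bomega G + 1) ⊕ Fin (bomega G + 1) → Fin (omegaNum G) :=
    Sum.elim (fun i => ⟨i, by omega⟩) (fun i => ⟨bomega G + 1 + i, by omega⟩)
  have hg : Function.Injective g := by
    rintro (i | i) (j | j) hij <;> simp only [g, Sum.elim_inl, Sum.elim_inr, Fin.mk.injEq] at hij
    · rw [Fin.ext hij]
    · omega
    · omega
    · rw [Fin.ext (by omega : (i : ℕ) = j)]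
  exact ⟨⟨f ∘ g, fun {a b} hab => f.map_rel (by simpa using hg.ne hab.ne)⟩, hf.comp hg⟩

lemma bomega_le_of_not_induced [Fintype V] {G : SimpleGraph V} {c s : ℕ} (hc : G.Colorable c)
    (h : ¬ IsInducedSubgraphOf (completeBipartiteGraph (Fin s) (Fin s)) G) :
    bomega G ≤ c * s := by
  by_contra hcon
  push Not at hcon
  obtain ⟨f, hf⟩ := isSubgraphOf_bomega G
  obtain ⟨C⟩ := hc
  have key : ∀ g : Fin (bomega G) → V, Function.Injective g →
      ∃ g' : Fin s → V, Function.Injective g' ∧ (∀ i j, C (g' i) = C (g' j)) ∧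
        ∀ i, ∃ j, g' i = g j := by
    intro g hg
    obtain ⟨a, -, ha⟩ := exists_lt_card_fiber_of_mul_lt_card_of_maps_to (s := univ)
      (t := (univ : Finset (Fin c))) (f := fun i => C (g i)) (n := s) (fun _ _ => mem_univ _)
      (by simpa using hcon)
    obtain ⟨T, hT, hTs⟩ := exists_subset_card_eq ha.le
    have hm : ∀ i : Fin s, (T.equivFin.symm (Fin.cast hTs.symm i) : Fin (bomega G)) ∈ T :=
      fun i => Subtype.prop _
    refine ⟨fun i => g (T.equivFin.symm (Fin.cast hTs.symm i)), fun i j hij => ?_, fun i j => ?_,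
      fun i => ⟨_, rfl⟩⟩
    · have := (T.equivFin.symm).injective (Subtype.ext (hg hij))
      simpa using this
    · rw [(mem_filter.1 (hT (hm i))).2, (mem_filter.1 (hT (hm j))).2]
  obtain ⟨x, hx, hxc, hxf⟩ := key (fun i => f (Sum.inl i)) fun i j h => Sum.inl_injective (hf h)
  obtain ⟨y, hy, hyc, hyf⟩ := key (fun i => f (Sum.inr i)) fun i j h => Sum.inr_injective (hf h)
  have hxy : ∀ i j, G.Adj (x i) (y j) := by
    intro i j
    obtain ⟨i', hi⟩ := hxf i
    obtain ⟨j', hj⟩ := hyf j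
    rw [hi, hj]
    exact f.map_rel (by simp)
  have hinj : Function.Injective (Sum.elim x y) := by
    rintro (i | i) (j | j) hij
    · rw [hx hij]
    · exact absurd hij (hxy i j).ne
    · exact absurd hij (hxy j i).ne'
    · rw [hy hij]
  refine h ⟨⟨⟨Sum.elim x y, hinj⟩, fun {a b} => ?_⟩⟩
  change G.Adj (Sum.elim x y a) (Sum.elim x y b) ↔ _
  rcases a with i | i <;> rcases b with j | j
  · simpa using fun h => C.valid h (hxc i j)
  · simpa using hxy i j
  · simpa using (hxy j i).symm
  · simpa using fun h => C.valid h (hyc i j)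

lemma MemTM.card_le [Fintype V] {G : SimpleGraph V} {r n : ℕ} {H : SimpleGraph (Fin n)}
    (h : MemTM r G H) : n ≤ Fintype.card V := by
  obtain ⟨t, -, f, hf⟩ := h
  simpa using Fintype.card_le_of_injective (fun i : Fin n => f (Sum.inl i))
    fun i j hij => Sum.inl_injective (hf hij)

lemma omegaNum_top (m : ℕ) : omegaNum (⊤ : SimpleGraph (Fin m)) = m :=
  le_antisymm (by simpa using (isSubgraphOf_omegaNum (⊤ : SimpleGraph (Fin m))).card_le)
    (le_omegaNum ⟨Hom.id, fun _ _ h => h⟩)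

lemma le_omegaTM [Fintype V] {G : SimpleGraph V} {r m : ℕ}
    (h : MemTM r G (⊤ : SimpleGraph (Fin m))) : m ≤ omegaTM r G := by
  refine le_csSup ⟨Fintype.card V, ?_⟩ ⟨m, ⊤, h, omegaNum_top m⟩
  rintro _ ⟨k, H, hH, rfl⟩
  have := (isSubgraphOf_omegaNum H).card_le
  simp only [Fintype.card_fin] at this
  exact this.trans hH.card_le

lemma omegaNum_le_omegaTM [Fintype V] (G : SimpleGraph V) (r : ℕ) :
    omegaNum G ≤ omegaTM r G := by
  obtain ⟨f, hf⟩ := isSubgraphOf_omegaNum G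
  refine le_omegaTM ⟨fun _ => 0, fun _ => Nat.zero_le _,
    ⟨Sum.elim f fun x => x.2.elim0, ?_⟩, ?_⟩
  · rintro (i | ⟨e, i⟩) (j | ⟨e', j⟩) hij
    · exact f.map_rel (by
        rw [top_adj]
        rintro rfl
        exact hij.ne rfl)
    · exact j.elim0
    · exact i.elim0
    · exact i.elim0
  · rintro (i | ⟨e, i⟩) (j | ⟨e', j⟩) hij
    · exact congrArg _ (hf hij)
    · exact j.elim0
    · exact i.elim0
    · exact i.elim0

lemma bomega_lt_omegaTM [Fintype V] (G : SimpleGraph V) {r : ℕ} (hr : 1 ≤ r) :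
    bomega G ≤ (omegaTM r G + 1) * (omegaTM r G + 1) := by
  by_contra hcon
  set m := omegaTM r G + 1 with hm
  refine absurd (le_omegaTM (G := G) (r := r) (m := m) ?_) (by omega)
  obtain ⟨f, hf⟩ := isSubgraphOf_bomega G
  have hmm : m ≤ m * m := Nat.le_mul_self m
  let a : Fin m → Fin (bomega G) := fun i => ⟨i, by omega⟩
  let b : Fin m × Fin m → Fin (bomega G) := fun x =>
    ⟨finProdFinEquiv x, (finProdFinEquiv x).2.trans (by omega)⟩
  have ha : Function.Injective a := fun i j h => Fin.ext (by simpa [a] using h)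
  have hb : Function.Injective b := fun x y h =>
    finProdFinEquiv.injective (Fin.ext (Fin.mk.inj_iff.1 h))
  refine ⟨fun _ => 1, fun _ => hr, ⟨Sum.elim (fun i => f (Sum.inl (a i)))
    fun x => f (Sum.inr (b x.1.1)), ?_⟩, ?_⟩
  · rintro (i | ⟨e, i⟩) (j | ⟨e', j⟩) hij
    · rw [Subdiv, fromRel_adj] at hij
      obtain ⟨-, ⟨_, h⟩ | ⟨_, h⟩⟩ := hij <;> exact absurd h one_ne_zero
    · exact f.map_rel (by simp)
    · exact f.map_rel (by simp)
    · rw [Subdiv, fromRel_adj] at hij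
      have hi := i.2
      have hj := j.2
      obtain ⟨-, ⟨-, h⟩ | ⟨-, h⟩⟩ := hij <;> simp only [Nat.lt_one_iff] at hi hj <;> omega
  · rintro (i | ⟨e, i⟩) (j | ⟨e', j⟩) hij
    · exact congrArg _ (ha (Sum.inl_injective (hf hij)))
    · cases hf hij
    · cases hf hij
    · have h := Subtype.ext (hb (Sum.inr_injective (hf hij)))
      subst h
      rw [Subsingleton.elim i j]

lemma chiP_one_le [Fintype V] (G : SimpleGraph V) : chiP G 1 ≤ chi G := by
  obtain ⟨c⟩ := colorable_chi G
  refine Nat.sInf_le ⟨c, fun I hI => ⟨fun u v => u = v, ⟨fun v => rfl, fun u v h _ => h,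
    fun u v w h h' => h.trans h', fun u v w h h' => Or.inl (h.trans h'.symm)⟩, ?_, ?_⟩⟩
  · intro u v huv
    exact absurd (card_le_one.1 hI _ u.2 _ v.2) (c.valid huv)
  · intro v
    have : {u | u = v} = {v} := by ext; simp
    rw [this, Set.ncard_singleton]
    exact card_pos.2 ⟨_, v.2⟩

lemma ChiBounded.exists_colorable {C : GraphClass} (h : ChiBounded C) : ∃ f : ℕ → ℕ,
    ∀ ⦃n : ℕ⦄ (G : SimpleGraph (Fin n)), G ∈ C n → G.Colorable (f (omegaNum G)) := by
  obtain ⟨f, hf⟩ := h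
  exact ⟨f, fun n G hG => (colorable_chi G).mono (hf G hG G ⟨Embedding.refl⟩)⟩

lemma chiP_le_bomega {C : GraphClass} (hχ : ChiBounded C)
    (hd : ∀ r : ℕ, 1 ≤ r → ∃ d : ℝ, ∀ ⦃m : ℕ⦄ (H : SimpleGraph (Fin m)), MemITMClass r C H →
      avgDeg H ≤ d) (p : ℕ) : ∃ f : ℕ → ℕ,
    ∀ ⦃n : ℕ⦄ (G : SimpleGraph (Fin n)), G ∈ C n → chiP G p ≤ f (bomega G) := by
  obtain ⟨f, hf⟩ := hχ.exists_colorable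
  choose! d hd using hd
  choose N hN using fun c s => exists_chiP_bound (fun k => ⌈d k⌉₊) c s p
  refine ⟨fun b => N ((range (2 * b + 2)).sup f) (b + 1), fun n G hG => ?_⟩
  refine hN _ _ _ G (fun k hk => inducedDensityLE_of_avgDeg hk fun m H hH =>
    hd k hk H ⟨n, G, hG, hH⟩) ((hf G hG).mono (le_sup ?_)) (noBiclique_of_bomega_lt (by omega))
  rw [mem_range]
  have := omegaNum_le_bomega G
  omega

lemma stronglyChiPBounded_of_bomega {C : GraphClass} (hχ : ChiBounded C) {p : ℕ}
    (h : ∃ f : ℕ → ℕ, ∀ ⦃n : ℕ⦄ (G : SimpleGraph (Fin n)), G ∈ C n → chiP G p ≤ f (bomega G))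
    (s : ℕ) : StronglyChiPBounded (fun n => {G : SimpleGraph (Fin n) | G ∈ C n ∧
      ¬ IsInducedSubgraphOf (completeBipartiteGraph (Fin s) (Fin s)) G}) p := by
  obtain ⟨f, hf⟩ := hχ.exists_colorable
  obtain ⟨g, hg⟩ := h
  refine ⟨fun w => (range (f w * s + 1)).sup g, fun n G hG => (hg G hG.1).trans (le_sup ?_)⟩
  rw [mem_range, Nat.lt_succ_iff]
  exact bomega_le_of_not_induced (hf G hG.1) hG.2

lemma bomega_bound_of_stronglyChiPBounded {C : GraphClass} {p : ℕ}
    (h : ∀ s : ℕ, 1 ≤ s → StronglyChiPBounded (fun n => {G : SimpleGraph (Fin n) | G ∈ C n ∧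
      ¬ IsInducedSubgraphOf (completeBipartiteGraph (Fin s) (Fin s)) G}) p) :
    ∃ f : ℕ → ℕ, ∀ ⦃n : ℕ⦄ (G : SimpleGraph (Fin n)), G ∈ C n → chiP G p ≤ f (bomega G) := by
  choose! g hg using h
  refine ⟨fun b => (range (2 * b + 2)).sup (g (b + 1)), fun n G hG => ?_⟩
  refine (hg (bomega G + 1) (by omega) G ⟨hG, fun hind => ?_⟩).trans (le_sup ?_)
  · obtain ⟨φ⟩ := hind
    have := le_bomega (G := G) ⟨φ.toHom, φ.injective⟩
    omega
  · rw [mem_range]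
    have := omegaNum_le_bomega G
    omega

lemma weaklyChiPBounded_of_bomega {C : GraphClass} (hχ : ChiBounded C) {p : ℕ} (hp : 1 ≤ p)
    (h : ∃ f : ℕ → ℕ, ∀ ⦃n : ℕ⦄ (G : SimpleGraph (Fin n)), G ∈ C n → chiP G p ≤ f (bomega G)) :
    WeaklyChiPBounded C p := by
  obtain ⟨f, hf⟩ := hχ.exists_colorable
  obtain ⟨g, hg⟩ := h
  rcases hp.eq_or_lt with rfl | hp
  · refine ⟨fun x => (range (x + 1)).sup f, fun n G hG =>
      (chiP_one_le G).trans ((chi_le (hf G hG)).trans (le_sup ?_))⟩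
    rw [mem_range, Nat.lt_succ_iff]
    exact omegaNum_le_omegaTM G _
  · refine ⟨fun x => (range ((x + 1) * (x + 1) + 1)).sup g, fun n G hG =>
      (hg G hG).trans (le_sup ?_)⟩
    rw [mem_range, Nat.lt_succ_iff]
    exact bomega_lt_omegaTM G (by omega)

end

section
open scoped Classical
open Finset

lemma colorable_of_edgesBetween_le {V : Type} [Fintype V] {H : SimpleGraph V} {D : ℕ}
    (h : ∀ T : Finset V, edgesBetween H T T ≤ D * #T) : H.Colorable (D + 1) := by
  obtain ⟨ρ, hρ, hQ⟩ := exists_ordering (fun v S => #{u ∈ S | H.Adj v u} ≤ D) fun S hS =>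
    exists_le_of_sum_le (s := S) (f := fun v => #{u ∈ S | H.Adj v u}) (g := fun _ => D) hS (by
      rw [sum_const, smul_eq_mul, mul_comm]
      exact h S)
  obtain ⟨c, hc⟩ := exists_greedy_coloring ρ (fun v => {u | ρ u < ρ v ∧ H.Adj v u}) D (fun v => by
    refine (card_le_card fun u hu => ?_).trans (hQ v)
    simp only [mem_filter, mem_univ, true_and] at hu ⊢
    exact ⟨hu.1.le, hu.2⟩) (fun v u hu => (mem_filter.1 hu).2.1)
  refine ⟨c, fun {u v} huv => ?_⟩
  rcases lt_or_gt_of_ne (hρ.ne huv.ne) with hlt | hlt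
  · exact hc v u (by simpa using ⟨hlt, huv.symm⟩)
  · exact (hc u v (by simpa using ⟨hlt, huv⟩)).symm

lemma MemITM.edgesBetween_le {V : Type} {G : SimpleGraph V} {r n D : ℕ} (hr : 1 ≤ r)
    {H : SimpleGraph (Fin n)} (h : MemITM r G H) (hD : InducedDensityLE G r D)
    (T : Finset (Fin n)) : edgesBetween H T T ≤ 2 * D * #T := by
  obtain ⟨φ⟩ := h
  have hl := (isInducedLinkage_subdiv H hr).map φ
  set E : Finset (Edges H) := {e | e.1.1 ∈ T ∧ e.1.2 ∈ T} with hE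
  have hl' := hl.subset (S' := (T.map Function.Embedding.inl).map φ.toEmbedding) (E' := E)
    (map_subset_map.2 (map_subset_map.2 (subset_univ _))) (subset_univ _)
    (fun e he => by
      rw [subdivPath_zero]
      simpa using (mem_filter.1 he).2.1)
    (fun e he => by
      rw [subdivPath_last]
      simpa using (mem_filter.1 he).2.2)
  have h1 := hD _ _ _ _ hl'
  rw [card_map, card_map] at h1
  have h2 := sum_card_joined_le ((univ : Finset (Edges H)).image fun e => e.1) T
  have h3 : #{π ∈ (univ : Finset (Edges H)).image (fun e => e.1) | π.1 ∈ T ∧ π.2 ∈ T} ≤ #E := by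
    refine le_trans (card_le_card ?_) (card_image_le (s := E) (f := fun e => e.1))
    intro π hπ
    obtain ⟨hπ, hT⟩ := mem_filter.1 hπ
    obtain ⟨e, -, rfl⟩ := mem_image.1 hπ
    exact mem_image.2 ⟨e, by simpa [hE] using hT, rfl⟩
  have h4 : edgesBetween H T T ≤ ∑ v ∈ T, #{u ∈ T |
      (v, u) ∈ (univ : Finset (Edges H)).image (fun e => e.1) ∨
      (u, v) ∈ (univ : Finset (Edges H)).image (fun e => e.1)} := by
    refine sum_le_sum fun v _ => card_le_card fun u hu => ?_
    rw [mem_filter] at hu ⊢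
    refine ⟨hu.1, ?_⟩
    rcases lt_or_gt_of_ne hu.2.ne with hlt | hlt
    · exact Or.inl (mem_image.2 ⟨⟨(v, u), hlt, hu.2⟩, mem_univ _, rfl⟩)
    · exact Or.inr (mem_image.2 ⟨⟨(u, v), hlt, hu.2.symm⟩, mem_univ _, rfl⟩)
  have h5 : edgesBetween H T T ≤ 2 * #E :=
    h4.trans (le_trans (le_of_eq (by congr!)) (h2.trans (Nat.mul_le_mul_left 2
      (le_trans (le_of_eq (by congr!)) h3))))
  nlinarith

lemma chiBounded_memITM {C : GraphClass} {r : ℕ} (hr : 1 ≤ r) {d : ℝ}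
    (hd : ∀ ⦃m : ℕ⦄ (H : SimpleGraph (Fin m)), MemITMClass r C H → avgDeg H ≤ d) :
    ChiBounded (fun m => {H : SimpleGraph (Fin m) | MemITMClass r C H}) := by
  refine ⟨fun _ => 2 * ⌈d⌉₊ + 1, fun n H hH m H' hH' => chi_le ?_⟩
  obtain ⟨N, G, hG, hHG⟩ := hH
  have hcol : H.Colorable (2 * ⌈d⌉₊ + 1) := colorable_of_edgesBetween_le
    (hHG.edgesBetween_le hr (inducedDensityLE_of_avgDeg hr fun m K hK => hd K ⟨N, G, hG, hK⟩))
  obtain ⟨φ⟩ := hH'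
  exact hcol.of_hom φ.toHom

/-- Joining pairs of paths of an induced linkage at common endpoints. -/
lemma IsInducedLinkage.double {V ι α : Type} {G : SimpleGraph V} {k : ℕ} {S : Finset V}
    {E : Finset ι} {p : ι → ℕ → V} (h : IsInducedLinkage G k S E p) {A : Finset α} {R : Finset V}
    (hR : R ⊆ S) (x : α → V) (y : α → Bool → V) (hx : ∀ a ∈ A, x a ∈ S) (hxR : ∀ a ∈ A, x a ∉ R)
    (hinj : ∀ a ∈ A, ∀ a' ∈ A, x a = x a' → a = a') (hy : ∀ a ∈ A, ∀ b, y a b ∈ R)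
    (hyne : ∀ a ∈ A, y a false ≠ y a true)
    (hyinj : ∀ a ∈ A, ∀ a' ∈ A, s(y a false, y a true) = s(y a' false, y a' true) → a = a')
    (he : ∀ a ∈ A, ∀ b, ∃ e ∈ E, s(p e 0, p e (k + 1)) = s(x a, y a b)) :
    ∃ P : α → ℕ → V, IsInducedLinkage G (2 * k + 1) R A P ∧
      ∀ a ∈ A, P a 0 = y a false ∧ P a (2 * k + 1 + 1) = y a true := by
  rcases A.eq_empty_or_nonempty with rfl | ⟨a₀, ha₀⟩
  · refine ⟨fun a _ => y a true, ⟨by constructor <;> simp, fun u hu v hv =>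
      h.indep u (hR hu) v (hR hv), by simp, by simp⟩, by simp⟩
  have hex : ∀ a b, a ∈ A → ∃ e ∈ E, ∃ q : ℕ → V, s(p e 0, p e (k + 1)) = s(x a, y a b) ∧
      q 0 = x a ∧ q (k + 1) = y a b ∧
      ((∀ i, q i = p e i) ∨ ∀ i ≤ k + 1, q i = p e (k + 1 - i)) := by
    intro a b ha
    obtain ⟨e, he, hs⟩ := he a ha b
    refine ⟨e, he, ?_⟩
    rcases Sym2.eq_iff.1 hs with ⟨h1, h2⟩ | ⟨h1, h2⟩
    · exact ⟨p e, hs, h1, h2, Or.inl fun _ => rfl⟩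
    · exact ⟨fun i => p e (k + 1 - i), hs, by simpa using h2, by simpa using h1,
        Or.inr fun _ _ => rfl⟩
  have hι : Nonempty ι := let ⟨e, _⟩ := hex a₀ true ha₀; ⟨e⟩
  have hV : Nonempty V := ⟨x a₀⟩
  choose! e heE' q hs' hq0' hq1' hq' using hex
  have heE := fun a ha b => heE' a b ha
  have hs := fun a ha b => hs' a b ha
  have hq0 := fun a ha b => hq0' a b ha
  have hq1 := fun a ha b => hq1' a b ha
  have hq := fun a ha b => hq' a b ha
  have hee : ∀ a ∈ A, ∀ b, ∀ a' ∈ A, ∀ b', e a b = e a' b' → a = a' ∧ b = b' := by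
    intro a ha b a' ha' b' hh
    have h1 := hs a ha b
    rw [hh, hs a' ha' b'] at h1
    rcases Sym2.eq_iff.1 h1 with ⟨h2, h3⟩ | ⟨h2, h3⟩
    · obtain rfl := hinj _ ha' _ ha h2
      refine ⟨rfl, ?_⟩
      have := hyne _ ha
      cases b <;> cases b' <;> first | rfl | (exfalso; first | exact this h3 | exact this h3.symm)
    · exact absurd (h2 ▸ hy a ha b) (hxR a' ha')
  have hqe : ∀ a ∈ A, ∀ b, ∀ i, 1 ≤ i → i ≤ k → ∃ j, 1 ≤ j ∧ j ≤ k ∧ q a b i = p (e a b) j ∧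
      ((∀ i, q a b i = p (e a b) i) ∧ j = i ∨
        (∀ i ≤ k + 1, q a b i = p (e a b) (k + 1 - i)) ∧ j + i = k + 1) := by
    intro a ha b i h1 h2
    rcases hq a ha b with h3 | h3
    · exact ⟨i, h1, h2, h3 i, Or.inl ⟨h3, rfl⟩⟩
    · exact ⟨k + 1 - i, by omega, by omega, h3 i (by omega), Or.inr ⟨h3, by omega⟩⟩
  have qadj : ∀ a ∈ A, ∀ b, ∀ i ≤ k, G.Adj (q a b i) (q a b (i + 1)) := by
    intro a ha b i hi
    rcases hq a ha b with h3 | h3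
    · rw [h3, h3]; exact h.adj _ (heE a ha b) i hi
    · rw [h3 i (by omega), h3 (i + 1) (by omega)]
      have := h.adj _ (heE a ha b) (k + 1 - (i + 1)) (by omega)
      rw [show k + 1 - (i + 1) + 1 = k + 1 - i by omega] at this
      exact this.symm
  have qint : ∀ a ∈ A, ∀ b, ∀ i, 1 ≤ i → i ≤ k → q a b i ∉ S := by
    intro a ha b i h1 h2
    obtain ⟨j, h3, h4, h5, -⟩ := hqe a ha b i h1 h2
    rw [h5]; exact h.interior _ (heE a ha b) j h3 h4
  have qinj : ∀ a ∈ A, ∀ b, ∀ a' ∈ A, ∀ b', ∀ i j, 1 ≤ i → i ≤ k → 1 ≤ j → j ≤ k →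
      q a b i = q a' b' j → a = a' ∧ b = b' ∧ i = j := by
    intro a ha b a' ha' b' i j h1 h2 h3 h4 hh
    obtain ⟨i', h5, h6, h7, h8⟩ := hqe a ha b i h1 h2
    obtain ⟨j', h9, h10, h11, h12⟩ := hqe a' ha' b' j h3 h4
    rw [h7, h11] at hh
    obtain ⟨h13, h14⟩ := h.inj _ (heE a ha b) _ (heE a' ha' b') _ _ h5 h6 h9 h10 hh
    obtain ⟨rfl, rfl⟩ := hee a ha b a' ha' b' h13
    refine ⟨rfl, rfl, ?_⟩
    rcases h8 with ⟨h8, h15⟩ | ⟨h8, h15⟩ <;> rcases h12 with ⟨h12, h16⟩ | ⟨h12, h16⟩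
    · omega
    · have := h.ne _ (heE a ha b)
      have h17 := h8 0
      have h18 := h12 0 (by omega)
      exact absurd (h17.symm.trans h18) this
    · have := h.ne _ (heE a ha b)
      have h17 := h12 0
      have h18 := h8 0 (by omega)
      exact absurd (h17.symm.trans h18) this
    · omega
  have qend : ∀ a ∈ A, ∀ b, ∀ i, 1 ≤ i → i ≤ k → ∀ w ∈ S, G.Adj (q a b i) w →
      (w = x a ∧ i = 1) ∨ (w = y a b ∧ i = k) := by
    intro a ha b i h1 h2 w hw hh
    obtain ⟨j, h3, h4, h5, h6⟩ := hqe a ha b i h1 h2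
    rw [h5] at hh
    rw [← hq0 a ha b, ← hq1 a ha b]
    rcases h6 with ⟨h6, h7⟩ | ⟨h6, h7⟩
    · rw [h6, h6]
      rcases h.adj_end _ (heE a ha b) j h3 h4 w hw hh with ⟨h8, h9⟩ | ⟨h8, h9⟩
      · exact Or.inl ⟨h8, by omega⟩
      · exact Or.inr ⟨h8, by omega⟩
    · rw [h6 0 (by omega), h6 (k + 1) le_rfl, Nat.sub_zero, Nat.sub_self]
      rcases h.adj_end _ (heE a ha b) j h3 h4 w hw hh with ⟨h8, h9⟩ | ⟨h8, h9⟩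
      · exact Or.inr ⟨h8, by omega⟩
      · exact Or.inl ⟨h8, by omega⟩
  have qadjint : ∀ a ∈ A, ∀ b, ∀ a' ∈ A, ∀ b', ∀ i j, 1 ≤ i → i ≤ k → 1 ≤ j → j ≤ k →
      G.Adj (q a b i) (q a' b' j) → a = a' ∧ b = b' ∧ (i + 1 = j ∨ j + 1 = i) := by
    intro a ha b a' ha' b' i j h1 h2 h3 h4 hh
    obtain ⟨i', h5, h6, h7, h8⟩ := hqe a ha b i h1 h2
    obtain ⟨j', h9, h10, h11, h12⟩ := hqe a' ha' b' j h3 h4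
    rw [h7, h11] at hh
    obtain ⟨h13, h14⟩ := h.adj_int _ (heE a ha b) _ (heE a' ha' b') _ _ h5 h6 h9 h10 hh
    obtain ⟨rfl, rfl⟩ := hee a ha b a' ha' b' h13
    refine ⟨rfl, rfl, ?_⟩
    rcases h8 with ⟨h8, h15⟩ | ⟨h8, h15⟩ <;> rcases h12 with ⟨h12, h16⟩ | ⟨h12, h16⟩
    · omega
    · have := h.ne _ (heE a ha b)
      have h17 := h8 0
      have h18 := h12 0 (by omega)
      exact absurd (h17.symm.trans h18) this
    · have := h.ne _ (heE a ha b)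
      have h17 := h12 0
      have h18 := h8 0 (by omega)
      exact absurd (h17.symm.trans h18) this
    · omega
  let P : α → ℕ → V := fun a i => if i ≤ k then q a false (k + 1 - i) else q a true (i - (k + 1))
  have hP1 : ∀ a i, i ≤ k → P a i = q a false (k + 1 - i) := fun a i hi => if_pos hi
  have hP2 : ∀ a i, k + 1 ≤ i → P a i = q a true (i - (k + 1)) := fun a i hi => if_neg (by omega)
  have hPm : ∀ a ∈ A, P a (k + 1) = x a := fun a ha => by
    rw [hP2 a _ le_rfl, Nat.sub_self, hq0 a ha]
  have hP0 : ∀ a ∈ A, P a 0 = y a false := fun a ha => by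
    rw [hP1 a _ (Nat.zero_le _), Nat.sub_zero, hq1 a ha]
  have hPl : ∀ a ∈ A, P a (2 * k + 1 + 1) = y a true := fun a ha => by
    rw [hP2 a _ (by omega), show 2 * k + 1 + 1 - (k + 1) = k + 1 by omega, hq1 a ha]
  have hcase : ∀ a ∈ A, ∀ i, 1 ≤ i → i ≤ 2 * k + 1 → (P a i = x a ∧ i = k + 1) ∨
      ∃ b j, P a i = q a b j ∧ 1 ≤ j ∧ j ≤ k ∧
        (b = false ∧ i + j = k + 1 ∨ b = true ∧ i = k + 1 + j) := by
    intro a ha i h1 h2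
    rcases lt_trichotomy i (k + 1) with h3 | rfl | h3
    · exact Or.inr ⟨false, k + 1 - i, hP1 a i (by omega), by omega, by omega,
        Or.inl ⟨rfl, by omega⟩⟩
    · exact Or.inl ⟨hPm a ha, rfl⟩
    · exact Or.inr ⟨true, i - (k + 1), hP2 a i (by omega), by omega, by omega,
        Or.inr ⟨rfl, by omega⟩⟩
  have hyx : ∀ a ∈ A, ∀ b, ∀ a' ∈ A, y a b ≠ x a' := fun a ha b a' ha' hh =>
    hxR a' ha' (hh ▸ hy a ha b)
  refine ⟨P, ⟨⟨?_, ?_, ?_, ?_, ?_, ?_, ?_⟩, ?_, ?_, ?_⟩, fun a ha => ⟨hP0 a ha, hPl a ha⟩⟩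
  · intro a ha; rw [hP0 a ha]; exact hy a ha _
  · intro a ha; rw [hPl a ha]; exact hy a ha _
  · intro a ha; rw [hP0 a ha, hPl a ha]; exact hyne a ha
  · intro a ha a' ha'
    rw [hP0 a ha, hPl a ha, hP0 a' ha', hPl a' ha']
    exact hyinj a ha a' ha'
  · intro a ha i hi
    rcases le_or_gt (k + 1) i with h1 | h1
    · rw [hP2 a i h1, hP2 a _ (by omega), show i + 1 - (k + 1) = i - (k + 1) + 1 by omega]
      exact qadj a ha _ _ (by omega)
    · rw [hP1 a i (by omega)]
      have h2 : P a (i + 1) = q a false (k + 1 - (i + 1)) := by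
        rcases (show i + 1 ≤ k ∨ i = k by omega) with h4 | rfl
        · exact hP1 a _ h4
        · rw [hPm a ha, Nat.sub_self, hq0 a ha]
      rw [h2, show k + 1 - i = k + 1 - (i + 1) + 1 by omega]
      exact (qadj a ha _ _ (by omega)).symm
  · intro a ha i h1 h2
    rcases hcase a ha i h1 h2 with ⟨h3, -⟩ | ⟨b, j, h3, h4, h5, -⟩
    · rw [h3]; exact hxR a ha
    · rw [h3]; exact fun hh => qint a ha b j h4 h5 (hR hh)
  · intro a ha a' ha' i j h1 h2 h3 h4 hh
    rcases hcase a ha i h1 h2 with ⟨h5, h6⟩ | ⟨b, i', h5, h6, h7, h8⟩ <;>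
    rcases hcase a' ha' j h3 h4 with ⟨h9, h10⟩ | ⟨b', j', h9, h10, h11, h12⟩ <;>
    rw [h5, h9] at hh
    · exact ⟨hinj a ha a' ha' hh, by omega⟩
    · exact absurd (hh ▸ hx a ha) (qint a' ha' b' j' h10 h11)
    · exact absurd (hh ▸ hx a' ha') (qint a ha b i' h6 h7)
    · obtain ⟨rfl, rfl, rfl⟩ := qinj a ha b a' ha' b' i' j' h6 h7 h10 h11 hh
      refine ⟨rfl, ?_⟩
      rcases h8 with ⟨rfl, h8⟩ | ⟨rfl, h8⟩ <;> rcases h12 with ⟨h13, h12⟩ | ⟨h13, h12⟩ <;>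
        first | omega | cases h13
  · exact fun u hu v hv => h.indep u (hR hu) v (hR hv)
  · intro a ha i h1 h2 w hw hh
    rw [hP0 a ha, hPl a ha]
    rcases hcase a ha i h1 h2 with ⟨h5, h6⟩ | ⟨b, i', h5, h6, h7, h8⟩ <;> rw [h5] at hh
    · exact absurd hh (h.indep _ (hx a ha) _ (hR hw))
    · rcases qend a ha b i' h6 h7 w (hR hw) hh with ⟨rfl, -⟩ | ⟨rfl, h9⟩
      · exact absurd hw (hxR a ha)
      · rcases h8 with ⟨rfl, h8⟩ | ⟨rfl, h8⟩
        · exact Or.inl ⟨rfl, by omega⟩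
        · exact Or.inr ⟨rfl, by omega⟩
  · intro a ha a' ha' i j h1 h2 h3 h4 hh
    rcases hcase a ha i h1 h2 with ⟨h5, h6⟩ | ⟨b, i', h5, h6, h7, h8⟩ <;>
    rcases hcase a' ha' j h3 h4 with ⟨h9, h10⟩ | ⟨b', j', h9, h10, h11, h12⟩ <;>
    rw [h5, h9] at hh
    · exact absurd hh (h.indep _ (hx a ha) _ (hx a' ha'))
    · rcases qend a' ha' b' j' h10 h11 _ (hx a ha) hh.symm with ⟨h13, h14⟩ | ⟨h13, -⟩
      · refine ⟨hinj a ha a' ha' h13, ?_⟩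
        rcases h12 with ⟨-, h12⟩ | ⟨-, h12⟩ <;> omega
      · exact absurd h13.symm (hyx a' ha' b' a ha)
    · rcases qend a ha b i' h6 h7 _ (hx a' ha') hh with ⟨h13, h14⟩ | ⟨h13, -⟩
      · refine ⟨hinj a ha a' ha' h13.symm, ?_⟩
        rcases h8 with ⟨-, h8⟩ | ⟨-, h8⟩ <;> omega
      · exact absurd h13.symm (hyx a ha b a' ha')
    · obtain ⟨rfl, rfl, h13⟩ := qadjint a ha b a' ha' b' i' j' h6 h7 h10 h11 hh
      refine ⟨rfl, ?_⟩
      rcases h8 with ⟨rfl, h8⟩ | ⟨rfl, h8⟩ <;> rcases h12 with ⟨h14, h12⟩ | ⟨h14, h12⟩ <;>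
        first | omega | cases h14

end

section
open scoped Classical
open Finset

/-- Shift graphs are triangle-free graphs of large chromatic number. -/
lemma exists_triangleFree_not_colorable (c : ℕ) : ∃ (n : ℕ) (T : SimpleGraph (Fin n)),
    (∀ x y z, T.Adj x y → T.Adj y z → ¬ T.Adj x z) ∧ ¬ T.Colorable c := by
  let N := 2 ^ c + 1
  let T : SimpleGraph (Fin N × Fin N) :=
    { Adj := fun x y => (x.1 < x.2 ∧ x.2 = y.1 ∧ y.1 < y.2) ∨ (y.1 < y.2 ∧ y.2 = x.1 ∧ x.1 < x.2)
      symm := ⟨fun x y h => h.symm⟩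
      loopless := ⟨fun x h => by
        rcases h with ⟨h1, h2, -⟩ | ⟨h1, h2, -⟩ <;> exact absurd h2 h1.ne'⟩ }
  let φ := (Fintype.equivFin (Fin N × Fin N)).symm
  refine ⟨_, T.comap φ, ?_, ?_⟩
  · intro x y z hxy hyz hxz
    simp only [comap_adj, T, Fin.lt_def, Fin.ext_iff] at hxy hyz hxz
    omega
  · rintro ⟨C⟩
    let C' : Fin N → Fin N → Fin c := fun i j => C (φ.symm (i, j))
    have hC : ∀ i j k, i < j → j < k → C' i j ≠ C' j k := by
      intro i j k hij hjk
      refine C.valid ?_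
      simp only [comap_adj, Equiv.apply_symm_apply]
      exact Or.inl ⟨hij, rfl, hjk⟩
    let U : Fin N → Finset (Fin c) := fun i => (Ioi i).image (C' i)
    have hne : ∀ i j, i < j → U i ≠ U j := by
      intro i j hij h
      have h1 : C' i j ∈ U i := mem_image_of_mem _ (mem_Ioi.2 hij)
      rw [h] at h1
      obtain ⟨k, hk, h2⟩ := mem_image.1 h1
      exact hC i j k hij (mem_Ioi.1 hk) h2.symm
    have hU : Function.Injective U := by
      intro i j h
      rcases lt_trichotomy i j with h1 | h1 | h1
      · exact absurd h (hne i j h1)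
      · exact h1
      · exact absurd h.symm (hne j i h1)
    have := Fintype.card_le_of_injective U hU
    simp [N] at this

lemma pow_mul_pow_lt {c q n k : ℕ} (h : c * (q + 1) * n < k) : c ^ n * q ^ k < (q + 1) ^ k := by
  have key : ∀ M, q ^ M * (q + M) ≤ q * (q + 1) ^ M := by
    intro M
    induction M with
    | zero => simp
    | succ M ih =>
      calc q ^ (M + 1) * (q + (M + 1)) ≤ q ^ M * (q + M) * (q + 1) := by
            rw [pow_succ]; nlinarith [Nat.zero_le (q ^ M * M)]
        _ ≤ _ := by rw [pow_succ, ← mul_assoc]; exact Nat.mul_le_mul_right _ ih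
  have h1 : c * q ^ (c * (q + 1)) ≤ (q + 1) ^ (c * (q + 1)) := by
    rcases Nat.eq_zero_or_pos q with rfl | hq
    · rcases Nat.eq_zero_or_pos c with rfl | hc
      · simp
      · simp [hc.ne']
    · have h2 := key (c * (q + 1))
      refine Nat.le_of_mul_le_mul_left (le_trans ?_ h2) hq
      have : c * q ≤ q + c * (q + 1) := by nlinarith
      calc q * (c * q ^ (c * (q + 1))) = q ^ (c * (q + 1)) * (c * q) := by ring
        _ ≤ _ := Nat.mul_le_mul_left _ this
  obtain ⟨j, rfl⟩ := Nat.exists_eq_add_of_lt h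
  calc c ^ n * q ^ (c * (q + 1) * n + j + 1)
      = (c * q ^ (c * (q + 1))) ^ n * q ^ (j + 1) := by
        rw [add_assoc, pow_add, pow_mul, mul_pow]; ring
    _ ≤ ((q + 1) ^ (c * (q + 1))) ^ n * q ^ (j + 1) :=
        Nat.mul_le_mul_right _ (Nat.pow_le_pow_left h1 n)
    _ < ((q + 1) ^ (c * (q + 1))) ^ n * (q + 1) ^ (j + 1) :=
        Nat.mul_lt_mul_of_pos_left (Nat.pow_lt_pow_left (Nat.lt_succ_self q) (by omega))
          (by positivity)
    _ = _ := by rw [← pow_mul, ← pow_add, add_assoc]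

/-- Successive choices, each of which kills a fixed fraction of the remaining objects. -/
lemma exists_killing_choice {α ε P : Type} (Ψ : Finset P) (Q : Finset ε) (A : Finset α) {q : ℕ}
    (hq : #Q = q + 1) (bad : α → ε → P → Prop) (hbad : ∀ a ∈ A, ∀ ψ ∈ Ψ, ∃ e ∈ Q, bad a e ψ) :
    ∃ f : α → ε, (∀ a, f a ∈ Q) ∧
      #{ψ ∈ Ψ | ∀ a ∈ A, ¬ bad a (f a) ψ} * (q + 1) ^ #A ≤ #Ψ * q ^ #A := by
  induction A using Finset.induction_on with
  | empty =>
    obtain ⟨e, he⟩ := card_pos.1 (show 0 < #Q by omega)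
    exact ⟨fun _ => e, fun _ => he, by simp⟩
  | insert a A ha ih =>
    obtain ⟨f, hf, hle⟩ := ih fun b hb => hbad b (mem_insert_of_mem hb)
    set Ψ' : Finset P := {ψ ∈ Ψ | ∀ a ∈ A, ¬ bad a (f a) ψ} with hΨ'
    obtain ⟨e, he, h1⟩ : ∃ e ∈ Q, #Ψ' ≤ #{ψ ∈ Ψ' | bad a e ψ} * (q + 1) := by
      by_contra hcon
      push Not at hcon
      have h2 : ∑ e ∈ Q, #{ψ ∈ Ψ' | bad a e ψ} * (q + 1) < ∑ e ∈ Q, #Ψ' :=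
        sum_lt_sum_of_nonempty (card_pos.1 (by omega)) hcon
      rw [← sum_mul, sum_const, hq, smul_eq_mul, mul_comm (q + 1)] at h2
      have h3 := lt_of_mul_lt_mul_right h2 (Nat.zero_le _)
      have h4 : #Ψ' ≤ ∑ e ∈ Q, #{ψ ∈ Ψ' | bad a e ψ} := by
        refine le_trans (card_le_card fun ψ hψ => ?_) card_biUnion_le
        obtain ⟨e, he, h5⟩ := hbad a (mem_insert_self _ _) ψ (mem_filter.1 hψ).1
        exact mem_biUnion.2 ⟨e, he, mem_filter.2 ⟨hψ, h5⟩⟩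
      omega
    refine ⟨Function.update f a e, fun b => ?_, ?_⟩
    · by_cases hb : b = a
      · subst hb; simpa using he
      · simpa [hb] using hf b
    · have h2 : ({ψ ∈ Ψ | ∀ b ∈ insert a A, ¬ bad b (Function.update f a e b) ψ} : Finset P) =
          {ψ ∈ Ψ' | ¬ bad a e ψ} := by
        ext ψ
        simp only [hΨ', mem_filter, mem_insert, forall_eq_or_imp, Function.update_self]
        have : (∀ b ∈ A, ¬ bad b (Function.update f a e b) ψ) ↔ ∀ b ∈ A, ¬ bad b (f b) ψ :=
          forall₂_congr fun b hb => by rw [Function.update_of_ne (by rintro rfl; exact ha hb)]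
        rw [this]
        tauto
      have h3 := card_filter_add_card_filter_not (s := Ψ') (fun ψ => bad a e ψ)
      have h4 : #{ψ ∈ Ψ' | ¬ bad a e ψ} * (q + 1) ≤ #Ψ' * q := by nlinarith
      rw [h2, card_insert_of_notMem ha, pow_succ, pow_succ]
      calc #{ψ ∈ Ψ' | ¬ bad a e ψ} * ((q + 1) ^ #A * (q + 1))
          = #{ψ ∈ Ψ' | ¬ bad a e ψ} * (q + 1) * (q + 1) ^ #A := by ring
        _ ≤ #Ψ' * q * (q + 1) ^ #A := Nat.mul_le_mul_right _ h4
        _ = #Ψ' * (q + 1) ^ #A * q := by ring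
        _ ≤ #Ψ * q ^ #A * q := Nat.mul_le_mul_right _ hle
        _ = _ := by ring

lemma card_retractions {R : Type} [Fintype R] {t : ℕ} (g : Fin t → R) (hg : Function.Injective g) :
    t ^ Fintype.card R ≤ t ^ t * #{φ : R → Fin t | ∀ x, φ (g x) = x} := by
  have h1 : #(univ : Finset (R → Fin t)) ≤
      #((univ : Finset (Fin t → Fin t)) ×ˢ ({φ : R → Fin t | ∀ x, φ (g x) = x} : Finset _)) := by
    refine card_le_card_of_injOn (fun φ => (φ ∘ g, Function.extend g id φ)) (fun φ _ => ?_) ?_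
    · simp only [coe_product, coe_univ, Set.mem_prod, Set.mem_univ, true_and, mem_coe, mem_filter,
        mem_univ]
      exact fun x => hg.extend_apply _ _ _
    · intro φ _ φ' _ h
      simp only [Prod.mk.injEq] at h
      funext z
      by_cases hz : ∃ x, g x = z
      · obtain ⟨x, rfl⟩ := hz
        exact congrFun h.1 x
      · have := congrFun h.2 z
        rwa [Function.extend_apply' _ _ _ hz, Function.extend_apply' _ _ _ hz] at this
  rw [card_product, card_univ, card_univ, Fintype.card_fun, Fintype.card_fun] at h1
  simpa using h1

lemma exists_retraction {R α : Type} [Fintype R] {t : ℕ} (A : Finset α) (g : α → Fin t → R)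
    (hg : ∀ a ∈ A, Function.Injective (g a)) (ht : 0 < t) :
    ∃ φ : R → Fin t, #A ≤ t ^ t * #{a ∈ A | ∀ x, φ (g a x) = x} := by
  by_contra hcon
  push Not at hcon
  have hne : (univ : Finset (R → Fin t)).Nonempty := ⟨fun _ => ⟨0, ht⟩, mem_univ _⟩
  have h1 := sum_lt_sum_of_nonempty hne fun φ _ => hcon φ
  have h2 := sum_card_bipartiteAbove_eq_sum_card_bipartiteBelow (s := (univ : Finset (R → Fin t)))
    (t := A) fun φ a => ∀ x, φ (g a x) = x
  simp only [bipartiteAbove, bipartiteBelow] at h2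
  have h3 : ∑ a ∈ A, t ^ Fintype.card R ≤
      ∑ a ∈ A, t ^ t * #{φ : R → Fin t | ∀ x, φ (g a x) = x} :=
    sum_le_sum fun a ha => card_retractions (g a) (hg a ha)
  rw [← mul_sum, h2, sum_const, card_univ, Fintype.card_fun, Fintype.card_fin, smul_eq_mul,
    mul_comm (t ^ Fintype.card R)] at h1
  rw [sum_const, smul_eq_mul, ← mul_sum] at h3
  refine absurd h3 (not_le.2 (lt_of_eq_of_lt ?_ h1))
  congr!

/-- If many sets of bounded size are chosen in a small set, then one can select pairs in some of
them that form a triangle-free graph of large chromatic number. -/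
lemma exists_triangleFree_selection (c : ℕ) (hc : 1 ≤ c) : ∃ t M : ℕ, ∀ (R α : Type) [Fintype R]
    (A : Finset α) (g : α → Fin t → R), (∀ a ∈ A, Function.Injective (g a)) →
    M * Fintype.card R < #A → ∃ A' ⊆ A, ∃ x y : α → Fin t, (∀ a ∈ A', x a ≠ y a) ∧
      (∀ a ∈ A', ∀ a' ∈ A', s(g a (x a), g a (y a)) = s(g a' (x a'), g a' (y a')) → a = a') ∧
      (∀ u v w, (∃ a ∈ A', s(g a (x a), g a (y a)) = s(u, v)) →
        (∃ a ∈ A', s(g a (x a), g a (y a)) = s(v, w)) →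
        ¬ ∃ a ∈ A', s(g a (x a), g a (y a)) = s(u, w)) ∧
      ∀ ψ : R → Fin c, ∃ a ∈ A', ψ (g a (x a)) = ψ (g a (y a)) := by
  obtain ⟨t, T, hT, hTc⟩ := exists_triangleFree_not_colorable c
  set Q : Finset (Fin t × Fin t) := {π | T.Adj π.1 π.2} with hQ
  have hmono : ∀ ψ : Fin t → Fin c, ∃ π ∈ Q, ψ π.1 = ψ π.2 := by
    intro ψ
    by_contra hcon
    push Not at hcon
    exact hTc ⟨ψ, fun {u v} huv => hcon (u, v) (by simpa [hQ] using huv)⟩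
  obtain ⟨π₀, hπ₀, -⟩ := hmono fun _ => ⟨0, hc⟩
  obtain ⟨q, hq⟩ : ∃ q, #Q = q + 1 := Nat.exists_eq_succ_of_ne_zero (card_pos.2 ⟨_, hπ₀⟩).ne'
  refine ⟨t, t ^ t * (c * (q + 1)), fun R α _ A g hg hA => ?_⟩
  have ht : 0 < t := (Nat.zero_le _).trans_lt π₀.1.2
  obtain ⟨φ, hφ⟩ := exists_retraction A g hg ht
  set A₂ : Finset α := {a ∈ A | ∀ x, φ (g a x) = x} with hA₂
  have hlt : c * (q + 1) * Fintype.card R < #A₂ := by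
    have := hA.trans_le hφ
    rw [mul_assoc] at this
    exact lt_of_mul_lt_mul_left this (Nat.zero_le _)
  obtain ⟨f, hfQ, hf⟩ := exists_killing_choice (univ : Finset (R → Fin c)) Q A₂ hq
    (fun a e ψ => ψ (g a e.1) = ψ (g a e.2)) fun a _ ψ _ => hmono fun x => ψ (g a x)
  have hsurv : ({ψ : R → Fin c | ∀ a ∈ A₂, ¬ ψ (g a (f a).1) = ψ (g a (f a).2)} : Finset _) = ∅ := by
    by_contra hne
    have h1 := card_pos.2 (nonempty_iff_ne_empty.2 hne)
    rw [card_univ, Fintype.card_fun, Fintype.card_fin] at hf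
    have h2 : (q + 1) ^ #A₂ ≤ c ^ Fintype.card R * q ^ #A₂ := by
      refine Nat.le_trans (Nat.le_mul_of_pos_left _ h1) ?_
      convert hf
    exact absurd h2 (not_le.2 (pow_mul_pow_lt hlt))
  have hadj : ∀ a, T.Adj (f a).1 (f a).2 := fun a => (mem_filter.1 (hfQ a)).2
  let F : α → Sym2 R := fun a => s(g a (f a).1, g a (f a).2)
  obtain ⟨A', hA', himg, hinj⟩ : ∃ A' ⊆ A₂, A'.image F = A₂.image F ∧
      ∀ a ∈ A', ∀ a' ∈ A', F a = F a' → a = a' := by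
    obtain ⟨A', h1, h2, h3⟩ := exists_subset_injOn_image_eq_of_surjOn (f := F) (A₂ : Set α)
      (A₂.image F) (by rw [coe_image]; exact Set.surjOn_image F A₂)
    exact ⟨A', coe_subset.1 h1, h3, fun a ha a' ha' => h2 ha ha'⟩
  have hφT : ∀ u v, (∃ a ∈ A', F a = s(u, v)) → T.Adj (φ u) (φ v) := by
    rintro u v ⟨a, ha, h⟩
    have hr := (mem_filter.1 (hA' ha)).2
    rcases Sym2.eq_iff.1 h with ⟨rfl, rfl⟩ | ⟨rfl, rfl⟩
    · rw [hr, hr]; exact hadj a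
    · rw [hr, hr]; exact (hadj a).symm
  refine ⟨A', hA'.trans (filter_subset _ _), fun a => (f a).1, fun a => (f a).2,
    fun a _ => (hadj a).ne, hinj, fun u v w h1 h2 h3 =>
      hT _ _ _ (hφT u v h1) (hφT v w h2) (hφT u w h3), fun ψ => ?_⟩
  by_contra hcon
  push Not at hcon
  have hmem : ψ ∈ ({ψ : R → Fin c | ∀ a ∈ A₂, ¬ ψ (g a (f a).1) = ψ (g a (f a).2)} : Finset _) := by
    refine mem_filter.2 ⟨mem_univ _, fun a ha h => ?_⟩
    have : F a ∈ A'.image F := himg ▸ mem_image_of_mem F ha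
    obtain ⟨a', ha', h1⟩ := mem_image.1 this
    refine hcon a' ha' ?_
    rcases Sym2.eq_iff.1 h1 with ⟨h2, h3⟩ | ⟨h2, h3⟩
    · rw [h2, h3, h]
    · rw [h2, h3, h]
  rw [hsurv] at hmem
  exact notMem_empty _ hmem

end

section
open scoped Classical
open Finset

lemma exists_half_edges {n : ℕ} (H : SimpleGraph (Fin n)) : ∃ R : Finset (Fin n),
    Fintype.card (Edges H) ≤ 4 * #{e : Edges H | e.1.1 ∈ R ∧ e.1.2 ∉ R} := by
  obtain ⟨R, hR⟩ := exists_sample (univ : Finset (Edges H)) (fun e => {e.1.1}) (fun e => {e.1.2}) 2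
    (fun e _ => by simpa using e.2.1.ne) (fun e _ => by simp)
  refine ⟨R, ?_⟩
  simpa using hR

lemma card_edges_le_edgesBetween {n : ℕ} (H : SimpleGraph (Fin n)) (R : Finset (Fin n)) :
    #{e : Edges H | e.1.1 ∈ R ∧ e.1.2 ∉ R} ≤ edgesBetween H R Rᶜ := by
  rw [edgesBetween, ← card_sigma]
  refine card_le_card_of_injOn (fun e => ⟨e.1.1, e.1.2⟩) (fun e he => ?_) fun e _ e' _ h => ?_
  · have := (mem_filter.1 he).2
    simpa [this] using e.2.2
  · simp only [Sigma.mk.injEq, heq_eq_eq] at h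
    exact Subtype.ext (Prod.ext h.1 h.2)

lemma ncard_edgeSet_le_card_edges {n : ℕ} (H : SimpleGraph (Fin n)) :
    H.edgeSet.ncard ≤ Fintype.card (Edges H) := by
  rw [← card_univ]
  refine le_trans ?_ (card_image_le (f := fun e : Edges H => s(e.1.1, e.1.2)))
  rw [← Set.ncard_coe_finset]
  refine Set.ncard_le_ncard (fun z hz => ?_) (Set.toFinite _)
  induction z using Sym2.ind with
  | _ u v =>
    rw [mem_edgeSet] at hz
    rcases lt_or_gt_of_ne hz.ne with hlt | hlt
    · exact mem_coe.2 (mem_image.2 ⟨⟨(u, v), hlt, hz⟩, mem_univ _, rfl⟩)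
    · exact mem_coe.2 (mem_image.2 ⟨⟨(v, u), hlt, hz.symm⟩, mem_univ _, Sym2.eq_swap⟩)

lemma avgDeg_le_of_card_edges_le {n D : ℕ} {H : SimpleGraph (Fin n)}
    (h : Fintype.card (Edges H) ≤ D * n) : avgDeg H ≤ 2 * D := by
  have h2 : (H.edgeSet.ncard : ℝ) ≤ D * n := by
    exact_mod_cast (ncard_edgeSet_le_card_edges H).trans h
  rw [avgDeg]
  refine div_le_of_le_mul₀ (by positivity) (by positivity) ?_
  linarith

lemma omegaNum_le_two {V : Type} [Fintype V] {G : SimpleGraph V}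
    (h : ∀ u v w, G.Adj u v → G.Adj v w → ¬ G.Adj u w) : omegaNum G ≤ 2 := by
  by_contra hcon
  obtain ⟨f, -⟩ := isSubgraphOf_omegaNum G
  have hf : ∀ i j : ℕ, ∀ hi : i < omegaNum G, ∀ hj : j < omegaNum G, i ≠ j →
      G.Adj (f ⟨i, hi⟩) (f ⟨j, hj⟩) := fun i j hi hj hij =>
    f.map_rel (by rw [top_adj]; simpa using hij)
  exact h _ _ _ (hf 0 1 (by omega) (by omega) (by omega)) (hf 1 2 (by omega) (by omega) (by omega))
    (hf 0 2 (by omega) (by omega) (by omega))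

lemma exists_subdivPath_ends {n : ℕ} {H : SimpleGraph (Fin n)} (r : ℕ) {u v : Fin n}
    (h : H.Adj u v) : ∃ e : Edges H,
      s(subdivPath H r e 0, subdivPath H r e (r + 1)) = s(Sum.inl u, Sum.inl v) := by
  rcases lt_or_gt_of_ne h.ne with hlt | hlt
  · let e : Edges H := ⟨(u, v), hlt, h⟩
    exact ⟨e, by rw [subdivPath_zero H r e, subdivPath_last H r e]⟩
  · let e : Edges H := ⟨(v, u), hlt, h.symm⟩
    exact ⟨e, by rw [subdivPath_zero H r e, subdivPath_last H r e]; exact Sym2.eq_swap⟩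

/-- A sufficiently unbalanced dense pair in `H` turns an induced `r`-subdivision of `H` into an
induced `(2 * r + 1)`-subdivision of a triangle-free graph of large chromatic number. -/
lemma exists_memITM_triangleFree {c t M : ℕ} (hsel : ∀ (R α : Type) [Fintype R]
    (A : Finset α) (g : α → Fin t → R), (∀ a ∈ A, Function.Injective (g a)) →
    M * Fintype.card R < #A → ∃ A' ⊆ A, ∃ x y : α → Fin t, (∀ a ∈ A', x a ≠ y a) ∧
      (∀ a ∈ A', ∀ a' ∈ A', s(g a (x a), g a (y a)) = s(g a' (x a'), g a' (y a')) → a = a') ∧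
      (∀ u v w, (∃ a ∈ A', s(g a (x a), g a (y a)) = s(u, v)) →
        (∃ a ∈ A', s(g a (x a), g a (y a)) = s(v, w)) →
        ¬ ∃ a ∈ A', s(g a (x a), g a (y a)) = s(u, w)) ∧
      ∀ ψ : R → Fin c, ∃ a ∈ A', ψ (g a (x a)) = ψ (g a (y a)))
    {V : Type} {G : SimpleGraph V} {n r : ℕ} (hr : 1 ≤ r) {H : SimpleGraph (Fin n)}
    (hH : MemITM r G H) {A R : Finset (Fin n)} (hAR : Disjoint A R)
    (hA : ∀ a ∈ A, #{b ∈ R | H.Adj a b} = t) (hM : M * #R < #A) :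
    ∃ (m : ℕ) (F : SimpleGraph (Fin m)), MemITM (2 * r + 1) G F ∧ omegaNum F ≤ 2 ∧
      ¬ F.Colorable c := by
  have hex : ∀ a ∈ A, ∃ g : Fin t → R, Function.Injective g ∧ ∀ i, H.Adj a (g i) := by
    intro a ha
    let e := equivFinOfCardEq (hA a ha)
    refine ⟨fun i => ⟨(e.symm i).1, (mem_filter.1 (e.symm i).2).1⟩, fun i j hij => ?_,
      fun i => (mem_filter.1 (e.symm i).2).2⟩
    exact e.symm.injective (Subtype.ext (Subtype.mk.inj hij))
  obtain ⟨a₀, ha₀⟩ : A.Nonempty := card_pos.1 ((Nat.zero_le _).trans_lt hM)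
  have : Nonempty (Fin t → R) := ⟨(hex a₀ ha₀).choose⟩
  choose! g hg hadj using hex
  obtain ⟨A', hA', x, y, hxy, hinj, htri, hcol⟩ := hsel R (Fin n) A g hg (by simpa using hM)
  obtain ⟨φ⟩ := hH
  have hl := (isInducedLinkage_subdiv H hr).map φ
  let f : Fin n → V := fun v => φ (Sum.inl v)
  have hf : Function.Injective f := fun u v h => Sum.inl_injective (φ.injective h)
  have hfR : Function.Injective fun u : R => f u := fun u v h => Subtype.ext (hf h)
  have hmem : ∀ (T : Finset (Fin n)) (v : Fin n),
      f v ∈ (T.map Function.Embedding.inl).map φ.toEmbedding ↔ v ∈ T := by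
    intro T v
    simp [f]
  have hlink := hl.double (A := A') (R := (R.map Function.Embedding.inl).map φ.toEmbedding)
    (map_subset_map.2 (map_subset_map.2 (subset_univ _))) f
    (fun a b => f (g a (bif b then y a else x a)))
    (fun a _ => (hmem _ _).2 (mem_univ _))
    (fun a ha h => Finset.disjoint_left.1 hAR (hA' ha) ((hmem _ _).1 h))
    (fun a _ a' _ h => hf h) (fun a _ b => (hmem _ _).2 (g a _).2)
    (fun a ha h => hxy a ha (hg a (hA' ha) (hfR h)))
    (fun a ha a' ha' h => hinj a ha a' ha' (Sym2.map.injective hfR h))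
    (fun a ha b => by
      obtain ⟨e, he⟩ := exists_subdivPath_ends r (hadj a (hA' ha) (bif b then y a else x a))
      exact ⟨e, mem_univ _, congrArg (Sym2.map φ) he⟩)
  obtain ⟨P, hP, hPends⟩ := hlink
  obtain ⟨F, σ, -, hσ, hF, hFmem⟩ := hP.exists_memITM (by omega)
  refine ⟨_, F, hFmem, ?_, ?_⟩
  · have hτ : ∀ i, ∃ u : R, f u = σ i := by
      intro i
      have := (hσ (σ i)).2 ⟨i, rfl⟩
      simp only [mem_map, exists_exists_and_eq_and] at this
      obtain ⟨u, hu, h⟩ := this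
      exact ⟨⟨u, hu⟩, h⟩
    choose τ hτ using hτ
    have hadjF : ∀ i j, F.Adj i j → ∃ a ∈ A', s(g a (x a), g a (y a)) = s(τ i, τ j) := by
      intro i j hij
      obtain ⟨a, ha, h⟩ := (hF i j).1 hij
      rw [(hPends a ha).1, (hPends a ha).2, ← hτ, ← hτ] at h
      exact ⟨a, ha, Sym2.map.injective hfR h⟩
    exact omegaNum_le_two fun u v w h1 h2 h3 =>
      htri _ _ _ (hadjF u v h1) (hadjF v w h2) (hadjF u w h3)
  · rintro ⟨κ⟩
    have hθ : ∀ u : R, ∃ i, σ i = f u := fun u => (hσ _).1 ((hmem _ _).2 u.2)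
    choose θ hθ using hθ
    obtain ⟨a, ha, h⟩ := hcol fun u => κ (θ u)
    refine κ.valid ((hF _ _).2 ⟨a, ha, ?_⟩) h
    rw [(hPends a ha).1, (hPends a ha).2, hθ, hθ]
    rfl

lemma avgDeg_le_of_chiBounded {C : GraphClass} {r : ℕ} (hr : 1 ≤ r)
    (h : ChiBounded (fun m => {H : SimpleGraph (Fin m) | MemITMClass (2 * r + 1) C H})) :
    ∃ d : ℝ, ∀ ⦃m : ℕ⦄ (H : SimpleGraph (Fin m)), MemITMClass r C H → avgDeg H ≤ d := by
  obtain ⟨f, hf⟩ := h.exists_colorable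
  obtain ⟨t, M, hsel⟩ := exists_triangleFree_selection ((range 3).sup f + 1) (by omega)
  obtain ⟨D, hD⟩ := exists_unbalanced_pair t M
  refine ⟨2 * (4 * D : ℕ), fun n H ⟨N, G, hG, hH⟩ => avgDeg_le_of_card_edges_le ?_⟩
  by_contra hcon
  obtain ⟨B, hB⟩ := exists_half_edges H
  have h1 := card_edges_le_edgesBetween H B
  have h2 : #B + #Bᶜ = n := by rw [card_add_card_compl, Fintype.card_fin]
  obtain ⟨A, R, hAR, hA, hM⟩ := hD (Fin n) H B Bᶜ (by rw [h2]; nlinarith)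
  have hdisj : Disjoint A R := by
    rcases hAR with ⟨h3, h4⟩ | ⟨h3, h4⟩
    · exact disjoint_compl_right.mono h3 h4
    · exact disjoint_compl_left.mono h3 h4
  obtain ⟨m, F, hF, hω, hcol⟩ := exists_memITM_triangleFree hsel hr hH hdisj hA hM
  refine hcol ((hf F ⟨N, G, hG, hF⟩).mono ((le_sup ?_).trans (Nat.le_succ _)))
  rw [mem_range]
  omega

end

section
open scoped Classical
open Finset

lemma exists_chiP_coloring {V : Type} [Fintype V] (G : SimpleGraph V) (p : ℕ) :
    ∃ c : V → Fin (chiP G p), ∀ I : Finset (Fin (chiP G p)), #I ≤ p →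
      TreeDepthLE (G.induce {v | c v ∈ I}) #I := by
  refine Nat.sInf_mem (s := {N | ∃ c : V → Fin N, ∀ I : Finset (Fin N), #I ≤ p →
    TreeDepthLE (G.induce {v | c v ∈ I}) #I}) ⟨Fintype.card V, Fintype.equivFin V, fun I _ =>
    ⟨fun u v => Fintype.equivFin V u ≤ Fintype.equivFin V v, ⟨fun v => le_rfl, fun u v h h' =>
      Subtype.ext ((Fintype.equivFin V).injective (le_antisymm h h')), fun u v w => le_trans,
      fun u v w _ _ => le_total _ _⟩, fun u v _ => le_total _ _, fun v => ?_⟩⟩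
  rw [← Set.ncard_coe_finset I]
  refine Set.ncard_le_ncard_of_injOn (fun u => Fintype.equivFin V u.1) (fun u _ => u.2) ?_
  exact fun u _ v _ h => Subtype.ext ((Fintype.equivFin V).injective h)

lemma TreeDepthLE.not_adj_of_le_one {V : Type} [Finite V] {G : SimpleGraph V} {h : ℕ}
    (htd : TreeDepthLE G h) (hh : h ≤ 1) (u v : V) : ¬ G.Adj u v := by
  obtain ⟨r, hr, hadj, hcard⟩ := htd
  have key : ∀ u v : V, u ≠ v → ¬ r u v := fun u v hne huv => by
    have h1 : ({u, v} : Set V) ⊆ {w | r w v} := by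
      rintro w (rfl | rfl)
      · exact huv
      · exact hr.1 _
    have := Set.ncard_le_ncard h1
    rw [Set.ncard_pair hne] at this
    have := hcard v
    omega
  intro huv
  rcases hadj u v huv with h1 | h1
  · exact key _ _ huv.ne h1
  · exact key _ _ huv.ne' h1

lemma chi_le_chiP_one {V : Type} [Fintype V] (G : SimpleGraph V) : chi G ≤ chiP G 1 := by
  obtain ⟨c, hc⟩ := exists_chiP_coloring G 1
  refine chi_le ⟨c, fun {u v} huv h => ?_⟩
  exact (hc {c u} (by simp)).not_adj_of_le_one (by simp) ⟨u, by simp⟩ ⟨v, by simp [h]⟩ huv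

lemma omegaTM_zero_le {V : Type} [Fintype V] (G : SimpleGraph V) : omegaTM 0 G ≤ omegaNum G := by
  refine csSup_le' ?_
  rintro _ ⟨k, H, ⟨t, ht, f, hf⟩, rfl⟩
  obtain ⟨φ, hφ⟩ := isSubgraphOf_omegaNum H
  refine le_omegaNum ⟨⟨fun i => f (Sum.inl (φ i)), fun {i j} hij => f.map_rel ?_⟩, fun i j h =>
    hφ (Sum.inl_injective (hf h))⟩
  have h := φ.map_rel hij
  rw [Subdiv, fromRel_adj]
  refine ⟨fun h' => h.ne (Sum.inl_injective h'), ?_⟩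
  rcases lt_or_gt_of_ne h.ne with hlt | hlt
  · exact Or.inl ⟨⟨hlt, h⟩, Nat.le_zero.1 (ht _)⟩
  · exact Or.inr ⟨⟨hlt, h.symm⟩, Nat.le_zero.1 (ht _)⟩

lemma chiBounded_of_weaklyChiPBounded {C : GraphClass} (hC : Hereditary C)
    (h : WeaklyChiPBounded C 1) : ChiBounded C := by
  obtain ⟨g, hg⟩ := h
  refine ⟨fun w => (range (w + 1)).sup g, fun n G hG m H hH => ?_⟩
  refine (chi_le_chiP_one H).trans ((hg H (hC G H hG hH)).trans (le_sup ?_))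
  rw [mem_range, Nat.lt_succ_iff]
  exact omegaTM_zero_le H

/-- In a graph of small tree-depth every path has a vertex that lies in a small set determined by
any vertex of the path. -/
lemma TreeDepthLE.exists_down {V : Type} [Fintype V] {G : SimpleGraph V} {h : ℕ} {T : Set V}
    (htd : TreeDepthLE (G.induce T) h) : ∃ D : V → Finset V, (∀ w, #(D w) ≤ h) ∧
      ∀ (x : ℕ → V) (m : ℕ), (∀ i ≤ m, x i ∈ T) → (∀ i < m, G.Adj (x i) (x (i + 1))) →
        ∃ j ≤ m, ∀ l ≤ m, x j ∈ D (x l) := by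
  obtain ⟨r, ⟨hrefl, -, htrans, hforest⟩, hadj, hcard⟩ := htd
  refine ⟨fun w => {u | ∃ (hu : u ∈ T) (hw : w ∈ T), r ⟨u, hu⟩ ⟨w, hw⟩}, fun w => ?_,
    fun x m => ?_⟩
  · by_cases hw : w ∈ T
    · refine le_trans ?_ (hcard ⟨w, hw⟩)
      rw [← Set.ncard_coe_finset, ← Set.ncard_image_of_injective _ Subtype.val_injective]
      refine Set.ncard_le_ncard (fun u hu => ?_) (Set.toFinite _)
      obtain ⟨hu, _, h⟩ := (mem_filter.1 (mem_coe.1 hu)).2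
      exact ⟨⟨u, hu⟩, h, rfl⟩
    · simp [hw]
  · simp only [mem_filter, mem_univ, true_and]
    induction m with
    | zero =>
      intro hT _
      refine ⟨0, le_rfl, fun l hl => ?_⟩
      obtain rfl := Nat.le_zero.1 hl
      exact ⟨hT 0 le_rfl, hT 0 le_rfl, hrefl _⟩
    | succ m ih =>
      intro hT hx
      obtain ⟨j, hj, hjl⟩ := ih (fun i hi => hT i (by omega)) fun i hi => hx i (by omega)
      have hm := hT m (by omega)
      have hm1 := hT (m + 1) le_rfl
      have hjT := hT j (by omega)
      obtain ⟨_, _, hjm⟩ := hjl m le_rfl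
      have hjm1 : r ⟨x j, hjT⟩ ⟨x (m + 1), hm1⟩ ∨ r ⟨x (m + 1), hm1⟩ ⟨x j, hjT⟩ := by
        rcases hadj ⟨x m, hm⟩ ⟨x (m + 1), hm1⟩ (hx m (by omega)) with h1 | h1
        · exact Or.inl (htrans _ _ _ hjm h1)
        · exact hforest _ _ _ hjm h1
      rcases hjm1 with h1 | h1
      · refine ⟨j, by omega, fun l hl => ?_⟩
        rcases hl.eq_or_lt with rfl | hl
        · exact ⟨hjT, hm1, h1⟩
        · exact hjl l (by omega)
      · refine ⟨m + 1, le_rfl, fun l hl => ?_⟩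
        rcases hl.eq_or_lt with rfl | hl
        · exact ⟨hm1, hm1, hrefl _⟩
        · obtain ⟨_, hl', h2⟩ := hjl l (by omega)
          exact ⟨hm1, hl', htrans _ _ _ h1 h2⟩

lemma IsLinkage.card_le_of_coloring {V ι : Type} [Fintype V] {G : SimpleGraph V} {k N : ℕ}
    {S : Finset V} {E : Finset ι} {p : ι → ℕ → V} (h : IsLinkage G k S E p) (c : V → Fin N)
    (hc : ∀ I : Finset (Fin N), #I ≤ k + 2 → TreeDepthLE (G.induce {v | c v ∈ I}) #I) :
    #E ≤ 2 ^ N * (#S * (k + 2)) := by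
  have hD : ∀ I : Finset (Fin N), ∃ D : V → Finset V, #I ≤ k + 2 → (∀ w, #(D w) ≤ #I) ∧
      ∀ (x : ℕ → V) (m : ℕ), (∀ i ≤ m, c (x i) ∈ I) → (∀ i < m, G.Adj (x i) (x (i + 1))) →
        ∃ j ≤ m, ∀ l ≤ m, x j ∈ D (x l) := by
    intro I
    by_cases hI : #I ≤ k + 2
    · obtain ⟨D, h1, h2⟩ := (hc I hI).exists_down
      exact ⟨D, fun _ => ⟨h1, h2⟩⟩
    · exact ⟨fun _ => ∅, fun h => absurd h hI⟩
  choose D hD using hD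
  let Q : Finset (Σ _ : Finset (Fin N), Σ _ : V, V) :=
    ({I | #I ≤ k + 2} : Finset (Finset (Fin N))).sigma fun I => S.sigma fun w => D I w
  have hQ : #Q ≤ 2 ^ N * (#S * (k + 2)) := by
    calc #Q = ∑ I : Finset (Fin N) with #I ≤ k + 2, ∑ w ∈ S, #(D I w) := by
          rw [card_sigma]; simp_rw [card_sigma]
      _ ≤ ∑ I : Finset (Fin N) with #I ≤ k + 2, #S * (k + 2) := by
          refine sum_le_sum fun I hI => ?_
          rw [← smul_eq_mul, ← sum_const]
          have hI := (mem_filter.1 hI).2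
          exact sum_le_sum fun w _ => ((hD I hI).1 w).trans hI
      _ ≤ _ := by
          rw [sum_const, smul_eq_mul]
          refine Nat.mul_le_mul_right _ ((card_le_univ _).trans ?_)
          simp
  have hex : ∀ e ∈ E, ∃ τ ∈ Q, (τ.2.2 ∉ S ∧ ∃ i, 1 ≤ i ∧ i ≤ k ∧ τ.2.2 = p e i) ∨
      (τ.2.2 ∈ S ∧ s(p e 0, p e (k + 1)) = s(τ.2.1, τ.2.2)) := by
    intro e he
    set I : Finset (Fin N) := (range (k + 2)).image fun i => c (p e i) with hI
    have hIc : #I ≤ k + 2 := card_image_le.trans (by simp)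
    obtain ⟨j, hj, hjl⟩ := (hD I hIc).2 (p e) (k + 1)
      (fun i hi => mem_image_of_mem _ (mem_range.2 (by omega))) fun i hi => h.adj e he i (by omega)
    have hmemQ : ∀ l ≤ k + 1, p e l ∈ S → (⟨I, p e l, p e j⟩ : Σ _ : Finset (Fin N), Σ _ : V, V) ∈ Q :=
      fun l hl hS => mem_sigma.2 ⟨by simpa using hIc, mem_sigma.2 ⟨hS, hjl l hl⟩⟩
    rcases Nat.eq_zero_or_pos j with rfl | hj0
    · exact ⟨_, hmemQ (k + 1) le_rfl (h.right_mem e he), Or.inr ⟨h.left_mem e he, Sym2.eq_swap⟩⟩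
    rcases hj.eq_or_lt with rfl | hj
    · exact ⟨_, hmemQ 0 (Nat.zero_le _) (h.left_mem e he), Or.inr ⟨h.right_mem e he, rfl⟩⟩
    · exact ⟨_, hmemQ 0 (Nat.zero_le _) (h.left_mem e he),
        Or.inl ⟨h.interior e he j hj0 (by omega), j, hj0, by omega, rfl⟩⟩
  rcases E.eq_empty_or_nonempty with rfl | ⟨e₀, he₀⟩
  · simp
  have : Nonempty (Σ _ : Finset (Fin N), Σ _ : V, V) := ⟨(hex e₀ he₀).choose⟩
  choose! τ hτQ hτ using hex
  refine (card_le_card_of_injOn τ hτQ fun e he e' he' heq => ?_).trans hQ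
  have h1 := hτ e he
  have h2 := hτ e' he'
  rw [heq] at h1
  rcases h1 with ⟨h1, i, hi1, hi2, h3⟩ | ⟨h1, h3⟩ <;>
    rcases h2 with ⟨h2, j, hj1, hj2, h4⟩ | ⟨h2, h4⟩
  · exact (h.inj e he e' he' i j hi1 hi2 hj1 hj2 (h3.symm.trans h4)).1
  · exact absurd h2 h1
  · exact absurd h1 h2
  · exact h.ends_inj e he e' he' (h3.trans h4.symm)

/-- The neighbors of a subdivision vertex. -/
lemma subdiv_adj_inr {n r : ℕ} {F : SimpleGraph (Fin n)} {e : Edges F} {i : Fin r}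
    {w : Fin n ⊕ Σ _ : Edges F, Fin r} (h : (Subdiv F fun _ => r).Adj (Sum.inr ⟨e, i⟩) w) :
    w = subdivPath F r e i ∨ w = subdivPath F r e (i + 2) := by
  have hr : 1 ≤ r := i.pos
  have hi := i.2
  have hl := isInducedLinkage_subdiv F hr
  rw [← subdivPath_int] at h
  rcases w with w | ⟨e', j⟩
  · rcases hl.adj_end e (mem_univ _) (i + 1) (by omega) (by omega) (Sum.inl w) (by simp) h with
      ⟨h1, h2⟩ | ⟨h1, h2⟩
    · left; rw [h1]; congr 1; omega
    · right; rw [h1]; congr 1; omega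
  · have hj := j.2
    rw [← subdivPath_int] at h ⊢
    obtain ⟨rfl, h1 | h1⟩ := hl.adj_int e (mem_univ _) e' (mem_univ _) (i + 1) (j + 1) (by omega)
      (by omega) (by omega) (by omega) h
    · right; congr 1; omega
    · left; congr 1; omega

/-- Short walks of a subdivision connect branch vertices only if they are equal or adjacent. -/
lemma adj_of_subdiv_walk {n r : ℕ} (hr : 1 ≤ r) {F : SimpleGraph (Fin n)} {u v : Fin n}
    (huv : u ≠ v) {m : ℕ} (hm : m < 2 * (r + 1)) (x : ℕ → Fin n ⊕ Σ _ : Edges F, Fin r)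
    (h0 : x 0 = Sum.inl u) (h1 : x m = Sum.inl v)
    (hx : ∀ i < m, (Subdiv F fun _ => r).Adj (x i) (x (i + 1))) : F.Adj u v := by
  let Φ₀ : Fin n → ℕ := fun w => if w = u then 0 else if F.Adj u w then r + 1 else 2 * (r + 1)
  let Φ : (Fin n ⊕ Σ _ : Edges F, Fin r) → ℕ := Sum.elim Φ₀ fun y =>
    min (Φ₀ y.1.1.1 + (y.2 + 1)) (Φ₀ y.1.1.2 + (r - y.2))
  have hedge : ∀ e : Edges F, Φ₀ e.1.1 ≤ Φ₀ e.1.2 + (r + 1) ∧ Φ₀ e.1.2 ≤ Φ₀ e.1.1 + (r + 1) := by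
    intro e
    have h := e.2.2
    simp only [Φ₀]
    constructor
    · by_cases h2 : e.1.2 = u
      · rw [h2] at h
        simp [h2, h.symm, h.ne]
      · split_ifs <;> omega
    · by_cases h2 : e.1.1 = u
      · rw [h2] at h
        simp [h2, h, h.ne']
      · split_ifs <;> omega
  have hrel : ∀ y z, subdivRel F (fun _ => r) y z → Φ y ≤ Φ z + 1 ∧ Φ z ≤ Φ y + 1 := by
    rintro (y | ⟨e, i⟩) (z | ⟨e', j⟩) h
    · obtain ⟨_, h⟩ := h
      exact absurd (show r = 0 from h) (by omega)
    · have := hedge e'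
      have hj : (j : ℕ) < r := j.2
      simp only [Φ, Sum.elim_inl, Sum.elim_inr]
      rcases h with ⟨rfl, h⟩ | ⟨rfl, h⟩
      · omega
      · have h : (j : ℕ) + 1 = r := h
        omega
    · exact h.elim
    · obtain ⟨rfl, h⟩ := h
      have hi : (i : ℕ) < r := i.2
      have hj : (j : ℕ) < r := j.2
      simp only [Φ, Sum.elim_inr]
      omega
  have hΦ : ∀ i ≤ m, Φ (x i) ≤ i := by
    intro i
    induction i with
    | zero => intro _; simp [h0, Φ, Φ₀]
    | succ i ih =>
      intro hi
      have h2 := ih (by omega)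
      have h3 := hx i (by omega)
      rw [Subdiv, fromRel_adj] at h3
      rcases h3.2 with h4 | h4
      · have := hrel _ _ h4; omega
      · have := hrel _ _ h4; omega
  have h2 := hΦ m le_rfl
  rw [h1] at h2
  by_contra hcon
  simp only [Φ, Φ₀, Sum.elim_inl, huv.symm, hcon, if_false] at h2
  omega

/-- The path replacing an edge in a subdivision. -/
lemma exists_subdiv_path {k : ℕ} {H : SimpleGraph (Fin k)} (t : Edges H → ℕ) {a b : Fin k}
    (h : H.Adj a b) : ∃ e : Edges H, s(e.1.1, e.1.2) = s(a, b) ∧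
      ∃ q : ℕ → Fin k ⊕ Σ e : Edges H, Fin (t e), q 0 = Sum.inl a ∧ q (t e + 1) = Sum.inl b ∧
        (∀ i ≤ t e, (Subdiv H t).Adj (q i) (q (i + 1))) ∧
        ∀ i, 1 ≤ i → i ≤ t e → ∃ j, q i = Sum.inr ⟨e, j⟩ := by
  have key : ∀ e : Edges H, ∃ q : ℕ → Fin k ⊕ Σ e : Edges H, Fin (t e),
      q 0 = Sum.inl e.1.1 ∧ q (t e + 1) = Sum.inl e.1.2 ∧
        (∀ i ≤ t e, (Subdiv H t).Adj (q i) (q (i + 1))) ∧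
        ∀ i, 1 ≤ i → i ≤ t e → ∃ j, q i = Sum.inr ⟨e, j⟩ := by
    intro e
    let q : ℕ → Fin k ⊕ Σ e : Edges H, Fin (t e) := fun i =>
      if h : 1 ≤ i ∧ i ≤ t e then Sum.inr ⟨e, ⟨i - 1, by omega⟩⟩
      else if i = 0 then Sum.inl e.1.1 else Sum.inl e.1.2
    have hq0 : q 0 = Sum.inl e.1.1 := by simp [q]
    have hq1 : q (t e + 1) = Sum.inl e.1.2 := by simp [q]
    have hqi : ∀ i : Fin (t e), q (i + 1) = Sum.inr ⟨e, i⟩ := by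
      intro i
      have : (i : ℕ) + 1 ≤ t e := i.2
      simp [q, this]
    refine ⟨q, hq0, hq1, fun i hi => ?_, fun i h1 h2 => ⟨⟨i - 1, by omega⟩, by
      rw [← hqi]; congr 1; simp; omega⟩⟩
    rw [Subdiv, fromRel_adj]
    rcases Nat.eq_zero_or_pos i with rfl | hpos
    · rcases Nat.eq_zero_or_pos (t e) with hte | hte
      · have : q (0 + 1) = Sum.inl e.1.2 := by rw [← hq1, hte]
        rw [hq0, this]
        exact ⟨fun hh => e.2.1.ne (Sum.inl_injective hh), Or.inl ⟨e.2, hte⟩⟩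
      · rw [hq0, show q (0 + 1) = Sum.inr ⟨e, ⟨0, hte⟩⟩ from hqi ⟨0, hte⟩]
        exact ⟨by simp, Or.inl (Or.inl ⟨rfl, rfl⟩)⟩
    · obtain ⟨j, rfl⟩ : ∃ j : Fin (t e), i = j + 1 := ⟨⟨i - 1, by omega⟩, by simp; omega⟩
      rcases Nat.lt_or_ge (j + 1) (t e) with hlt | hge
      · rw [hqi, show q (j + 1 + 1) = Sum.inr ⟨e, ⟨j + 1, hlt⟩⟩ from hqi ⟨j + 1, hlt⟩]
        exact ⟨by simp [Fin.ext_iff], Or.inl ⟨rfl, rfl⟩⟩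
      · have : (j : ℕ) + 1 = t e := by omega
        rw [hqi, this, hq1]
        exact ⟨by simp, Or.inr (Or.inr ⟨rfl, this⟩)⟩
  rcases lt_or_gt_of_ne h.ne with hlt | hlt
  · let e : Edges H := ⟨(a, b), hlt, h⟩
    exact ⟨e, rfl, key e⟩
  · let e : Edges H := ⟨(b, a), hlt, h.symm⟩
    obtain ⟨q, h1, h2, h3, h4⟩ := key e
    refine ⟨e, Sym2.eq_swap, fun i => q (t e + 1 - i), by simpa using h2, by simpa using h1,
      fun i hi => ?_, fun i hi1 hi2 => h4 _ (by omega) (by omega)⟩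
    have := (h3 (t e - i) (by omega)).symm
    rwa [show t e - i = t e + 1 - (i + 1) by omega,
      show t e + 1 - (i + 1) + 1 = t e + 1 - i by omega] at this

end

section
open scoped Classical
open Finset

lemma exists_branch_of_subdiv {k n r : ℕ} {H : SimpleGraph (Fin k)} {F : SimpleGraph (Fin n)}
    {t : Edges H → ℕ} (f : Subdiv H t →g Subdiv F fun _ => r) (hf : Function.Injective f)
    {a : Fin k} {b : Fin 3 → Fin k} (hb : Function.Injective b) (hab : ∀ i, H.Adj a (b i)) :
    ∃ u, f (Sum.inl a) = Sum.inl u := by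
  choose e he q hq0 hq1 hq hqi using fun i => exists_subdiv_path t (hab i)
  have hinj : Function.Injective fun i => q i 1 := by
    intro i j hij
    dsimp only at hij
    refine hb ?_
    rcases Nat.eq_zero_or_pos (t (e i)) with hi | hi <;>
      rcases Nat.eq_zero_or_pos (t (e j)) with hj | hj
    · have h1 := hq1 i
      have h2 := hq1 j
      rw [hi, zero_add] at h1
      rw [hj, zero_add] at h2
      exact Sum.inl_injective (h1.symm.trans (hij.trans h2))
    · have h1 := hq1 i
      rw [hi, zero_add] at h1
      obtain ⟨l, h2⟩ := hqi j 1 le_rfl hj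
      rw [h1, h2] at hij
      cases hij
    · have h1 := hq1 j
      rw [hj, zero_add] at h1
      obtain ⟨l, h2⟩ := hqi i 1 le_rfl hi
      rw [h1, h2] at hij
      cases hij
    · obtain ⟨l, h1⟩ := hqi i 1 le_rfl hi
      obtain ⟨l', h2⟩ := hqi j 1 le_rfl hj
      rw [h1, h2] at hij
      have h3 : e i = e j := (Sigma.mk.inj (Sum.inr_injective hij)).1
      have h4 := he i
      rw [h3, he j] at h4
      exact (Sym2.congr_right.1 h4).symm
  rcases hfa : f (Sum.inl a) with u | ⟨ε, l⟩
  · exact ⟨u, rfl⟩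
  · have hnb : ∀ i, f (q i 1) ∈ ({subdivPath F r ε l, subdivPath F r ε (l + 2)} : Finset _) := by
      intro i
      have h := f.map_rel (hq i 0 (Nat.zero_le _))
      rw [hq0, hfa] at h
      rw [mem_insert, mem_singleton]
      exact subdiv_adj_inr h
    have h := card_le_card_of_injOn (s := (univ : Finset (Fin 3))) (fun i => f (q i 1))
      (fun i _ => hnb i) (fun i _ j _ h => hinj (hf h))
    have := h.trans card_le_two
    simp at this

lemma omegaTM_le_three {V : Type} {G : SimpleGraph V} {n r : ℕ} (hr : 1 ≤ r)
    {F : SimpleGraph (Fin n)} (hF : F.Colorable 2) (ψ : G →g Subdiv F fun _ => r)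
    (hψ : Function.Injective ψ) : omegaTM (r + 1) G ≤ 3 := by
  refine csSup_le' ?_
  rintro _ ⟨k, H, ⟨t, ht, f₀, hf₀⟩, rfl⟩
  by_contra hcon
  obtain ⟨φ, hφ⟩ := isSubgraphOf_omegaNum H
  let f : Subdiv H t →g Subdiv F fun _ => r := ψ.comp f₀
  have hf : Function.Injective f := hψ.comp hf₀
  let a : Fin 4 → Fin k := fun i => φ (Fin.castLE (by omega) i)
  have ha : Function.Injective a := fun i j h => Fin.castLE_injective _ (hφ h)
  have hadj : ∀ i j, i ≠ j → H.Adj (a i) (a j) := fun i j hij => φ.map_rel (by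
    rw [top_adj]
    exact fun h => hij (Fin.castLE_injective _ h))
  have hbr : ∀ i, ∃ u, f (Sum.inl (a i)) = Sum.inl u := fun i =>
    exists_branch_of_subdiv f hf (b := fun j => a (i.succAbove j))
      (ha.comp i.succAbove_right_injective) fun j => hadj _ _ (i.succAbove_ne j).symm
  choose u hu using hbr
  have huF : ∀ i j, i ≠ j → F.Adj (u i) (u j) := by
    intro i j hij
    obtain ⟨e, -, q, hq0, hq1, hq, -⟩ := exists_subdiv_path t (hadj i j hij)
    refine adj_of_subdiv_walk hr (fun h => hij (ha ?_)) (m := t e + 1) ?_ (fun l => f (q l))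
      (by rw [hq0, hu]) (by rw [hq1, hu]) fun l hl => f.map_rel (hq l (by omega))
    · exact Sum.inl_injective (hf (by rw [hu, hu, h]))
    · have := ht e
      omega
  obtain ⟨κ⟩ := hF
  have h1 := κ.valid (huF 0 1 (by decide))
  have h2 := κ.valid (huF 1 2 (by decide))
  have h3 := κ.valid (huF 0 2 (by decide))
  omega

lemma exists_iso_fin {W : Type} [Fintype W] (K : SimpleGraph W) :
    ∃ (N : ℕ) (G : SimpleGraph (Fin N)), Nonempty (G ≃g K) :=
  ⟨_, _, ⟨(Iso.map (Fintype.equivFin W) K).symm⟩⟩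

/-- An induced subdivision of `H` contains one of a bipartite graph with many edges. -/
lemma MemITM.exists_bipartite {V : Type} {G : SimpleGraph V} {r n : ℕ} (hr : 1 ≤ r)
    {H : SimpleGraph (Fin n)} (h : MemITM r G H) : ∃ F : SimpleGraph (Fin n), MemITM r G F ∧
      F.Colorable 2 ∧ Fintype.card (Edges H) ≤ 4 * Fintype.card (Edges F) := by
  obtain ⟨R, hR⟩ := exists_half_edges H
  obtain ⟨φ⟩ := h
  have hl := (isInducedLinkage_subdiv H hr).map φ
  set S : Finset V := (univ.map Function.Embedding.inl).map φ.toEmbedding with hS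
  have hSn : #S = n := by simp [hS]
  set E : Finset (Edges H) := {e | e.1.1 ∈ R ∧ e.1.2 ∉ R} with hE
  have hlE := hl.subset subset_rfl (subset_univ E) (fun e _ => hl.left_mem e (mem_univ _))
    (fun e _ => hl.right_mem e (mem_univ _))
  obtain ⟨F, σ, -, hσ, hF, hmem⟩ := hlE.exists_memITM hr
  have hcard := hlE.card_le_ncard_edgeSet F σ hσ hF
  have hcol : F.Colorable 2 := by
    let T : Finset V := (R.map Function.Embedding.inl).map φ.toEmbedding
    have hT : ∀ v, φ (Sum.inl v) ∈ T ↔ v ∈ R := by simp [T]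
    refine ⟨fun i => if σ i ∈ T then 0 else 1, fun {i j} hij => ?_⟩
    obtain ⟨e, he, h⟩ := (hF i j).1 hij
    have he := (mem_filter.1 he).2
    rw [subdivPath_zero, subdivPath_last] at h
    have h1 := (hT e.1.1).2 he.1
    have h2 : φ (Sum.inl e.1.2) ∉ T := fun h => he.2 ((hT e.1.2).1 h)
    rcases Sym2.eq_iff.1 h with ⟨h3, h4⟩ | ⟨h3, h4⟩ <;> rw [← h3, ← h4] <;> simp [h1, h2]
  have hlast := hR.trans (Nat.mul_le_mul_left 4 (hcard.trans (ncard_edgeSet_le_card_edges F)))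
  clear_value S
  subst hSn
  exact ⟨F, hmem, hcol, hlast⟩

lemma avgDeg_le_of_weaklyChiPBounded {C : GraphClass} (hC : Hereditary C) {r : ℕ} (hr : 1 ≤ r)
    (h : WeaklyChiPBounded C (r + 2)) :
    ∃ d : ℝ, ∀ ⦃m : ℕ⦄ (H : SimpleGraph (Fin m)), MemITMClass r C H → avgDeg H ≤ d := by
  obtain ⟨g, hg⟩ := h
  set N := (range 4).sup g with hN
  refine ⟨2 * (4 * (2 ^ N * (r + 2)) : ℕ), fun n H ⟨N', G, hG, hH⟩ =>
    avgDeg_le_of_card_edges_le ?_⟩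
  obtain ⟨F, ⟨φ⟩, hcol, hcard⟩ := hH.exists_bipartite hr
  obtain ⟨N₁, K, ⟨ψ⟩⟩ := exists_iso_fin (Subdiv F fun _ => r)
  have hK : K ∈ C N₁ := hC G K hG ⟨φ.comp ψ.toEmbedding⟩
  have hω : omegaTM (r + 2 - 1) K ≤ 3 := omegaTM_le_three hr hcol ψ.toHom ψ.injective
  have hχ : chiP K (r + 2) ≤ N := (hg K hK).trans (le_sup (mem_range.2 (by omega)))
  obtain ⟨c, hc⟩ := exists_chiP_coloring K (r + 2)
  have h1 := ((isInducedLinkage_subdiv F hr).map ψ.symm.toEmbedding).card_le_of_coloring c hc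
  rw [card_univ, card_map, card_map, card_univ, Fintype.card_fin] at h1
  have h2 : 2 ^ chiP K (r + 2) ≤ 2 ^ N := Nat.pow_le_pow_right two_pos hχ
  calc Fintype.card (Edges H) ≤ 4 * Fintype.card (Edges F) := hcard
    _ ≤ 4 * (2 ^ N * (n * (r + 2))) := Nat.mul_le_mul_left 4 (h1.trans (Nat.mul_le_mul_right _ h2))
    _ = _ := by ring

end

/-- characterization of hereditary classes that are weakly `χ_p`-bounded
for every positive integer `p`. -/
theorem weakly_chiP_bounded_tfae (C : GraphClass) (hC : Hereditary C) :
    List.TFAE [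
      -- (i) weakly χ_p-bounded for every positive p
      ∀ p : ℕ, 1 ≤ p → WeaklyChiPBounded C p,
      -- (ii) 𝒞 and all classes ITM_r^e(𝒞) (r ≥ 1) are χ-bounded
      ChiBounded C ∧ ∀ r : ℕ, 1 ≤ r →
        ChiBounded (fun m => {H : SimpleGraph (Fin m) | MemITMClass r C H}),
      -- (iii) 𝒞 is χ-bounded and d̄(ITM_r^e(𝒞)) < ∞ for every positive r
      ChiBounded C ∧ ∀ r : ℕ, 1 ≤ r → ∃ d : ℝ,
        ∀ ⦃m : ℕ⦄ (H : SimpleGraph (Fin m)), MemITMClass r C H → avgDeg H ≤ d,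
      -- (iv) 𝒞 is χ-bounded and χ_p is bounded in terms of bω
      ChiBounded C ∧ ∀ p : ℕ, 1 ≤ p → ∃ f : ℕ → ℕ,
        ∀ ⦃n : ℕ⦄ (G : SimpleGraph (Fin n)), G ∈ C n → chiP G p ≤ f (bomega G),
      -- (v) 𝒞 is χ-bounded and the K_{s,s}-free graphs of 𝒞 form a strongly
      -- χ_p-bounded class for all positive s and p
      ChiBounded C ∧ ∀ s : ℕ, 1 ≤ s → ∀ p : ℕ, 1 ≤ p →
        StronglyChiPBounded (fun n => {G : SimpleGraph (Fin n) | G ∈ C n ∧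
          ¬ IsInducedSubgraphOf (completeBipartiteGraph (Fin s) (Fin s)) G}) p
    ] := by
  tfae_have 1 → 3 := fun h => ⟨chiBounded_of_weaklyChiPBounded hC (h 1 le_rfl), fun r hr =>
    avgDeg_le_of_weaklyChiPBounded hC hr (h (r + 2) (by omega))⟩
  tfae_have 3 → 2 := fun h => ⟨h.1, fun r hr => (h.2 r hr).elim fun _ => chiBounded_memITM hr⟩
  tfae_have 2 → 3 := fun h => ⟨h.1, fun r hr => avgDeg_le_of_chiBounded hr (h.2 _ (by omega))⟩
  tfae_have 3 → 4 := fun h => ⟨h.1, fun p _ => chiP_le_bomega h.1 h.2 p⟩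
  tfae_have 4 → 5 := fun h => ⟨h.1, fun s _ p hp => stronglyChiPBounded_of_bomega h.1 (h.2 p hp) s⟩
  tfae_have 5 → 4 := fun h => ⟨h.1, fun p hp =>
    bomega_bound_of_stronglyChiPBounded fun s hs => h.2 s hs p hp⟩
  tfae_have 4 → 1 := fun h p hp => weaklyChiPBounded_of_bomega h.1 hp (h.2 p hp)
  tfae_finish
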